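/- (Backward uniqueness for the heat operator.) Let n ≥ 1, R > 0, T > 0, and let u : (ℝⁿ∖B_R(0))×[0,T] → ℝⁿ be a function of class C^{2,1} (continuous together with ∂ₜu, ∇u and ∇²u) on (ℝⁿ∖B_R(0))×[0,T]. Assume: (a) |∂ₜu + Δu| ≤ c₁(|∇u| + |u|) on (ℝⁿ∖B_R(0))×[0,T] for some constant c₁ > 0; (b) u(x,0) = 0 for all x ∈ ℝⁿ∖B_R(0); (c) |u(x,t)| ≤ exp(M|x|²) for all (x,t) ∈ (ℝⁿ∖B_R(0))×[0,T] and some M > 0. Then u ≡ 0 on (ℝⁿ∖B_R(0))×[0,T]. -/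

import Mathlib

open MeasureTheory Set Metric
open scoped ENNReal NNReal BigOperators
noncomputable section

/-- The exterior region `ℝⁿ ∖ B_R(0)` (the complement of the open ball of radius `R`). -/
def extRegion (n : ℕ) (R : ℝ) : Set (EuclideanSpace ℝ (Fin n)) :=
  {x : EuclideanSpace ℝ (Fin n) | R ≤ ‖x‖}

section Auxiliary

section LineDeriv
variable {V : Type*} [AddCommGroup V] [Module ℝ V]

lemma HasLineDerivAt.add_real {f g : V → ℝ} {f' g' : ℝ} {x v : V} (hf : HasLineDerivAt ℝ f f' x v)
    (hg : HasLineDerivAt ℝ g g' x v) : HasLineDerivAt ℝ (fun y => f y + g y) (f' + g') x v :=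
  HasDerivAt.fun_add hf hg

lemma HasLineDerivAt.sub_real {f g : V → ℝ} {f' g' : ℝ} {x v : V} (hf : HasLineDerivAt ℝ f f' x v)
    (hg : HasLineDerivAt ℝ g g' x v) : HasLineDerivAt ℝ (fun y => f y - g y) (f' - g') x v :=
  HasDerivAt.fun_sub hf hg

lemma HasLineDerivAt.mul_real {f g : V → ℝ} {f' g' : ℝ} {x v : V} (hf : HasLineDerivAt ℝ f f' x v)
    (hg : HasLineDerivAt ℝ g g' x v) :
    HasLineDerivAt ℝ (fun y => f y * g y) (f' * g x + f x * g') x v := by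
  have := HasDerivAt.fun_mul hf hg
  simpa [HasLineDerivAt] using this

lemma HasLineDerivAt.const_mul_real {g : V → ℝ} {g' : ℝ} {x v : V} (c : ℝ)
    (hg : HasLineDerivAt ℝ g g' x v) :
    HasLineDerivAt ℝ (fun y => c * g y) (c * g') x v :=
  HasDerivAt.const_mul c hg

lemma HasLineDerivAt.exp_real {g : V → ℝ} {g' : ℝ} {x v : V}
    (hg : HasLineDerivAt ℝ g g' x v) :
    HasLineDerivAt ℝ (fun y => Real.exp (g y)) (Real.exp (g x) * g') x v := by
  have := HasDerivAt.exp hg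
  simpa [HasLineDerivAt] using this

lemma HasLineDerivAt.sum_real {ι : Type*} {s : Finset ι} {f : ι → V → ℝ} {f' : ι → ℝ} {x v : V}
    (hf : ∀ i ∈ s, HasLineDerivAt ℝ (f i) (f' i) x v) :
    HasLineDerivAt ℝ (fun y => ∑ i ∈ s, f i y) (∑ i ∈ s, f' i) x v :=
  HasDerivAt.fun_sum hf

end LineDeriv

variable {n : ℕ}

/-- The divergence theorem for compactly supported fields, in coordinates. -/
lemma integral_lineDeriv_eq_zero {X X' : EuclideanSpace ℝ (Fin n) → ℝ} {e : EuclideanSpace ℝ (Fin n)}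
    (hX : ∀ x, HasLineDerivAt ℝ X (X' x) x e)
    (hi : Integrable X) (hi' : Integrable X') : ∫ x, X' x = 0 := by
  have := integral_bilinear_hasLineDerivAt_right_eq_neg_left_of_integrable
    (μ := (volume : Measure (EuclideanSpace ℝ (Fin n)))) (f := X) (f' := X')
    (g := fun _ => (1:ℝ)) (g' := fun _ => 0) (v := e) (B := ContinuousLinearMap.mul ℝ ℝ)
    (by simpa using hi') (by simp) (by simpa using hi) (fun x _ => hX x)
    (fun x _ => hasDerivAt_const _ _)
  simpa using this

/-- A scalar function `v` of class `C^{2,1}` on `[0,T] × Ω`, with time derivative `vt`, first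
partial derivatives `d i` and second partial derivatives `dd i j = ∂ᵢ∂ⱼv`. -/
structure IsC21 (T : ℝ) (Ω : Set (EuclideanSpace ℝ (Fin n)))
    (v vt : ℝ → EuclideanSpace ℝ (Fin n) → ℝ)
    (d : Fin n → ℝ → EuclideanSpace ℝ (Fin n) → ℝ)
    (dd : Fin n → Fin n → ℝ → EuclideanSpace ℝ (Fin n) → ℝ) : Prop where
  cont : ContinuousOn (Function.uncurry v) (Icc 0 T ×ˢ Ω)
  cont_t : ContinuousOn (Function.uncurry vt) (Icc 0 T ×ˢ Ω)
  cont_d : ∀ i, ContinuousOn (Function.uncurry (d i)) (Icc 0 T ×ˢ Ω)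
  cont_dd : ∀ i j, ContinuousOn (Function.uncurry (dd i j)) (Icc 0 T ×ˢ Ω)
  deriv_t : ∀ t ∈ Ioo 0 T, ∀ x ∈ Ω, HasDerivAt (fun s => v s x) (vt t x) t
  deriv_d : ∀ t ∈ Icc 0 T, ∀ x ∈ Ω, ∀ i,
    HasLineDerivAt ℝ (v t) (d i t x) x (EuclideanSpace.single i 1)
  deriv_dd : ∀ t ∈ Icc 0 T, ∀ x ∈ Ω, ∀ i j,
    HasLineDerivAt ℝ (d j t) (dd i j t x) x (EuclideanSpace.single i 1)
  symm : ∀ t ∈ Icc 0 T, ∀ x ∈ Ω, ∀ i j, dd i j t x = dd j i t x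

/-- Time slices of jointly continuous functions are continuous. -/
lemma ContinuousOn.slice_continuous {T : ℝ} {f : ℝ → EuclideanSpace ℝ (Fin n) → ℝ}
    (hf : ContinuousOn (Function.uncurry f) (Icc 0 T ×ˢ univ)) {t : ℝ} (ht : t ∈ Icc 0 T) :
    Continuous (f t) :=
  hf.comp_continuous (f := fun x => (t, x)) (by fun_prop) (fun x => ⟨ht, mem_univ x⟩)

lemma Continuous.integrable_of_vanish {f : EuclideanSpace ℝ (Fin n) → ℝ} (hf : Continuous f)
    {K : Set (EuclideanSpace ℝ (Fin n))} (hK : IsCompact K) (h : ∀ x ∉ K, f x = 0) :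
    Integrable f :=
  hf.integrable_of_hasCompactSupport (HasCompactSupport.intro hK h)

/-- Limit of integrated difference quotients. -/
lemma tendsto_integral_slope {T : ℝ} {a a' w : ℝ → EuclideanSpace ℝ (Fin n) → ℝ}
    {K : Set (EuclideanSpace ℝ (Fin n))} (hK : IsCompact K)
    (ha : ContinuousOn (Function.uncurry a) (Icc 0 T ×ˢ univ))
    (ha' : ContinuousOn (Function.uncurry a') (Icc 0 T ×ˢ univ))
    (hw : ContinuousOn (Function.uncurry w) (Icc 0 T ×ˢ univ))
    (hd : ∀ t ∈ Ioo 0 T, ∀ x, HasDerivAt (fun s => a s x) (a' t x) t)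
    (hwK : ∀ t ∈ Icc 0 T, ∀ x ∉ K, w t x = 0) {t : ℝ} (ht : t ∈ Ioo 0 T) :
    Filter.Tendsto (fun s => ∫ x, (s - t)⁻¹ * (a s x - a t x) * w s x) (nhdsWithin t {t}ᶜ)
      (nhds (∫ x, a' t x * w t x)) := by
  have hcpt : IsCompact (Icc 0 T ×ˢ K) := isCompact_Icc.prod hK
  obtain ⟨A, hA⟩ := hcpt.exists_bound_of_continuousOn (ha'.mono (prod_mono_right (subset_univ K)))
  obtain ⟨W, hW⟩ := hcpt.exists_bound_of_continuousOn (hw.mono (prod_mono_right (subset_univ K)))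
  have hIoo : ∀ᶠ s in nhdsWithin t {t}ᶜ, s ∈ Ioo 0 T ∧ s ≠ t :=
    (Filter.eventually_iff.2 (nhdsWithin_le_nhds (Ioo_mem_nhds ht.1 ht.2))).and
      self_mem_nhdsWithin
  refine tendsto_integral_filter_of_dominated_convergence (K.indicator fun _ => A * W) ?_ ?_ ?_ ?_
  · filter_upwards [hIoo] with s hs
    have h1 := ha.slice_continuous (Ioo_subset_Icc_self hs.1)
    have h2 := ha.slice_continuous (Ioo_subset_Icc_self ht)
    have h3 := hw.slice_continuous (Ioo_subset_Icc_self hs.1)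
    exact (by fun_prop : Continuous fun x => (s - t)⁻¹ * (a s x - a t x) * w s x).aestronglyMeasurable
  · filter_upwards [hIoo] with s hs
    refine Filter.Eventually.of_forall fun x => ?_
    by_cases hx : x ∈ K
    · rw [indicator_of_mem hx, norm_mul]
      have hmv : ‖a s x - a t x‖ ≤ A * ‖s - t‖ := by
        refine (convex_Ioo 0 T).norm_image_sub_le_of_norm_hasDerivWithin_le
          (f := fun s => a s x) (f' := fun s => a' s x)
          (fun r hr => (hd r hr x).hasDerivWithinAt) (fun r hr => ?_) ht hs.1
        exact hA (r, x) ⟨Ioo_subset_Icc_self hr, hx⟩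
      have hWx := hW (s, x) ⟨Ioo_subset_Icc_self hs.1, hx⟩
      have hst : 0 < ‖s - t‖ := norm_pos_iff.2 (sub_ne_zero.2 hs.2)
      have h1 : ‖(s - t)⁻¹ * (a s x - a t x)‖ ≤ A := by
        rw [norm_mul, norm_inv, inv_mul_le_iff₀ hst, mul_comm]; exact hmv
      exact mul_le_mul h1 hWx (norm_nonneg _) ((norm_nonneg _).trans h1)
    · rw [indicator_of_notMem hx, hwK s (Ioo_subset_Icc_self hs.1) x hx]; simp
  · exact (integrable_indicator_iff hK.measurableSet).2 (integrableOn_const hK.measure_ne_top)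
  · refine Filter.Eventually.of_forall fun x => ?_
    have h1 := (hasDerivAt_iff_tendsto_slope.1 (hd t ht x))
    have h2 : Filter.Tendsto (fun s => w s x) (nhdsWithin t {t}ᶜ) (nhds (w t x)) := by
      have hc : ContinuousOn (fun s => w s x) (Icc 0 T) :=
        hw.comp (f := fun s => (s, x)) (by fun_prop) (fun s hs => ⟨hs, mem_univ x⟩)
      exact ((hc.continuousAt (Icc_mem_nhds ht.1 ht.2)).tendsto).mono_left nhdsWithin_le_nhds
    simpa [slope, smul_eq_mul] using h1.mul h2

/-- A weighted Rellich identity: the integral of the divergence of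
`e^g (F v ∇v - v²∇F/2 + F v²∇g/2 - 2(∇g·∇v)∇v + |∇v|²∇g)` vanishes. -/
lemma integral_weighted_rellich {v g F : EuclideanSpace ℝ (Fin n) → ℝ}
    {d gd Fd : Fin n → EuclideanSpace ℝ (Fin n) → ℝ}
    {dd gdd Fdd : Fin n → Fin n → EuclideanSpace ℝ (Fin n) → ℝ}
    {K : Set (EuclideanSpace ℝ (Fin n))} (hK : IsCompact K)
    (hv : Continuous v) (hg : Continuous g) (hF : Continuous F)
    (hd : ∀ i, Continuous (d i)) (hgd : ∀ i, Continuous (gd i)) (hFd : ∀ i, Continuous (Fd i))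
    (hdd : ∀ i j, Continuous (dd i j)) (hgdd : ∀ i j, Continuous (gdd i j))
    (hFdd : ∀ i j, Continuous (Fdd i j))
    (vK : ∀ x ∉ K, v x = 0) (dK : ∀ i, ∀ x ∉ K, d i x = 0) (ddK : ∀ i j, ∀ x ∉ K, dd i j x = 0)
    (Dv : ∀ x i, HasLineDerivAt ℝ v (d i x) x (EuclideanSpace.single i 1))
    (Dg : ∀ x i, HasLineDerivAt ℝ g (gd i x) x (EuclideanSpace.single i 1))
    (DF : ∀ x i, HasLineDerivAt ℝ F (Fd i x) x (EuclideanSpace.single i 1))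
    (Dd : ∀ x i j, HasLineDerivAt ℝ (d j) (dd i j x) x (EuclideanSpace.single i 1))
    (Dgd : ∀ x i j, HasLineDerivAt ℝ (gd j) (gdd i j x) x (EuclideanSpace.single i 1))
    (DFd : ∀ x i j, HasLineDerivAt ℝ (Fd j) (Fdd i j x) x (EuclideanSpace.single i 1))
    (symm : ∀ x i j, dd i j x = dd j i x) :
    ∫ x, Real.exp (g x) * (F x * v x * (∑ i, dd i i x + ∑ i, gd i x * d i x)
      + F x * ∑ i, d i x ^ 2 - 1 / 2 * v x ^ 2 * ∑ i, Fdd i i x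
      + F x * v x * ∑ i, gd i x * d i x
      + 1 / 2 * F x * v x ^ 2 * (∑ i, gdd i i x + ∑ i, gd i x ^ 2)
      - 2 * (∑ i, gd i x * d i x) * (∑ i, dd i i x + ∑ i, gd i x * d i x)
      - 2 * ∑ i, ∑ j, gdd i j x * d j x * d i x
      + (∑ i, d i x ^ 2) * (∑ i, gdd i i x + ∑ i, gd i x ^ 2)) = 0 := by
  set X : Fin n → EuclideanSpace ℝ (Fin n) → ℝ := fun i x => Real.exp (g x) *
    (F x * v x * d i x - 1 / 2 * (v x * v x) * Fd i x + 1 / 2 * (F x * (v x * v x)) * gd i x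
      - 2 * (∑ j, gd j x * d j x) * d i x + (∑ j, d j x * d j x) * gd i x) with hX
  set X' : Fin n → EuclideanSpace ℝ (Fin n) → ℝ := fun i x => Real.exp (g x) *
    (gd i x * (F x * v x * d i x - 1 / 2 * (v x * v x) * Fd i x
        + 1 / 2 * (F x * (v x * v x)) * gd i x
        - 2 * (∑ j, gd j x * d j x) * d i x + (∑ j, d j x * d j x) * gd i x)
      + F x * d i x * d i x + F x * v x * dd i i x
      - 1 / 2 * (v x * v x) * Fdd i i x
      + 1 / 2 * (Fd i x * (v x * v x)) * gd i x + F x * v x * d i x * gd i x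
      + 1 / 2 * (F x * (v x * v x)) * gdd i i x
      - 2 * (∑ j, gdd i j x * d j x * d i x) - 2 * (∑ j, gd j x * dd i j x * d i x)
      - 2 * (∑ j, gd j x * d j x) * dd i i x
      + 2 * (∑ j, gd i x * dd i j x * d j x) + (∑ j, d j x * d j x) * gdd i i x) with hX'
  have hder : ∀ i x, HasLineDerivAt ℝ (X i) (X' i x) x (EuclideanSpace.single i 1) := by
    intro i x
    have hG : HasLineDerivAt ℝ (fun x => ∑ j, gd j x * d j x)
        (∑ j, (gdd i j x * d j x + gd j x * dd i j x)) x (EuclideanSpace.single i 1) :=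
      HasLineDerivAt.sum_real fun j _ => (Dgd x i j).mul_real (Dd x i j)
    have hN : HasLineDerivAt ℝ (fun x => ∑ j, d j x * d j x)
        (∑ j, (dd i j x * d j x + d j x * dd i j x)) x (EuclideanSpace.single i 1) :=
      HasLineDerivAt.sum_real fun j _ => (Dd x i j).mul_real (Dd x i j)
    have hvv := (Dv x i).mul_real (Dv x i)
    have key := (Dg x i).exp_real.mul_real
      ((((((DF x i).mul_real (Dv x i)).mul_real (Dd x i i)).sub_real
        ((hvv.const_mul_real (1/2)).mul_real (DFd x i i))).add_real
        ((((DF x i).mul_real hvv).const_mul_real (1/2)).mul_real (Dgd x i i))).sub_real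
        ((hG.const_mul_real 2).mul_real (Dd x i i)) |>.add_real (hN.mul_real (Dgd x i i)))
    convert key using 1
    simp only [hX', Finset.sum_add_distrib]
    have e1 : ∑ j, gdd i j x * d j x * d i x = (∑ j, gdd i j x * d j x) * d i x := by
      rw [Finset.sum_mul]
    have e2 : ∑ j, gd j x * dd i j x * d i x = (∑ j, gd j x * dd i j x) * d i x := by
      rw [Finset.sum_mul]
    have e3 : ∑ j, gd i x * dd i j x * d j x = gd i x * ∑ j, dd i j x * d j x := by
      rw [Finset.mul_sum]; exact Finset.sum_congr rfl fun j _ => by ring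
    have e4 : ∑ j, d j x * dd i j x = ∑ j, dd i j x * d j x :=
      Finset.sum_congr rfl fun j _ => by ring
    rw [e1, e2, e3, e4]
    ring
  have hXc : ∀ i, Continuous (X i) := fun i => by simp only [hX]; fun_prop
  have hX'c : ∀ i, Continuous (X' i) := fun i => by simp only [hX']; fun_prop
  have hXi : ∀ i, Integrable (X i) := fun i => (hXc i).integrable_of_vanish hK fun x hx => by
    simp [hX, vK x hx, fun j => dK j x hx]
  have hX'i : ∀ i, Integrable (X' i) := fun i => (hX'c i).integrable_of_vanish hK fun x hx => by
    simp [hX', vK x hx, fun j => dK j x hx, fun j k => ddK j k x hx]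
  have hsum : ∫ x, ∑ i, X' i x = 0 := by
    rw [integral_finsetSum _ fun i _ => hX'i i]
    exact Finset.sum_eq_zero fun i _ => integral_lineDeriv_eq_zero (hder i) (hXi i) (hX'i i)
  rw [← hsum]
  refine integral_congr_ae (Filter.Eventually.of_forall fun x => ?_)
  simp only [hX', ← Finset.mul_sum]
  congr 1
  have hsym : ∑ i, ∑ j, gd j x * dd i j x * d i x = ∑ i, ∑ j, gd i x * dd i j x * d j x := by
    rw [Finset.sum_comm]
    exact Finset.sum_congr rfl fun i _ => Finset.sum_congr rfl fun j _ => by rw [symm x j i]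
  have hN : ∑ j, d j x ^ 2 = ∑ j, d j x * d j x :=
    Finset.sum_congr rfl fun j _ => by ring
  rw [hN]
  generalize hGd : ∑ j, gd j x * d j x = G
  generalize hNd : ∑ j, d j x * d j x = N
  refine Eq.trans (b := ∑ i, (F x * v x * dd i i x + 2 * (F x * v x) * (gd i x * d i x)
      + F x * (d i x * d i x) - 1 / 2 * v x ^ 2 * Fdd i i x
      + 1 / 2 * F x * v x ^ 2 * (gdd i i x + gd i x ^ 2) - 2 * G * (dd i i x + gd i x * d i x)
      - 2 * (∑ j, gdd i j x * d j x * d i x) - 2 * (∑ j, gd j x * dd i j x * d i x)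
      + 2 * (∑ j, gd i x * dd i j x * d j x) + N * (gdd i i x + gd i x ^ 2)))
      ?_ (Finset.sum_congr rfl fun i _ => by ring)
  simp only [Finset.sum_add_distrib, Finset.sum_sub_distrib, ← Finset.mul_sum, hGd, hNd, hsym]
  ring

/-- The derivative of the weighted energy `∫ (|∇v|² + F v²/2) e^g`, before integrating by parts
in the interior. -/
lemma hasDerivAt_energy_raw {T : ℝ} {v vt g gt F Ft : ℝ → EuclideanSpace ℝ (Fin n) → ℝ}
    {d gd Fd : Fin n → ℝ → EuclideanSpace ℝ (Fin n) → ℝ}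
    {dd gdd Fdd : Fin n → Fin n → ℝ → EuclideanSpace ℝ (Fin n) → ℝ}
    {K : Set (EuclideanSpace ℝ (Fin n))} (hK : IsCompact K)
    (hv : IsC21 T univ v vt d dd) (hg : IsC21 T univ g gt gd gdd) (hF : IsC21 T univ F Ft Fd Fdd)
    (vK : ∀ t ∈ Icc 0 T, ∀ x ∉ K, v t x = 0) (vtK : ∀ t ∈ Icc 0 T, ∀ x ∉ K, vt t x = 0)
    (dK : ∀ i, ∀ t ∈ Icc 0 T, ∀ x ∉ K, d i t x = 0)
    (ddK : ∀ i j, ∀ t ∈ Icc 0 T, ∀ x ∉ K, dd i j t x = 0)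
    {t : ℝ} (ht : t ∈ Ioo 0 T) :
    HasDerivAt (fun t => ∫ x, (∑ i, d i t x ^ 2 + 1 / 2 * F t x * v t x ^ 2) * Real.exp (g t x))
      (∫ x, (vt t x * ((-2 * (∑ i, dd i i t x + ∑ i, gd i t x * d i t x)
        + 1 / 2 * F t x * v t x) * Real.exp (g t x))
        + Real.exp (g t x) * gt t x * (∑ i, d i t x ^ 2)
        + (1 / 2 * ((Ft t x * v t x + F t x * vt t x) * Real.exp (g t x)
          + F t x * v t x * (Real.exp (g t x) * gt t x))) * v t x)) t := by
  have htI := Ioo_subset_Icc_self ht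
  have cv := hv.cont; have cvt := hv.cont_t; have cd := hv.cont_d; have cdd := hv.cont_dd
  have cg := hg.cont; have cgt := hg.cont_t; have cgd := hg.cont_d
  have cF := hF.cont; have cFt := hF.cont_t
  have sv := fun {s} (hs : s ∈ Icc 0 T) => cv.slice_continuous hs
  have svt := fun {s} (hs : s ∈ Icc 0 T) => cvt.slice_continuous hs
  have sg := fun {s} (hs : s ∈ Icc 0 T) => cg.slice_continuous hs
  have sgt := fun {s} (hs : s ∈ Icc 0 T) => cgt.slice_continuous hs
  have sF := fun {s} (hs : s ∈ Icc 0 T) => cF.slice_continuous hs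
  have sFt := fun {s} (hs : s ∈ Icc 0 T) => cFt.slice_continuous hs
  have sd := fun {s} (hs : s ∈ Icc 0 T) i => (cd i).slice_continuous hs
  have sgd := fun {s} (hs : s ∈ Icc 0 T) i => (cgd i).slice_continuous hs
  have sdd := fun {s} (hs : s ∈ Icc 0 T) i j => (cdd i j).slice_continuous hs
  have svt0 := sv htI; have svtt := svt htI; have sgt0 := sg htI; have sgtt := sgt htI
  have sF0 := sF htI; have sFtt := sFt htI; have sd0 := sd htI; have sgd0 := sgd htI
  have sdd0 := sdd htI
  have L1 := tendsto_integral_slope (w := fun s x => -((∑ i, (dd i i s x + dd i i t x)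
      + ∑ i, gd i t x * (d i s x + d i t x)) * Real.exp (g t x))
      + 1 / 2 * F t x * v t x * Real.exp (g t x)) hK cv cvt (by unfold Function.uncurry; fun_prop)
    (fun t ht x => hv.deriv_t t ht x (mem_univ x)) (fun s hs x hx => by
      simp [vK t htI x hx, fun j => dK j t htI x hx, fun j k => ddK j k t htI x hx,
        fun j => dK j s hs x hx, fun j k => ddK j k s hs x hx]) ht
  have L2 := tendsto_integral_slope (a := fun s x => Real.exp (g s x))
    (a' := fun s x => Real.exp (g s x) * gt s x)
    (w := fun s x => ∑ i, d i s x ^ 2) hK (by unfold Function.uncurry; fun_prop)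
    (by unfold Function.uncurry; fun_prop) (by unfold Function.uncurry; fun_prop)
    (fun t ht x => (hg.deriv_t t ht x (mem_univ x)).exp) (fun s hs x hx => by
      simp [fun j => dK j s hs x hx]) ht
  have L3 := tendsto_integral_slope (a := fun s x => 1 / 2 * (F s x * v s x * Real.exp (g s x)))
    (a' := fun s x => 1 / 2 * ((Ft s x * v s x + F s x * vt s x) * Real.exp (g s x)
          + F s x * v s x * (Real.exp (g s x) * gt s x)))
    (w := v) hK (by unfold Function.uncurry; fun_prop)
    (by unfold Function.uncurry; fun_prop) cv
    (fun t ht x => (((hF.deriv_t t ht x (mem_univ x)).mul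
      (hv.deriv_t t ht x (mem_univ x))).mul (hg.deriv_t t ht x (mem_univ x)).exp).const_mul _) vK ht
  rw [hasDerivAt_iff_tendsto_slope]
  have L := (L1.add L2).add L3
  refine (L.congr' ?_).trans_eq ?_
  · have hIoo : ∀ᶠ s in nhdsWithin t {t}ᶜ, s ∈ Ioo 0 T :=
      Filter.eventually_iff.2 (nhdsWithin_le_nhds (Ioo_mem_nhds ht.1 ht.2))
    filter_upwards [hIoo] with s hs
    have hsI := Ioo_subset_Icc_self hs
    have svs := sv hsI; have sgs := sg hsI; have sFs := sF hsI; have sds := sd hsI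
    have sdds := sdd hsI
    have hdiv : ∫ x, ∑ i, (((d i s x - d i t x) * (d i s x + d i t x)
        + (v s x - v t x) * (dd i i s x + dd i i t x)) * Real.exp (g t x)
        + (v s x - v t x) * (d i s x + d i t x) * (Real.exp (g t x) * gd i t x)) = 0 := by
      rw [integral_finsetSum]
      · refine Finset.sum_eq_zero fun i _ => integral_lineDeriv_eq_zero
          (X := fun x => (v s x - v t x) * (d i s x + d i t x) * Real.exp (g t x))
          (e := EuclideanSpace.single i 1) (fun x => ?_) ?_ ?_
        · exact ((((hv.deriv_d s hsI x trivial i).sub_real (hv.deriv_d t htI x trivial i)).mul_real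
            ((hv.deriv_dd s hsI x trivial i i).add_real (hv.deriv_dd t htI x trivial i i))).mul_real
            (hg.deriv_d t htI x trivial i).exp_real)
        · refine Continuous.integrable_of_vanish (by fun_prop) hK fun x hx => ?_
          simp [vK t htI x hx, vK s hsI x hx]
        · refine Continuous.integrable_of_vanish (by fun_prop) hK fun x hx => ?_
          simp [vK t htI x hx, vK s hsI x hx, fun j => dK j t htI x hx, fun j => dK j s hsI x hx]
      · intro i _
        refine Continuous.integrable_of_vanish (by fun_prop) hK fun x hx => ?_
        simp [vK t htI x hx, vK s hsI x hx, fun j => dK j t htI x hx, fun j => dK j s hsI x hx]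
    simp only [slope, vsub_eq_sub, smul_eq_mul]
    have hQ : ∀ r ∈ Icc 0 T, Integrable fun x =>
        (∑ i, d i r x ^ 2 + 1 / 2 * F r x * v r x ^ 2) * Real.exp (g r x) := by
      intro r hr
      have svs := sv hr; have sgs := sg hr; have sFs := sF hr; have sds := sd hr
      refine Continuous.integrable_of_vanish (by fun_prop) hK fun x hx => ?_
      simp [vK r hr x hx, fun j => dK j r hr x hx]
    rw [← integral_sub (hQ s hsI) (hQ t htI), ← integral_const_mul]
    rw [← integral_add, ← integral_add, ← add_zero (∫ _, _ ∂_),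
      ← mul_zero (s - t)⁻¹, ← hdiv, ← integral_const_mul, ← integral_add]
    · refine integral_congr_ae (Filter.Eventually.of_forall fun x => ?_)
      have e1 : ∑ i, (((d i s x - d i t x) * (d i s x + d i t x)
        + (v s x - v t x) * (dd i i s x + dd i i t x)) * Real.exp (g t x)
        + (v s x - v t x) * (d i s x + d i t x) * (Real.exp (g t x) * gd i t x))
        = ((∑ i, d i s x ^ 2 - ∑ i, d i t x ^ 2)
          + (v s x - v t x) * (∑ i, (dd i i s x + dd i i t x)
          + ∑ i, gd i t x * (d i s x + d i t x))) * Real.exp (g t x) := by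
        rw [← Finset.sum_sub_distrib, ← Finset.sum_add_distrib, Finset.mul_sum,
          ← Finset.sum_add_distrib, Finset.sum_mul]
        exact Finset.sum_congr rfl fun i _ => by ring
      simp only [e1]
      ring
    all_goals
      refine Continuous.integrable_of_vanish (by fun_prop) hK fun x hx => ?_
      simp [vK t htI x hx, vK s hsI x hx, fun j => dK j t htI x hx, fun j => dK j s hsI x hx]
  · congr 1
    rw [← integral_add, ← integral_add]
    · refine integral_congr_ae (Filter.Eventually.of_forall fun x => ?_)
      simp only [mul_add, Finset.sum_add_distrib]
      ring
    all_goals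
      refine Continuous.integrable_of_vanish (by fun_prop) hK fun x hx => ?_
      simp [vK t htI x hx, vtK t htI x hx, fun j => dK j t htI x hx]

/-- A function and its derivatives vanish outside `K`. -/
structure VanishOff (T : ℝ) (K : Set (EuclideanSpace ℝ (Fin n)))
    (v vt : ℝ → EuclideanSpace ℝ (Fin n) → ℝ)
    (d : Fin n → ℝ → EuclideanSpace ℝ (Fin n) → ℝ)
    (dd : Fin n → Fin n → ℝ → EuclideanSpace ℝ (Fin n) → ℝ) : Prop where
  val : ∀ t ∈ Icc 0 T, ∀ x ∉ K, v t x = 0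
  time : ∀ t ∈ Icc 0 T, ∀ x ∉ K, vt t x = 0
  grad : ∀ i, ∀ t ∈ Icc 0 T, ∀ x ∉ K, d i t x = 0
  hess : ∀ i j, ∀ t ∈ Icc 0 T, ∀ x ∉ K, dd i j t x = 0

/-- The derivative of the weighted energy is bounded below by a quadratic form when the Hessian
of the weight exponent is `γ` times the identity. -/
lemma hasDerivAt_energy {T : ℝ} {v vt g gt F Ft : ℝ → EuclideanSpace ℝ (Fin n) → ℝ}
    {d gd Fd : Fin n → ℝ → EuclideanSpace ℝ (Fin n) → ℝ}
    {dd gdd Fdd : Fin n → Fin n → ℝ → EuclideanSpace ℝ (Fin n) → ℝ} {γ : ℝ → ℝ}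
    {K : Set (EuclideanSpace ℝ (Fin n))} (hK : IsCompact K)
    (hv : IsC21 T univ v vt d dd) (hg : IsC21 T univ g gt gd gdd) (hF : IsC21 T univ F Ft Fd Fdd)
    (hvK : VanishOff T K v vt d dd)
    (hFg : ∀ t ∈ Icc 0 T, ∀ x, F t x = gt t x - ∑ i, gdd i i t x - ∑ i, gd i t x ^ 2)
    (hγ : ∀ t ∈ Icc 0 T, ∀ x i j, gdd i j t x = if i = j then γ t else 0)
    {t : ℝ} (ht : t ∈ Ioo 0 T) :
    ∃ Q' : ℝ,
      HasDerivAt (fun t => ∫ x, (∑ i, d i t x ^ 2 + 1 / 2 * F t x * v t x ^ 2) * Real.exp (g t x))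
        Q' t ∧
      ∫ x, (-1 / 2 * (vt t x + ∑ i, dd i i t x) ^ 2 + 1 / 2 * (Ft t x + ∑ i, Fdd i i t x) * v t x ^ 2
        + 2 * γ t * ∑ i, d i t x ^ 2) * Real.exp (g t x) ≤ Q' := by
  refine ⟨_, hasDerivAt_energy_raw hK hv hg hF hvK.val hvK.time hvK.grad hvK.hess ht, ?_⟩
  have htI := Ioo_subset_Icc_self ht
  have cv := hv.cont.slice_continuous htI
  have cvt := hv.cont_t.slice_continuous htI
  have cd := fun i => (hv.cont_d i).slice_continuous htI
  have cdd := fun i j => (hv.cont_dd i j).slice_continuous htI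
  have cg := hg.cont.slice_continuous htI
  have cgt := hg.cont_t.slice_continuous htI
  have cgd := fun i => (hg.cont_d i).slice_continuous htI
  have cgdd := fun i j => (hg.cont_dd i j).slice_continuous htI
  have cF := hF.cont.slice_continuous htI
  have cFt := hF.cont_t.slice_continuous htI
  have cFd := fun i => (hF.cont_d i).slice_continuous htI
  have cFdd := fun i j => (hF.cont_dd i j).slice_continuous htI
  have R := integral_weighted_rellich hK cv cg cF cd cgd cFd cdd cgdd cFdd
    (hvK.val t htI) (fun i => hvK.grad i t htI) (fun i j => hvK.hess i j t htI)
    (fun x => hv.deriv_d t htI x trivial) (fun x => hg.deriv_d t htI x trivial)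
    (fun x => hF.deriv_d t htI x trivial) (fun x => hv.deriv_dd t htI x trivial)
    (fun x => hg.deriv_dd t htI x trivial) (fun x => hF.deriv_dd t htI x trivial)
    (fun x => hv.symm t htI x trivial)
  rw [← sub_nonneg, ← R, ← integral_sub]
  · rw [← sub_nonneg, ← integral_sub]
    · refine integral_nonneg fun x => ?_
      have e : ∑ i, ∑ j, gdd i j t x * d j t x * d i t x = γ t * ∑ i, d i t x ^ 2 := by
        rw [Finset.mul_sum]
        refine Finset.sum_congr rfl fun i _ => ?_
        simp [hγ t htI x, pow_two, mul_assoc]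
      have hgt : gt t x = F t x + (∑ i, gdd i i t x + ∑ i, gd i t x ^ 2) := by
        rw [hFg t htI x]; ring
      simp only [e, hgt]
      generalize ∑ i, gdd i i t x + ∑ i, gd i t x ^ 2 = A
      generalize ∑ i, gd i t x * d i t x = G
      generalize ∑ i, d i t x ^ 2 = N
      generalize ∑ i, dd i i t x = L
      generalize ∑ i, Fdd i i t x = H
      have : 0 ≤ Real.exp (g t x) * (2 * (L + G - 1 / 2 * F t x * v t x
        - 1 / 2 * (vt t x + L)) ^ 2) := by positivity
      refine this.trans_eq ?_
      ring
    all_goals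
      refine Continuous.integrable_of_vanish (by fun_prop) hK fun x hx => ?_
      simp [hvK.val t htI x hx, hvK.time t htI x hx, fun j => hvK.grad j t htI x hx,
        fun i j => hvK.hess i j t htI x hx]
  all_goals
    refine Continuous.integrable_of_vanish (by fun_prop) hK fun x hx => ?_
    simp [hvK.val t htI x hx, hvK.time t htI x hx, fun j => hvK.grad j t htI x hx,
      fun i j => hvK.hess i j t htI x hx]

lemma ContinuousOn.integrableOn_slab {a b T : ℝ} {φ : ℝ → EuclideanSpace ℝ (Fin n) → ℝ}
    {K S : Set (EuclideanSpace ℝ (Fin n))} (hK : IsCompact K) (hS : S ⊆ K)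
    (hφ : ContinuousOn (Function.uncurry φ) (Icc 0 T ×ˢ univ)) (ha : 0 ≤ a) (hb : b ≤ T) :
    IntegrableOn (Function.uncurry φ) (Icc a b ×ˢ S) :=
  ((hφ.mono (prod_mono (Icc_subset_Icc ha hb) (subset_univ K))).integrableOn_compact
    (isCompact_Icc.prod hK)).mono_set (prod_mono_right hS)

lemma setIntegral_slab {a b T : ℝ} {φ : ℝ → EuclideanSpace ℝ (Fin n) → ℝ}
    {K : Set (EuclideanSpace ℝ (Fin n))} (hK : IsCompact K)
    (hφ : ContinuousOn (Function.uncurry φ) (Icc 0 T ×ˢ univ))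
    (hφK : ∀ t ∈ Icc 0 T, ∀ x ∉ K, φ t x = 0) (ha : 0 ≤ a) (hab : a ≤ b) (hb : b ≤ T) :
    ∫ z in Icc a b ×ˢ K, Function.uncurry φ z = ∫ t in a..b, ∫ x, φ t x := by
  rw [intervalIntegral.integral_of_le hab, ← integral_Icc_eq_integral_Ioc,
    Measure.volume_eq_prod, setIntegral_prod _ (hφ.integrableOn_slab hK subset_rfl ha hb)]
  refine setIntegral_congr_fun measurableSet_Icc fun t ht => ?_
  exact setIntegral_eq_integral_of_forall_compl_eq_zero
    (hφK t ⟨ha.trans ht.1, ht.2.trans hb⟩)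

/-- Integrating a differential inequality `∫ φ ≤ Q'` in time. -/
lemma setIntegral_le_of_hasDerivAt {T T' : ℝ} {φ : ℝ → EuclideanSpace ℝ (Fin n) → ℝ} {Q : ℝ → ℝ}
    {K : Set (EuclideanSpace ℝ (Fin n))} (hK : IsCompact K)
    (hφ : ContinuousOn (Function.uncurry φ) (Icc 0 T ×ˢ univ))
    (hφK : ∀ t ∈ Icc 0 T, ∀ x ∉ K, φ t x = 0) (hQ : ContinuousOn Q (Icc 0 T))
    (hQ' : ∀ t ∈ Ioo 0 T, ∃ Q' : ℝ, HasDerivAt Q Q' t ∧ ∫ x, φ t x ≤ Q') (hT' : T' ∈ Icc 0 T) :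
    ∫ z in Icc 0 T' ×ˢ K, Function.uncurry φ z ≤ Q T' - Q 0 := by
  rw [setIntegral_slab hK hφ hφK le_rfl hT'.1 hT'.2]
  choose! q hq using hQ'
  have hsub : Ioo 0 T' ⊆ Ioo 0 T := Ioo_subset_Ioo_right hT'.2
  exact intervalIntegral.integral_le_sub_of_hasDeriv_right_of_le hT'.1
    (hQ.mono (Icc_subset_Icc_right hT'.2)) (fun t ht => (hq t (hsub ht)).1.hasDerivWithinAt)
    (((continuousOn_integral_of_compact_support hK hφ fun t x ht hx => hφK t ht x hx).mono
      (Icc_subset_Icc_right hT'.2)).integrableOn_Icc)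
    (fun t ht => (hq t (hsub ht)).2)

/-- Some time slice is bounded by the time average. -/
lemma exists_slice_le_average {T T₀ : ℝ} {φ : ℝ → EuclideanSpace ℝ (Fin n) → ℝ}
    {K : Set (EuclideanSpace ℝ (Fin n))} (hK : IsCompact K)
    (hφ : ContinuousOn (Function.uncurry φ) (Icc 0 T ×ˢ univ))
    (hφK : ∀ t ∈ Icc 0 T, ∀ x ∉ K, φ t x = 0) (h0 : 0 ≤ T₀) (hT : T₀ < T) :
    ∃ T' ∈ Icc T₀ T, ∫ x, φ T' x ≤
      (T - T₀)⁻¹ * ∫ z in Icc T₀ T ×ˢ K, Function.uncurry φ z := by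
  have hc : ContinuousOn (fun t => ∫ x, φ t x) (Icc T₀ T) :=
    (continuousOn_integral_of_compact_support hK hφ fun t x ht hx => hφK t ht x hx).mono
      (Icc_subset_Icc_left h0)
  obtain ⟨T', hT', hmin⟩ := isCompact_Icc.exists_isMinOn ⟨T₀, left_mem_Icc.2 hT.le⟩ hc
  refine ⟨T', hT', ?_⟩
  rw [le_inv_mul_iff₀ (sub_pos.2 hT), setIntegral_slab hK hφ hφK h0 hT.le le_rfl]
  have := intervalIntegral.integral_mono_on hT.le
    (intervalIntegrable_const (μ := volume) (c := ∫ x, φ T' x)) (hc.intervalIntegrable_of_Icc hT.le)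
    (fun t ht => hmin ht)
  simpa using this

/-- Integrated Carleman inequality for a scalar function, with a multiplier `m` in time. -/
lemma carleman_scalar {T T' : ℝ} {v vt g gt F Ft : ℝ → EuclideanSpace ℝ (Fin n) → ℝ}
    {d gd Fd : Fin n → ℝ → EuclideanSpace ℝ (Fin n) → ℝ}
    {dd gdd Fdd : Fin n → Fin n → ℝ → EuclideanSpace ℝ (Fin n) → ℝ} {γ m m' : ℝ → ℝ}
    {K : Set (EuclideanSpace ℝ (Fin n))} (hK : IsCompact K)
    (hv : IsC21 T univ v vt d dd) (hg : IsC21 T univ g gt gd gdd) (hF : IsC21 T univ F Ft Fd Fdd)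
    (hvK : VanishOff T K v vt d dd) (hv0 : ∀ x, v 0 x = 0) (hd0 : ∀ i x, d i 0 x = 0)
    (hFg : ∀ t ∈ Icc 0 T, ∀ x, F t x = gt t x - ∑ i, gdd i i t x - ∑ i, gd i t x ^ 2)
    (hγ : ∀ t ∈ Icc 0 T, ∀ x i j, gdd i j t x = if i = j then γ t else 0)
    (hγc : ContinuousOn γ (Icc 0 T))
    (hm : ∀ t ∈ Icc 0 T, HasDerivAt m (m' t) t) (hm' : ContinuousOn m' (Icc 0 T))
    (hm0 : ∀ t ∈ Icc 0 T, 0 ≤ m t) (hF0 : ∀ t ∈ Icc 0 T, ∀ x ∈ K, F t x ≤ 0)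
    (hT' : T' ∈ Icc 0 T) :
    ∫ z in Icc 0 T' ×ˢ K, Function.uncurry (fun t x =>
      (-1 / 2 * m t * (vt t x + ∑ i, dd i i t x) ^ 2
        + (1 / 2 * m t * (Ft t x + ∑ i, Fdd i i t x) + 1 / 2 * m' t * F t x) * v t x ^ 2
        + (2 * m t * γ t + m' t) * ∑ i, d i t x ^ 2) * Real.exp (g t x)) z ≤
      ∫ x, m T' * (∑ i, d i T' x ^ 2) * Real.exp (g T' x) := by
  have cv := hv.cont; have cvt := hv.cont_t; have cd := hv.cont_d; have cdd := hv.cont_dd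
  have cg := hg.cont; have cF := hF.cont; have cFt := hF.cont_t; have cFdd := hF.cont_dd
  have cm : ContinuousOn m (Icc 0 T) := fun t ht => (hm t ht).continuousAt.continuousWithinAt
  set q : ℝ → EuclideanSpace ℝ (Fin n) → ℝ := fun t x =>
    (∑ i, d i t x ^ 2 + 1 / 2 * F t x * v t x ^ 2) * Real.exp (g t x) with hq
  have cq : ContinuousOn (Function.uncurry q) (Icc 0 T ×ˢ univ) := by
    unfold q Function.uncurry at *; fun_prop
  have hqK : ∀ t x, t ∈ Icc 0 T → x ∉ K → q t x = 0 := fun t x ht hx => by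
    simp [hq, hvK.val t ht x hx, fun j => hvK.grad j t ht x hx]
  have hQc := continuousOn_integral_of_compact_support (μ := volume) hK cq hqK
  have key := setIntegral_le_of_hasDerivAt (T := T) (Q := fun t => m t * ∫ x, q t x) (φ := fun t x =>
      (-1 / 2 * m t * (vt t x + ∑ i, dd i i t x) ^ 2
        + (1 / 2 * m t * (Ft t x + ∑ i, Fdd i i t x) + 1 / 2 * m' t * F t x) * v t x ^ 2
        + (2 * m t * γ t + m' t) * ∑ i, d i t x ^ 2) * Real.exp (g t x)) hK
      (by
        unfold Function.uncurry at *
        fun_prop (disch := first | exact (fun p hp => And.left hp) | assumption))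
      (fun t ht x hx => by
        simp [hvK.val t ht x hx, hvK.time t ht x hx, fun j => hvK.grad j t ht x hx,
        fun i j => hvK.hess i j t ht x hx]) (cm.mul hQc) (fun t ht => by
      have htI := Ioo_subset_Icc_self ht
      obtain ⟨Q', h1, h2⟩ := hasDerivAt_energy hK hv hg hF hvK hFg hγ ht
      refine ⟨_, (hm t htI).mul h1, ?_⟩
      rw [← sub_le_iff_le_add']
      refine le_trans (le_of_eq ?_) (mul_le_mul_of_nonneg_left h2 (hm0 t htI))
      have cv := hv.cont.slice_continuous htI
      have cvt := hv.cont_t.slice_continuous htI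
      have cd := fun i => (hv.cont_d i).slice_continuous htI
      have cdd := fun i j => (hv.cont_dd i j).slice_continuous htI
      have cg := hg.cont.slice_continuous htI
      have cF := hF.cont.slice_continuous htI
      have cFt := hF.cont_t.slice_continuous htI
      have cFdd := fun i j => (hF.cont_dd i j).slice_continuous htI
      rw [← integral_const_mul, ← integral_const_mul, ← integral_sub]
      · refine integral_congr_ae (Filter.Eventually.of_forall fun x => ?_)
        dsimp only
        ring
      all_goals
        refine Continuous.integrable_of_vanish (by fun_prop) hK fun x hx => ?_
        simp [hvK.val t htI x hx, hvK.time t htI x hx, fun j => hvK.grad j t htI x hx,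
          fun i j => hvK.hess i j t htI x hx, hqK t x htI hx]) hT'
  refine key.trans ?_
  have h0 : ∫ x, q 0 x = 0 := by simp [hq, hv0, hd0]
  simp only [h0, mul_zero, sub_zero]
  rw [← integral_const_mul]
  have cv' := hv.cont.slice_continuous hT'
  have cd' := fun i => (hv.cont_d i).slice_continuous hT'
  have cg' := hg.cont.slice_continuous hT'
  have cF' := hF.cont.slice_continuous hT'
  refine integral_mono ?_ ?_ fun x => ?_
  · refine Continuous.integrable_of_vanish (by fun_prop) hK fun x hx => ?_
    simp [hqK T' x hT' hx]
  · refine Continuous.integrable_of_vanish (by fun_prop) hK fun x hx => ?_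
    simp [fun j => hvK.grad j T' hT' x hx]
  · by_cases hx : x ∈ K
    · have h1 : 1 / 2 * F T' x * v T' x ^ 2 ≤ 0 :=
        mul_nonpos_of_nonpos_of_nonneg (by linarith [hF0 T' hT' x hx]) (sq_nonneg _)
      simp only [hq, mul_assoc (m T')]
      refine mul_le_mul_of_nonneg_left (mul_le_mul_of_nonneg_right ?_ (Real.exp_pos _).le)
        (hm0 T' hT')
      linarith
    · have hq0 := hqK T' x hT' hx
      have hgrad := fun j => hvK.grad j T' hT' x hx
      simp [hq0, hgrad]

/-- The density `|u|² + |∇u|²` of a vector field with components `U k` and first partial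
derivatives `D k i`. -/
def energyDensity (U : Fin n → ℝ → EuclideanSpace ℝ (Fin n) → ℝ)
    (D : Fin n → Fin n → ℝ → EuclideanSpace ℝ (Fin n) → ℝ) (t : ℝ)
    (x : EuclideanSpace ℝ (Fin n)) : ℝ :=
  ∑ k, (U k t x ^ 2 + ∑ i, D k i t x ^ 2)

lemma energyDensity_nonneg (U : Fin n → ℝ → EuclideanSpace ℝ (Fin n) → ℝ)
    (D : Fin n → Fin n → ℝ → EuclideanSpace ℝ (Fin n) → ℝ) (t : ℝ)
    (x : EuclideanSpace ℝ (Fin n)) : 0 ≤ energyDensity U D t x := by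
  unfold energyDensity; positivity

/-- A `C^{2,1}` solution of `|∂ₜu + Δu|² ≤ c (|u|² + |∇u|²)` on `[0,T] × Ω` vanishing at time
zero, given through its components. -/
structure IsSubsol (T c : ℝ) (Ω : Set (EuclideanSpace ℝ (Fin n)))
    (U Ut : Fin n → ℝ → EuclideanSpace ℝ (Fin n) → ℝ)
    (D : Fin n → Fin n → ℝ → EuclideanSpace ℝ (Fin n) → ℝ)
    (DD : Fin n → Fin n → Fin n → ℝ → EuclideanSpace ℝ (Fin n) → ℝ) : Prop where
  regular : ∀ k, IsC21 T Ω (U k) (Ut k) (D k) (DD k)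
  ineq : ∀ t ∈ Icc 0 T, ∀ x ∈ Ω,
    ∑ k, (Ut k t x + ∑ i, DD k i i t x) ^ 2 ≤ c * energyDensity U D t x
  zero : ∀ k, ∀ x ∈ Ω, U k 0 x = 0

/-- A cutoff function supported in `K` and equal to one on `G`, with derivatives bounded in
terms of `B`. -/
structure IsCutoff (K G : Set (EuclideanSpace ℝ (Fin n))) (B : ℝ)
    (ζ : EuclideanSpace ℝ (Fin n) → ℝ) (ζd : Fin n → EuclideanSpace ℝ (Fin n) → ℝ)
    (ζdd : Fin n → Fin n → EuclideanSpace ℝ (Fin n) → ℝ) : Prop where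
  cont : Continuous ζ
  cont_d : ∀ i, Continuous (ζd i)
  cont_dd : ∀ i j, Continuous (ζdd i j)
  deriv : ∀ x i, HasLineDerivAt ℝ ζ (ζd i x) x (EuclideanSpace.single i 1)
  deriv_d : ∀ x i j, HasLineDerivAt ℝ (ζd j) (ζdd i j x) x (EuclideanSpace.single i 1)
  symm : ∀ x i j, ζdd i j x = ζdd j i x
  off : ∀ x ∉ K, ζ x = 0
  off_d : ∀ i, ∀ x ∉ K, ζd i x = 0
  off_dd : ∀ i j, ∀ x ∉ K, ζdd i j x = 0
  on : ∀ x ∈ G, ζ x = 1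
  on_d : ∀ i, ∀ x ∈ G, ζd i x = 0
  on_dd : ∀ i j, ∀ x ∈ G, ζdd i j x = 0
  sq_le : ∀ x, ζ x ^ 2 ≤ 1
  grad_le : ∀ x, ∑ i, ζd i x ^ 2 ≤ B
  lap_le : ∀ x, (∑ i, ζdd i i x) ^ 2 ≤ B

lemma ContinuousOn.cutoff_mul {T : ℝ} {Ω K : Set (EuclideanSpace ℝ (Fin n))} (hΩ : IsOpen Ω)
    (hK : IsCompact K) (hKΩ : K ⊆ Ω) {ζ : EuclideanSpace ℝ (Fin n) → ℝ}
    {f : ℝ → EuclideanSpace ℝ (Fin n) → ℝ} (hζ : Continuous ζ) (hζK : ∀ x ∉ K, ζ x = 0)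
    (hf : ContinuousOn (Function.uncurry f) (Icc 0 T ×ˢ Ω)) :
    ContinuousOn (Function.uncurry fun t x => ζ x * f t x) (Icc 0 T ×ˢ univ) := by
  intro p hp
  by_cases hpΩ : p.2 ∈ Ω
  · have h1 : ContinuousOn (Function.uncurry fun t x => ζ x * f t x) (Icc 0 T ×ˢ Ω) := by
      unfold Function.uncurry at *; fun_prop
    refine (h1 p ⟨hp.1, hpΩ⟩).mono_of_mem_nhdsWithin ?_
    rw [nhdsWithin_prod_eq, nhdsWithin_univ]
    exact Filter.prod_mem_prod self_mem_nhdsWithin (hΩ.mem_nhds hpΩ)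
  · have hpK : p.2 ∉ K := fun h => hpΩ (hKΩ h)
    have h1 : ContinuousAt (Function.uncurry fun t x => ζ x * f t x) p := by
      refine (continuousAt_const (y := (0 : ℝ))).congr ?_
      have : ∀ᶠ q : ℝ × EuclideanSpace ℝ (Fin n) in nhds p, q.2 ∈ Kᶜ :=
        continuous_snd.continuousAt.eventually (hK.isClosed.isOpen_compl.mem_nhds hpK)
      filter_upwards [this] with q hq
      simp [Function.uncurry, hζK q.2 hq]
    exact h1.continuousWithinAt

lemma HasLineDerivAt.of_vanish {K : Set (EuclideanSpace ℝ (Fin n))}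
    (hK : IsCompact K) {f : EuclideanSpace ℝ (Fin n) → ℝ} (hf : ∀ x ∉ K, f x = 0)
    {x : EuclideanSpace ℝ (Fin n)} (hx : x ∉ K) (e : EuclideanSpace ℝ (Fin n)) :
    HasLineDerivAt ℝ f 0 x e := by
  refine (hasDerivAt_const (0 : ℝ) (0 : ℝ)).congr_of_eventuallyEq ?_
  have hc : Continuous fun s : ℝ => x + s • e := by fun_prop
  have : ∀ᶠ s : ℝ in nhds 0, x + s • e ∈ Kᶜ :=
    hc.continuousAt.eventually (hK.isClosed.isOpen_compl.mem_nhds (by simpa using hx))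
  filter_upwards [this] with s hs
  exact hf _ hs

section Cutoff
variable {T c B : ℝ} {Ω K G : Set (EuclideanSpace ℝ (Fin n))}
  {ζ : EuclideanSpace ℝ (Fin n) → ℝ} {ζd : Fin n → EuclideanSpace ℝ (Fin n) → ℝ}
  {ζdd : Fin n → Fin n → EuclideanSpace ℝ (Fin n) → ℝ}

lemma IsCutoff.vanishOff (hζ : IsCutoff K G B ζ ζd ζdd)
    (v vt : ℝ → EuclideanSpace ℝ (Fin n) → ℝ) (d : Fin n → ℝ → EuclideanSpace ℝ (Fin n) → ℝ)
    (dd : Fin n → Fin n → ℝ → EuclideanSpace ℝ (Fin n) → ℝ) :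
    VanishOff T K (fun t x => ζ x * v t x) (fun t x => ζ x * vt t x)
      (fun i t x => ζd i x * v t x + ζ x * d i t x)
      (fun i j t x => ζdd i j x * v t x + ζd j x * d i t x + (ζd i x * d j t x + ζ x * dd i j t x))
    where
  val t _ x hx := by simp [hζ.off x hx]
  time t _ x hx := by simp [hζ.off x hx]
  grad i t _ x hx := by simp [hζ.off x hx, hζ.off_d i x hx]
  hess i j t _ x hx := by
    simp [hζ.off x hx, hζ.off_d i x hx, hζ.off_d j x hx, hζ.off_dd i j x hx]

lemma IsC21.cutoff (hΩ : IsOpen Ω) (hK : IsCompact K) (hKΩ : K ⊆ Ω)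
    (hζ : IsCutoff K G B ζ ζd ζdd) {v vt : ℝ → EuclideanSpace ℝ (Fin n) → ℝ}
    {d : Fin n → ℝ → EuclideanSpace ℝ (Fin n) → ℝ}
    {dd : Fin n → Fin n → ℝ → EuclideanSpace ℝ (Fin n) → ℝ} (hv : IsC21 T Ω v vt d dd) :
    IsC21 T univ (fun t x => ζ x * v t x) (fun t x => ζ x * vt t x)
      (fun i t x => ζd i x * v t x + ζ x * d i t x)
      (fun i j t x => ζdd i j x * v t x + ζd j x * d i t x
        + (ζd i x * d j t x + ζ x * dd i j t x)) := by
  have hvan := hζ.vanishOff (T := T) v vt d dd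
  have c0 := fun {f} => ContinuousOn.cutoff_mul (T := T) (f := f) hΩ hK hKΩ hζ.cont hζ.off
  have c1 := fun {f} i => ContinuousOn.cutoff_mul (T := T) (f := f) hΩ hK hKΩ (hζ.cont_d i)
    (hζ.off_d i)
  have c2 := fun {f} i j => ContinuousOn.cutoff_mul (T := T) (f := f) hΩ hK hKΩ (hζ.cont_dd i j)
    (hζ.off_dd i j)
  refine ⟨c0 hv.cont, c0 hv.cont_t, fun i => (c1 i hv.cont).add (c0 (hv.cont_d i)),
    fun i j => ((c2 i j hv.cont).add (c1 j (hv.cont_d i))).add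
      ((c1 i (hv.cont_d j)).add (c0 (hv.cont_dd i j))), ?_, ?_, ?_, ?_⟩
  · intro t ht x _
    by_cases hx : x ∈ Ω
    · exact (hv.deriv_t t ht x hx).const_mul _
    · simpa [hζ.off x fun h => hx (hKΩ h)] using hasDerivAt_const t (0 : ℝ)
  · intro t ht x _ i
    by_cases hx : x ∈ Ω
    · exact (hζ.deriv x i).mul_real (hv.deriv_d t ht x hx i)
    · have hxK : x ∉ K := fun h => hx (hKΩ h)
      rw [hvan.grad i t ht x hxK]
      exact HasLineDerivAt.of_vanish hK (hvan.val t ht) hxK _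
  · intro t ht x _ i j
    by_cases hx : x ∈ Ω
    · exact ((hζ.deriv_d x i j).mul_real (hv.deriv_d t ht x hx i)).add_real
        ((hζ.deriv x i).mul_real (hv.deriv_dd t ht x hx i j))
    · have hxK : x ∉ K := fun h => hx (hKΩ h)
      rw [hvan.hess i j t ht x hxK]
      exact HasLineDerivAt.of_vanish hK (hvan.grad j t ht) hxK _
  · intro t ht x _ i j
    by_cases hx : x ∈ Ω
    · rw [hζ.symm x i j, hv.symm t ht x hx i j]; ring
    · have hxK : x ∉ K := fun h => hx (hKΩ h)
      rw [hvan.hess i j t ht x hxK, hvan.hess j i t ht x hxK]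

lemma add_add_sq_le (a b c : ℝ) : (a + b + c) ^ 2 ≤ 3 * (a ^ 2 + b ^ 2 + c ^ 2) := by
  nlinarith [sq_nonneg (a - b), sq_nonneg (b - c), sq_nonneg (a - c)]

variable {U Ut : Fin n → ℝ → EuclideanSpace ℝ (Fin n) → ℝ}
  {D : Fin n → Fin n → ℝ → EuclideanSpace ℝ (Fin n) → ℝ}
  {DD : Fin n → Fin n → Fin n → ℝ → EuclideanSpace ℝ (Fin n) → ℝ}

lemma sum_sq_le_energyDensity (t : ℝ) (x : EuclideanSpace ℝ (Fin n)) :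
    ∑ k, U k t x ^ 2 ≤ energyDensity U D t x :=
  Finset.sum_le_sum fun k _ => le_add_of_nonneg_right (by positivity)

lemma sum_grad_sq_le_energyDensity (t : ℝ) (x : EuclideanSpace ℝ (Fin n)) :
    ∑ k, ∑ i, D k i t x ^ 2 ≤ energyDensity U D t x :=
  Finset.sum_le_sum fun k _ => le_add_of_nonneg_left (by positivity)

/-- The heat operator applied to a truncated function. -/
lemma IsSubsol.cutoff_heat_le (hU : IsSubsol T c Ω U Ut D DD) (hζ : IsCutoff K G B ζ ζd ζdd)
    {t : ℝ} (ht : t ∈ Icc 0 T) {x : EuclideanSpace ℝ (Fin n)} (hx : x ∈ Ω) :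
    ∑ k, (ζ x * Ut k t x + ∑ i, (ζdd i i x * U k t x + ζd i x * D k i t x
      + (ζd i x * D k i t x + ζ x * DD k i i t x))) ^ 2
      ≤ (3 * c + 15 * B) * energyDensity U D t x := by
  have h1 : ∀ k, (ζ x * Ut k t x + ∑ i, (ζdd i i x * U k t x + ζd i x * D k i t x
      + (ζd i x * D k i t x + ζ x * DD k i i t x))) ^ 2 ≤
      3 * ((Ut k t x + ∑ i, DD k i i t x) ^ 2 + B * U k t x ^ 2 + 4 * B * ∑ i, D k i t x ^ 2) := by
    intro k
    have e : ζ x * Ut k t x + ∑ i, (ζdd i i x * U k t x + ζd i x * D k i t x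
      + (ζd i x * D k i t x + ζ x * DD k i i t x)) =
        ζ x * (Ut k t x + ∑ i, DD k i i t x) + (∑ i, ζdd i i x) * U k t x
          + 2 * ∑ i, ζd i x * D k i t x := by
      simp only [Finset.sum_add_distrib, ← Finset.sum_mul, ← Finset.mul_sum]; ring
    rw [e]
    refine (add_add_sq_le _ _ _).trans (mul_le_mul_of_nonneg_left (add_le_add (add_le_add ?_ ?_) ?_)
      (by norm_num))
    · rw [mul_pow]; exact mul_le_of_le_one_left (sq_nonneg _) (hζ.sq_le x)
    · rw [mul_pow]; exact mul_le_mul_of_nonneg_right (hζ.lap_le x) (sq_nonneg _)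
    · rw [mul_pow, mul_assoc]
      have := (Finset.sum_mul_sq_le_sq_mul_sq Finset.univ (fun i => ζd i x) fun i => D k i t x).trans
        (mul_le_mul_of_nonneg_right (hζ.grad_le x) (by positivity))
      linarith
  have hB : 0 ≤ B := le_trans (by positivity) (hζ.grad_le x)
  refine (Finset.sum_le_sum fun k _ => h1 k).trans ?_
  rw [← Finset.mul_sum, Finset.sum_add_distrib, Finset.sum_add_distrib, ← Finset.mul_sum,
    ← Finset.mul_sum]
  have h2 := hU.ineq t ht x hx
  have h3 := mul_le_mul_of_nonneg_left (sum_sq_le_energyDensity (U := U) (D := D) t x) hB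
  have h4 := mul_le_mul_of_nonneg_left (sum_grad_sq_le_energyDensity (U := U) (D := D) t x) hB
  linarith

lemma IsCutoff.grad_cutoff_le (hζ : IsCutoff K G B ζ ζd ζdd)
    (t : ℝ) (x : EuclideanSpace ℝ (Fin n)) :
    ∑ k, ∑ i, (ζd i x * U k t x + ζ x * D k i t x) ^ 2
      ≤ 2 * (1 + B) * energyDensity U D t x := by
  have hB : 0 ≤ B := le_trans (by positivity) (hζ.grad_le x)
  have h1 : ∀ k, ∑ i, (ζd i x * U k t x + ζ x * D k i t x) ^ 2 ≤
      2 * (B * U k t x ^ 2 + ∑ i, D k i t x ^ 2) := by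
    intro k
    have : ∀ i, (ζd i x * U k t x + ζ x * D k i t x) ^ 2 ≤
        2 * (ζd i x ^ 2 * U k t x ^ 2 + D k i t x ^ 2) := fun i => by
      nlinarith [sq_nonneg (ζd i x * U k t x - ζ x * D k i t x),
        mul_le_mul_of_nonneg_right (hζ.sq_le x) (sq_nonneg (D k i t x))]
    refine (Finset.sum_le_sum fun i _ => this i).trans ?_
    rw [← Finset.mul_sum, Finset.sum_add_distrib, ← Finset.sum_mul]
    linarith [mul_le_mul_of_nonneg_right (hζ.grad_le x) (sq_nonneg (U k t x))]
  refine (Finset.sum_le_sum fun k _ => h1 k).trans ?_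
  rw [← Finset.mul_sum, Finset.sum_add_distrib, ← Finset.mul_sum]
  have h3 := mul_le_mul_of_nonneg_left (sum_sq_le_energyDensity (U := U) (D := D) t x) hB
  have h4 := sum_grad_sq_le_energyDensity (U := U) (D := D) t x
  linarith
end Cutoff

section Carleman
variable {T c B : ℝ} {Ω K G : Set (EuclideanSpace ℝ (Fin n))}
  {ζ : EuclideanSpace ℝ (Fin n) → ℝ} {ζd : Fin n → EuclideanSpace ℝ (Fin n) → ℝ}
  {ζdd : Fin n → Fin n → EuclideanSpace ℝ (Fin n) → ℝ}
  {U Ut : Fin n → ℝ → EuclideanSpace ℝ (Fin n) → ℝ}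
  {D : Fin n → Fin n → ℝ → EuclideanSpace ℝ (Fin n) → ℝ}
  {DD : Fin n → Fin n → Fin n → ℝ → EuclideanSpace ℝ (Fin n) → ℝ}

lemma IsSubsol.grad_zero (hΩ : IsOpen Ω) (hU : IsSubsol T c Ω U Ut D DD) (hT : 0 ≤ T)
    (k i : Fin n) {x : EuclideanSpace ℝ (Fin n)} (hx : x ∈ Ω) : D k i 0 x = 0 := by
  have h1 := (hU.regular k).deriv_d 0 ⟨le_rfl, hT⟩ x hx i
  have h2 : HasLineDerivAt ℝ (U k 0) 0 x (EuclideanSpace.single i 1) := by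
    refine (hasDerivAt_const (0 : ℝ) (0 : ℝ)).congr_of_eventuallyEq ?_
    have hc : Continuous fun s : ℝ => x + s • (EuclideanSpace.single i 1 : EuclideanSpace ℝ (Fin n)) := by
      fun_prop
    have : ∀ᶠ s : ℝ in nhds 0, x + s • EuclideanSpace.single i 1 ∈ Ω :=
      hc.continuousAt.eventually (hΩ.mem_nhds (by simpa using hx))
    filter_upwards [this] with s hs
    exact hU.zero k _ hs
  exact HasDerivAt.unique h1 h2

lemma IsSubsol.continuousOn_density (hU : IsSubsol T c Ω U Ut D DD) :
    ContinuousOn (fun z : ℝ × EuclideanSpace ℝ (Fin n) => energyDensity U D z.1 z.2)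
      (Icc 0 T ×ˢ Ω) := by
  have h0 := fun k => (hU.regular k).cont
  have h1 := fun k i => (hU.regular k).cont_d i
  unfold energyDensity
  unfold Function.uncurry at *
  fun_prop

lemma IsSubsol.integrableOn_weighted (hU : IsSubsol T c Ω U Ut D DD) (hK : IsCompact K)
    (hKΩ : K ⊆ Ω) {g : ℝ → EuclideanSpace ℝ (Fin n) → ℝ}
    (hg : ContinuousOn (Function.uncurry g) (Icc 0 T ×ˢ univ)) :
    IntegrableOn (fun z => energyDensity U D z.1 z.2 * Real.exp (g z.1 z.2)) (Icc 0 T ×ˢ K) := by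
  refine ContinuousOn.integrableOn_compact (isCompact_Icc.prod hK) ?_
  have h1 := hU.continuousOn_density.mono (prod_mono_right (s := Icc 0 T) hKΩ)
  have h2 := hg.mono (prod_mono_right (s := Icc 0 T) (subset_univ K))
  unfold Function.uncurry at *
  fun_prop

/-- Carleman inequality for truncated solutions. -/
lemma IsSubsol.carleman (hΩ : IsOpen Ω) (hK : IsCompact K) (hKΩ : K ⊆ Ω) (hc : 0 ≤ c)
    (hU : IsSubsol T c Ω U Ut D DD) (hζ : IsCutoff K G B ζ ζd ζdd) (hG : MeasurableSet G)
    {g gt F Ft : ℝ → EuclideanSpace ℝ (Fin n) → ℝ}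
    {gd Fd : Fin n → ℝ → EuclideanSpace ℝ (Fin n) → ℝ}
    {gdd Fdd : Fin n → Fin n → ℝ → EuclideanSpace ℝ (Fin n) → ℝ} {γ m m' : ℝ → ℝ}
    (hg : IsC21 T univ g gt gd gdd) (hF : IsC21 T univ F Ft Fd Fdd)
    (hFg : ∀ t ∈ Icc 0 T, ∀ x, F t x = gt t x - ∑ i, gdd i i t x - ∑ i, gd i t x ^ 2)
    (hγ : ∀ t ∈ Icc 0 T, ∀ x i j, gdd i j t x = if i = j then γ t else 0)
    (hγc : ContinuousOn γ (Icc 0 T))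
    (hm : ∀ t ∈ Icc 0 T, HasDerivAt m (m' t) t) (hm' : ContinuousOn m' (Icc 0 T))
    (hm0 : ∀ t ∈ Icc 0 T, 0 ≤ m t) (hF0 : ∀ t ∈ Icc 0 T, ∀ x ∈ K, F t x ≤ 0)
    {l Λ T₀ : ℝ} (hl : 0 ≤ l) (hmΛ : ∀ t ∈ Icc 0 T, m t ≤ Λ) (hT₀ : 0 ≤ T₀) (hT₀T : T₀ < T)
    (ha : ∀ t ∈ Icc 0 T, ∀ x ∈ K, l + c / 2 * m t ≤
      1 / 2 * m t * (Ft t x + ∑ i, Fdd i i t x) + 1 / 2 * m' t * F t x)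
    (hb : ∀ t ∈ Icc 0 T, l + c / 2 * m t ≤ 2 * m t * γ t + m' t)
    {N : Set (EuclideanSpace ℝ (Fin n))} (hN : N ⊆ K ∩ G) (hNm : MeasurableSet N) :
    l * ∫ z in Icc 0 T₀ ×ˢ N, energyDensity U D z.1 z.2 * Real.exp (g z.1 z.2) ≤
      Λ * ((3 * c + 15 * B) / 2 *
          (∫ z in Icc 0 T ×ˢ (K \ G), energyDensity U D z.1 z.2 * Real.exp (g z.1 z.2))
        + 2 * (1 + B) * ((T - T₀)⁻¹ *
          ∫ z in Icc T₀ T ×ˢ K, energyDensity U D z.1 z.2 * Real.exp (g z.1 z.2))) := by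
  have hT : 0 ≤ T := hT₀.trans hT₀T.le
  have hB : 0 ≤ B := le_trans (by positivity) (hζ.grad_le 0)
  have hΛ : 0 ≤ Λ := (hm0 0 ⟨le_rfl, hT⟩).trans (hmΛ 0 ⟨le_rfl, hT⟩)
  set W : ℝ × EuclideanSpace ℝ (Fin n) → ℝ :=
    fun z => energyDensity U D z.1 z.2 * Real.exp (g z.1 z.2) with hW
  have hW0 : ∀ z, 0 ≤ W z := fun z => mul_nonneg (energyDensity_nonneg _ _ _ _) (Real.exp_pos _).le
  have hWi : IntegrableOn W (Icc 0 T ×ˢ K) := hU.integrableOn_weighted hK hKΩ hg.cont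
  have hv := fun k => (hU.regular k).cutoff hΩ hK hKΩ hζ
  have hvK := fun k => hζ.vanishOff (T := T) (U k) (Ut k) (D k) (DD k)
  have cm : ContinuousOn m (Icc 0 T) := fun t ht => (hm t ht).continuousAt.continuousWithinAt
  have cd := fun k => (hv k).cont_d
  have cv := fun k => (hv k).cont
  have cvt := fun k => (hv k).cont_t
  have cdd := fun k => (hv k).cont_dd
  have cg := hg.cont
  have cF := hF.cont; have cFt := hF.cont_t; have cFdd := hF.cont_dd
  set v : Fin n → ℝ → EuclideanSpace ℝ (Fin n) → ℝ := fun k t x => ζ x * U k t x with hvdef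
  set vt : Fin n → ℝ → EuclideanSpace ℝ (Fin n) → ℝ := fun k t x => ζ x * Ut k t x with hvtdef
  set d : Fin n → Fin n → ℝ → EuclideanSpace ℝ (Fin n) → ℝ :=
    fun k i t x => ζd i x * U k t x + ζ x * D k i t x with hddef
  set dd : Fin n → Fin n → Fin n → ℝ → EuclideanSpace ℝ (Fin n) → ℝ :=
    fun k i j t x => ζdd i j x * U k t x + ζd j x * D k i t x
        + (ζd i x * D k j t x + ζ x * DD k i j t x) with hdddef
  set φ : ℝ → EuclideanSpace ℝ (Fin n) → ℝ := fun t x =>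
    m t * (∑ k, ∑ i, d k i t x ^ 2) * Real.exp (g t x) with hφ
  have cφ : ContinuousOn (Function.uncurry φ) (Icc 0 T ×ˢ univ) := by
    unfold φ Function.uncurry at *
    fun_prop (disch := first | exact (fun p hp => And.left hp) | assumption)
  have hφK : ∀ t ∈ Icc 0 T, ∀ x ∉ K, φ t x = 0 := fun t ht x hx => by
    have h : ∀ k i, d k i t x = 0 := fun k i => (hvK k).grad i t ht x hx
    simp [hφ, h]
  obtain ⟨T', hT', hslice⟩ := exists_slice_le_average hK cφ hφK hT₀ hT₀T
  have hT'I : T' ∈ Icc 0 T := ⟨hT₀.trans hT'.1, hT'.2⟩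
  set P : Fin n → ℝ × EuclideanSpace ℝ (Fin n) → ℝ := fun k => Function.uncurry (fun t x =>
      (-1 / 2 * m t * (vt k t x + ∑ i, dd k i i t x) ^ 2
        + (1 / 2 * m t * (Ft t x + ∑ i, Fdd i i t x) + 1 / 2 * m' t * F t x) * v k t x ^ 2
        + (2 * m t * γ t + m' t) * ∑ i, d k i t x ^ 2) * Real.exp (g t x)) with hP
  have hPi : ∀ k, IntegrableOn (P k) (Icc 0 T' ×ˢ K) := by
    intro k
    refine ContinuousOn.integrableOn_slab hK subset_rfl (T := T) ?_ le_rfl hT'.2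
    unfold Function.uncurry at *
    fun_prop (disch := first | exact (fun p hp => And.left hp) | assumption)
  have hcar : ∀ k, ∫ z in Icc 0 T' ×ˢ K, P k z ≤
      ∫ x, m T' * (∑ i, d k i T' x ^ 2) * Real.exp (g T' x) := fun k =>
    carleman_scalar hK (hv k) hg hF (hvK k)
      (fun x => by
        by_cases hx : x ∈ K
        · simp [hvdef, hU.zero k x (hKΩ hx)]
        · exact (hvK k).val 0 ⟨le_rfl, hT⟩ x hx)
      (fun i x => by
        by_cases hx : x ∈ K
        · simp [hddef, hU.zero k x (hKΩ hx), hU.grad_zero hΩ hT k i (hKΩ hx)]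
        · exact (hvK k).grad i 0 ⟨le_rfl, hT⟩ x hx) hFg hγ hγc hm hm' hm0 hF0 hT'I
  have hsum : ∫ z in Icc 0 T' ×ˢ K, ∑ k, P k z ≤ ∫ x, φ T' x := by
    rw [integral_finsetSum _ fun k _ => hPi k]
    refine (Finset.sum_le_sum fun k _ => hcar k).trans_eq ?_
    rw [← integral_finsetSum]
    · refine integral_congr_ae (Filter.Eventually.of_forall fun x => ?_)
      simp only [hφ, Finset.mul_sum, Finset.sum_mul]
    · intro k _
      have cd' := fun i => (cd k i).slice_continuous hT'I
      have cg' := cg.slice_continuous hT'I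
      refine Continuous.integrable_of_vanish (by fun_prop) hK fun x hx => ?_
      have h : ∀ i, d k i T' x = 0 := fun i => (hvK k).grad i T' hT'I x hx
      simp [h]
  have hφW : ∫ z in Icc T₀ T ×ˢ K, Function.uncurry φ z ≤
      Λ * (2 * (1 + B)) * ∫ z in Icc T₀ T ×ˢ K, W z := by
    rw [← integral_const_mul]
    refine setIntegral_mono_on (cφ.integrableOn_slab hK subset_rfl hT₀ le_rfl)
      ((hWi.mono_set (prod_mono_left (Icc_subset_Icc_left hT₀))).const_mul _)
      (measurableSet_Icc.prod hK.measurableSet) fun z hz => ?_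
    have ht : z.1 ∈ Icc 0 T := ⟨hT₀.trans hz.1.1, hz.1.2⟩
    have h1 := hζ.grad_cutoff_le (U := U) (D := D) z.1 z.2
    have h2 := mul_le_mul (hmΛ z.1 ht) h1 (by positivity) hΛ
    have h3 := mul_le_mul_of_nonneg_right h2 (Real.exp_pos (g z.1 z.2)).le
    refine h3.trans_eq ?_
    simp only [hW]; ring
  have hlow : l * (∫ z in Icc 0 T' ×ˢ N, W z) - Λ * ((3 * c + 15 * B) / 2) *
      (∫ z in Icc 0 T' ×ˢ (K \ G), W z) ≤ ∫ z in Icc 0 T' ×ˢ K, ∑ k, P k z := by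
    have hNK : Icc 0 T' ×ˢ N ⊆ Icc 0 T' ×ˢ K := prod_mono_right fun x hx => (hN hx).1
    have hGK : Icc 0 T' ×ˢ (K \ G) ⊆ Icc 0 T' ×ˢ K := prod_mono_right sdiff_subset
    have hNM : MeasurableSet (Icc 0 T' ×ˢ N) := measurableSet_Icc.prod hNm
    have hGM : MeasurableSet (Icc 0 T' ×ˢ (K \ G)) :=
      measurableSet_Icc.prod (hK.measurableSet.diff hG)
    have hWi' : IntegrableOn W (Icc 0 T' ×ˢ K) :=
      hWi.mono_set (prod_mono_left (Icc_subset_Icc_right hT'.2))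
    have e1 : ∫ z in Icc 0 T' ×ˢ N, W z =
        ∫ z in Icc 0 T' ×ˢ K, (Icc 0 T' ×ˢ N).indicator W z := by
      rw [setIntegral_indicator hNM, inter_eq_self_of_subset_right hNK]
    have e2 : ∫ z in Icc 0 T' ×ˢ (K \ G), W z =
        ∫ z in Icc 0 T' ×ˢ K, (Icc 0 T' ×ˢ (K \ G)).indicator W z := by
      rw [setIntegral_indicator hGM, inter_eq_self_of_subset_right hGK]
    rw [e1, e2, ← integral_const_mul, ← integral_const_mul, ← integral_sub
      ((hWi'.indicator hNM).const_mul _) ((hWi'.indicator hGM).const_mul _)]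
    refine setIntegral_mono_on (((hWi'.indicator hNM).const_mul _).sub
      ((hWi'.indicator hGM).const_mul _)) (integrable_finsetSum _ fun k _ => hPi k)
      (measurableSet_Icc.prod hK.measurableSet) fun z hz => ?_
    obtain ⟨t, x⟩ := z
    have ht : t ∈ Icc 0 T := ⟨hz.1.1, hz.1.2.trans hT'.2⟩
    have hxK : x ∈ K := hz.2
    have hPz : ∑ k, P k (t, x) = (-1 / 2 * m t * ∑ k, (vt k t x + ∑ i, dd k i i t x) ^ 2
        + (1 / 2 * m t * (Ft t x + ∑ i, Fdd i i t x) + 1 / 2 * m' t * F t x) * ∑ k, v k t x ^ 2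
        + (2 * m t * γ t + m' t) * ∑ k, ∑ i, d k i t x ^ 2) * Real.exp (g t x) := by
      simp only [hP, Function.uncurry_apply_pair]
      rw [← Finset.sum_mul, Finset.sum_add_distrib, Finset.sum_add_distrib, ← Finset.mul_sum,
        ← Finset.mul_sum, ← Finset.mul_sum]
    rw [hPz]
    have hat := ha t ht x hxK
    have hbt := hb t ht
    have hm0t := hm0 t ht
    set E := energyDensity U D t x with hE
    have hE0 : 0 ≤ E := energyDensity_nonneg _ _ _ _
    have hexp := (Real.exp_pos (g t x)).le
    by_cases hxG : x ∈ G
    · have hz2 : ((t, x) : ℝ × EuclideanSpace ℝ (Fin n)) ∉ Icc 0 T' ×ˢ (K \ G) :=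
        fun h => h.2.2 hxG
      rw [indicator_of_notMem hz2, mul_zero, sub_zero]
      have h1 : l * (Icc 0 T' ×ˢ N).indicator W (t, x) ≤ l * W (t, x) :=
        mul_le_mul_of_nonneg_left (indicator_le_self' (fun _ _ => hW0 _) _) hl
      refine h1.trans ?_
      simp only [hW, ← mul_assoc]
      refine mul_le_mul_of_nonneg_right ?_ hexp
      have f1 : ∑ k, (vt k t x + ∑ i, dd k i i t x) ^ 2 =
          ∑ k, (Ut k t x + ∑ i, DD k i i t x) ^ 2 := by
        simp [hvtdef, hdddef, hζ.on x hxG, fun i => hζ.on_d i x hxG, fun i j => hζ.on_dd i j x hxG]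
      have f2 : ∑ k, v k t x ^ 2 = ∑ k, U k t x ^ 2 := by simp [hvdef, hζ.on x hxG]
      have f3 : ∑ k, ∑ i, d k i t x ^ 2 = ∑ k, ∑ i, D k i t x ^ 2 := by
        simp [hddef, hζ.on x hxG, fun i => hζ.on_d i x hxG]
      rw [f1, f2, f3]
      have f4 : E = ∑ k, U k t x ^ 2 + ∑ k, ∑ i, D k i t x ^ 2 := by
        rw [hE, energyDensity, Finset.sum_add_distrib]
      have f5 := mul_le_mul_of_nonneg_left (hU.ineq t ht x (hKΩ hxK)) hm0t
      have p1 : 0 ≤ ∑ k, U k t x ^ 2 := by positivity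
      have p2 : 0 ≤ ∑ k, ∑ i, D k i t x ^ 2 := by positivity
      have q1 := mul_le_mul_of_nonneg_right hat p1
      have q2 := mul_le_mul_of_nonneg_right hbt p2
      change l * E ≤ _
      rw [← hE, f4] at f5
      rw [f4]
      linarith
    · have hz1 : ((t, x) : ℝ × EuclideanSpace ℝ (Fin n)) ∉ Icc 0 T' ×ˢ N :=
        fun h => hxG (hN h.2).2
      have hz2 : ((t, x) : ℝ × EuclideanSpace ℝ (Fin n)) ∈ Icc 0 T' ×ˢ (K \ G) :=
        ⟨hz.1, hxK, hxG⟩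
      rw [indicator_of_notMem hz1, indicator_of_mem hz2, mul_zero, zero_sub]
      simp only [hW, ← mul_assoc, ← neg_mul]
      refine mul_le_mul_of_nonneg_right ?_ hexp
      have g1 := hU.cutoff_heat_le hζ ht (hKΩ hxK)
      have g2 : m t * ∑ k, (vt k t x + ∑ i, dd k i i t x) ^ 2 ≤
          Λ * ((3 * c + 15 * B) * E) := by
        refine mul_le_mul (hmΛ t ht) g1 (by positivity) hΛ
      have p1 : 0 ≤ ∑ k, v k t x ^ 2 := by positivity
      have p2 : 0 ≤ ∑ k, ∑ i, d k i t x ^ 2 := by positivity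
      have hcm : 0 ≤ c / 2 * m t := by positivity
      have q1 := mul_le_mul_of_nonneg_right ((add_nonneg hl hcm).trans hat) p1
      have q2 := mul_le_mul_of_nonneg_right ((add_nonneg hl hcm).trans hbt) p2
      change -Λ * ((3 * c + 15 * B) / 2) * E ≤ _
      linarith
  have hmono1 : ∫ z in Icc 0 T₀ ×ˢ N, W z ≤ ∫ z in Icc 0 T' ×ˢ N, W z :=
    setIntegral_mono_set (hWi.mono_set (prod_mono (Icc_subset_Icc_right hT'.2)
      fun x hx => (hN hx).1)) (Filter.Eventually.of_forall hW0)
      (LE.le.eventuallyLE (prod_mono_left (Icc_subset_Icc_right hT'.1)))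
  have hmono2 : ∫ z in Icc 0 T' ×ˢ (K \ G), W z ≤ ∫ z in Icc 0 T ×ˢ (K \ G), W z :=
    setIntegral_mono_set (hWi.mono_set (prod_mono_right sdiff_subset))
      (Filter.Eventually.of_forall hW0)
      (LE.le.eventuallyLE (prod_mono_left (Icc_subset_Icc_right hT'.2)))
  have r1 := mul_le_mul_of_nonneg_left hmono1 hl
  have r2 := mul_le_mul_of_nonneg_left hmono2 (by positivity : 0 ≤ Λ * ((3 * c + 15 * B) / 2))
  have r3 := mul_le_mul_of_nonneg_left hφW (inv_nonneg.2 (sub_pos.2 hT₀T).le)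
  linarith
end Carleman

/-- The energy identity for a compactly supported function. -/
lemma hasDerivAt_integral_sq {T : ℝ} {v vt : ℝ → EuclideanSpace ℝ (Fin n) → ℝ}
    {d : Fin n → ℝ → EuclideanSpace ℝ (Fin n) → ℝ}
    {dd : Fin n → Fin n → ℝ → EuclideanSpace ℝ (Fin n) → ℝ}
    {K : Set (EuclideanSpace ℝ (Fin n))} (hK : IsCompact K)
    (hv : IsC21 T univ v vt d dd) (hvK : VanishOff T K v vt d dd) {t : ℝ} (ht : t ∈ Ioo 0 T) :
    HasDerivAt (fun t => ∫ x, v t x ^ 2)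
      (∫ x, (2 * v t x * (vt t x + ∑ i, dd i i t x) + 2 * ∑ i, d i t x ^ 2)) t := by
  have htI := Ioo_subset_Icc_self ht
  have cv := hv.cont; have cvt := hv.cont_t
  have sv := fun {s} (hs : s ∈ Icc 0 T) => cv.slice_continuous hs
  have sv0 := sv htI
  have svt := cvt.slice_continuous htI
  have sd := fun i => (hv.cont_d i).slice_continuous htI
  have sdd := fun i j => (hv.cont_dd i j).slice_continuous htI
  have L := tendsto_integral_slope (w := fun s x => v s x + v t x) hK cv cvt
    (by unfold Function.uncurry; fun_prop) (fun t ht x => hv.deriv_t t ht x (mem_univ x))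
    (fun s hs x hx => by simp [hvK.val t htI x hx, hvK.val s hs x hx]) ht
  have hdiv : ∫ x, ∑ i, (d i t x * d i t x + v t x * dd i i t x) = 0 := by
    rw [integral_finsetSum]
    · refine Finset.sum_eq_zero fun i _ => integral_lineDeriv_eq_zero
        (X := fun x => v t x * d i t x) (e := EuclideanSpace.single i 1)
        (fun x => (hv.deriv_d t htI x trivial i).mul_real (hv.deriv_dd t htI x trivial i i)) ?_ ?_
      all_goals
        refine Continuous.integrable_of_vanish (by fun_prop) hK fun x hx => ?_
        simp [hvK.val t htI x hx, hvK.grad i t htI x hx]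
    · intro i _
      refine Continuous.integrable_of_vanish (by fun_prop) hK fun x hx => ?_
      simp [hvK.val t htI x hx, hvK.grad i t htI x hx]
  rw [hasDerivAt_iff_tendsto_slope]
  refine (L.congr' ?_).trans_eq ?_
  · have hIoo : ∀ᶠ s in nhdsWithin t {t}ᶜ, s ∈ Ioo 0 T :=
      Filter.eventually_iff.2 (nhdsWithin_le_nhds (Ioo_mem_nhds ht.1 ht.2))
    filter_upwards [hIoo] with s hs
    have hsI := Ioo_subset_Icc_self hs
    have svs := sv hsI
    simp only [slope, vsub_eq_sub, smul_eq_mul]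
    rw [← integral_sub, ← integral_const_mul]
    · refine integral_congr_ae (Filter.Eventually.of_forall fun x => ?_)
      dsimp only
      ring
    · refine Continuous.integrable_of_vanish (by fun_prop) hK fun x hx => ?_
      simp [hvK.val s hsI x hx]
    · refine Continuous.integrable_of_vanish (by fun_prop) hK fun x hx => ?_
      simp [hvK.val t htI x hx]
  · congr 1
    rw [← add_zero (∫ _, _ ∂_), ← mul_zero (2 : ℝ), ← hdiv, ← integral_const_mul, ← integral_add]
    · refine integral_congr_ae (Filter.Eventually.of_forall fun x => ?_)
      simp only [Finset.sum_add_distrib, ← Finset.mul_sum, pow_two]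
      ring
    all_goals
      refine Continuous.integrable_of_vanish (by fun_prop) hK fun x hx => ?_
      simp [hvK.val t htI x hx, fun i => hvK.grad i t htI x hx]

section Caccioppoli
variable {T c B : ℝ} {Ω K G : Set (EuclideanSpace ℝ (Fin n))}
  {ζ : EuclideanSpace ℝ (Fin n) → ℝ} {ζd : Fin n → EuclideanSpace ℝ (Fin n) → ℝ}
  {ζdd : Fin n → Fin n → EuclideanSpace ℝ (Fin n) → ℝ}
  {U Ut : Fin n → ℝ → EuclideanSpace ℝ (Fin n) → ℝ}
  {D : Fin n → Fin n → ℝ → EuclideanSpace ℝ (Fin n) → ℝ}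
  {DD : Fin n → Fin n → Fin n → ℝ → EuclideanSpace ℝ (Fin n) → ℝ}

lemma IsSubsol.caccioppoli_pointwise (hc : 0 ≤ c)
    (hU : IsSubsol T c Ω U Ut D DD) (hζ : IsCutoff K G B ζ ζd ζdd) {t : ℝ} (ht : t ∈ Icc 0 T)
    {x : EuclideanSpace ℝ (Fin n)} (hx : x ∈ Ω) :
    1 / 2 * ζ x ^ 2 * ∑ k, ∑ i, D k i t x ^ 2 ≤
      ∑ k, (2 * (ζ x * U k t x) * (ζ x * Ut k t x + ∑ i, (ζdd i i x * U k t x + ζd i x * D k i t x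
        + (ζd i x * D k i t x + ζ x * DD k i i t x)))
        + 2 * ∑ i, (ζd i x * U k t x + ζ x * D k i t x) ^ 2)
      + (2 * c + 17 * B + 4) * ∑ k, U k t x ^ 2 := by
  have hB : 0 ≤ B := le_trans (by positivity) (hζ.grad_le x)
  have hz := hζ.sq_le x
  have h1 : ∀ k, ζ x ^ 2 * ∑ i, D k i t x ^ 2 ≤
      (2 * (ζ x * U k t x) * (ζ x * Ut k t x + ∑ i, (ζdd i i x * U k t x + ζd i x * D k i t x
        + (ζd i x * D k i t x + ζ x * DD k i i t x)))
        + 2 * ∑ i, (ζd i x * U k t x + ζ x * D k i t x) ^ 2) + (17 * B + 1) * U k t x ^ 2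
      + ζ x ^ 2 * ((2 * c + 2) * U k t x ^ 2
        + (2 * c + 2)⁻¹ * (Ut k t x + ∑ i, DD k i i t x) ^ 2) := by
    intro k
    have e : ζ x * Ut k t x + ∑ i, (ζdd i i x * U k t x + ζd i x * D k i t x
      + (ζd i x * D k i t x + ζ x * DD k i i t x)) =
        ζ x * (Ut k t x + ∑ i, DD k i i t x) + (∑ i, ζdd i i x) * U k t x
          + 2 * ∑ i, ζd i x * D k i t x := by
      simp only [Finset.sum_add_distrib, ← Finset.sum_mul, ← Finset.mul_sum]; ring
    have e2 : ∑ i, (ζd i x * U k t x + ζ x * D k i t x) ^ 2 =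
        U k t x ^ 2 * (∑ i, ζd i x ^ 2) + 2 * (ζ x * U k t x) * (∑ i, ζd i x * D k i t x)
          + ζ x ^ 2 * ∑ i, D k i t x ^ 2 := by
      simp only [Finset.mul_sum, ← Finset.sum_add_distrib]
      exact Finset.sum_congr rfl fun i _ => by ring
    rw [e, e2]
    have hcs := (Finset.sum_mul_sq_le_sq_mul_sq Finset.univ (fun i => ζd i x)
      fun i => D k i t x).trans
        (mul_le_mul_of_nonneg_right (hζ.grad_le x) (by positivity))
    have hg0 : 0 ≤ ∑ i, ζd i x ^ 2 := by positivity
    have hlap := hζ.lap_le x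
    have hp : 0 < 2 * c + 2 := by linarith
    have hyoung : -((2 * c + 2) * U k t x ^ 2 + (2 * c + 2)⁻¹ * (Ut k t x + ∑ i, DD k i i t x) ^ 2)
        ≤ 2 * U k t x * (Ut k t x + ∑ i, DD k i i t x) := by
      have : 0 ≤ (2 * c + 2)⁻¹ * ((2 * c + 2) * U k t x + (Ut k t x + ∑ i, DD k i i t x)) ^ 2 := by
        positivity
      have e3 : (2 * c + 2)⁻¹ * ((2 * c + 2) * U k t x + (Ut k t x + ∑ i, DD k i i t x)) ^ 2 =
          (2 * c + 2) * U k t x ^ 2 + (2 * c + 2)⁻¹ * (Ut k t x + ∑ i, DD k i i t x) ^ 2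
            + 2 * U k t x * (Ut k t x + ∑ i, DD k i i t x) := by
        field_simp; ring
      linarith
    have hy := mul_le_mul_of_nonneg_left hyoung (sq_nonneg (ζ x))
    have : 0 ≤ ∑ i, D k i t x ^ 2 := by positivity
    generalize Ut k t x + ∑ i, DD k i i t x = L at *
    generalize ∑ i, ζd i x * D k i t x = P at *
    generalize ∑ i, D k i t x ^ 2 = E at *
    generalize ∑ i, ζd i x ^ 2 = Z at *
    generalize ∑ i, ζdd i i x = A at *
    generalize U k t x = w at *
    generalize ζ x = s at *
    have hE0 : 0 ≤ E := ‹_›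
    have hP : -(s ^ 2 * E + 16 * B * w ^ 2) ≤ 8 * (s * w * P) := by
      refine (abs_le_of_sq_le_sq' ?_ (by positivity)).1
      have q1 := mul_le_mul_of_nonneg_left hcs (by positivity : 0 ≤ 64 * (s * w) ^ 2)
      nlinarith [sq_nonneg (s ^ 2 * E - 16 * B * w ^ 2)]
    have hA : -((1 + B) * w ^ 2) ≤ 2 * s * A * w ^ 2 := by
      have : 0 ≤ (1 + B + 2 * s * A) * w ^ 2 :=
        mul_nonneg (by nlinarith [sq_nonneg (s + A)]) (sq_nonneg w)
      linarith
    have hZ : 0 ≤ w ^ 2 * Z := by positivity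
    linarith
  have h2 := Finset.sum_le_sum fun k (_ : k ∈ Finset.univ) => h1 k
  rw [← Finset.mul_sum, Finset.sum_add_distrib, Finset.sum_add_distrib, ← Finset.mul_sum,
    ← Finset.mul_sum, Finset.sum_add_distrib (f := fun k => (2 * c + 2) * U k t x ^ 2),
    ← Finset.mul_sum, ← Finset.mul_sum] at h2
  have h3 := hU.ineq t ht x hx
  rw [energyDensity, Finset.sum_add_distrib] at h3
  have hu0 : 0 ≤ ∑ k, U k t x ^ 2 := by positivity
  have hE0 : 0 ≤ ∑ k, ∑ i, D k i t x ^ 2 := by positivity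
  generalize ∑ k, U k t x ^ 2 = u at *
  generalize ∑ k, ∑ i, D k i t x ^ 2 = E at *
  generalize ∑ k, (Ut k t x + ∑ i, DD k i i t x) ^ 2 = L at *
  have h4 : (2 * c + 2)⁻¹ * L ≤ 1 / 2 * (u + E) := by
    rw [inv_mul_le_iff₀ (by linarith)]
    nlinarith
  have h5 : ζ x ^ 2 * ((2 * c + 2) * u + (2 * c + 2)⁻¹ * L) ≤
      (2 * c + 3) * u + 1 / 2 * ζ x ^ 2 * E := by
    have q1 := mul_le_mul_of_nonneg_left h4 (sq_nonneg (ζ x))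
    have q2 := mul_le_mul_of_nonneg_right hz (by positivity : 0 ≤ (2 * c + 3) * u)
    have q3 : 0 ≤ ζ x ^ 2 * u := by positivity
    linarith
  linarith

/-- A local energy estimate. -/
lemma IsSubsol.caccioppoli (hΩ : IsOpen Ω) (hK : IsCompact K) (hKΩ : K ⊆ Ω) (hc : 0 ≤ c)
    (hT : 0 ≤ T) (hU : IsSubsol T c Ω U Ut D DD) (hζ : IsCutoff K G B ζ ζd ζdd) {A : ℝ}
    (hA : ∀ t ∈ Icc 0 T, ∀ x ∈ K, ∑ k, U k t x ^ 2 ≤ A)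
    {N : Set (EuclideanSpace ℝ (Fin n))} (hN : N ⊆ K ∩ G) (hNm : MeasurableSet N) :
    ∫ z in Icc 0 T ×ˢ N, energyDensity U D z.1 z.2 ≤
      (2 + (4 * c + 34 * B + 9) * T) * (A * volume.real K) := by
  have hB : 0 ≤ B := le_trans (by positivity) (hζ.grad_le 0)
  have hTI : T ∈ Icc 0 T := ⟨hT, le_rfl⟩
  have hv := fun k => (hU.regular k).cutoff hΩ hK hKΩ hζ
  have hvK := fun k => hζ.vanishOff (T := T) (U k) (Ut k) (D k) (DD k)
  have cd := fun k => (hv k).cont_d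
  have cv := fun k => (hv k).cont
  have cvt := fun k => (hv k).cont_t
  have cdd := fun k => (hv k).cont_dd
  set v : Fin n → ℝ → EuclideanSpace ℝ (Fin n) → ℝ := fun k t x => ζ x * U k t x with hvdef
  set vt : Fin n → ℝ → EuclideanSpace ℝ (Fin n) → ℝ := fun k t x => ζ x * Ut k t x with hvtdef
  set d : Fin n → Fin n → ℝ → EuclideanSpace ℝ (Fin n) → ℝ :=
    fun k i t x => ζd i x * U k t x + ζ x * D k i t x with hddef
  set dd : Fin n → Fin n → Fin n → ℝ → EuclideanSpace ℝ (Fin n) → ℝ :=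
    fun k i j t x => ζdd i j x * U k t x + ζd j x * D k i t x
        + (ζd i x * D k j t x + ζ x * DD k i j t x) with hdddef
  set P : Fin n → ℝ → EuclideanSpace ℝ (Fin n) → ℝ := fun k t x =>
    2 * v k t x * (vt k t x + ∑ i, dd k i i t x) + 2 * ∑ i, d k i t x ^ 2 with hP
  have cP : ∀ k, ContinuousOn (Function.uncurry (P k)) (Icc 0 T ×ˢ univ) := fun k => by
    unfold P Function.uncurry at *
    fun_prop
  have hPK : ∀ k, ∀ t ∈ Icc 0 T, ∀ x ∉ K, P k t x = 0 := fun k t ht x hx => by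
    have h1 : v k t x = 0 := (hvK k).val t ht x hx
    have h2 : ∀ i, d k i t x = 0 := fun i => (hvK k).grad i t ht x hx
    simp [hP, h1, h2]
  have hPi : ∀ k, IntegrableOn (Function.uncurry (P k)) (Icc 0 T ×ˢ K) := fun k =>
    (cP k).integrableOn_slab hK subset_rfl le_rfl le_rfl
  have sv : ∀ k, Continuous (v k T) := fun k => (cv k).slice_continuous hTI
  have hvi : ∀ k, Integrable fun x => v k T x ^ 2 := fun k => by
    have := sv k
    refine Continuous.integrable_of_vanish (by fun_prop) hK fun x hx => ?_
    have h1 : v k T x = 0 := (hvK k).val T hTI x hx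
    simp [h1]
  have hk : ∀ k, ∫ z in Icc 0 T ×ˢ K, Function.uncurry (P k) z ≤ ∫ x, v k T x ^ 2 := fun k => by
    have h1 := setIntegral_le_of_hasDerivAt (Q := fun t => ∫ x, v k t x ^ 2) hK (cP k) (hPK k)
      (continuousOn_integral_of_compact_support hK
        (by have := cv k; unfold Function.uncurry at *; fun_prop) fun t x ht hx => by
          have h1 : v k t x = 0 := (hvK k).val t ht x hx
          simp [h1])
      (fun t ht => ⟨_, hasDerivAt_integral_sq hK (hv k) (hvK k) ht, le_rfl⟩) hTI
    have h2 : 0 ≤ ∫ x, v k 0 x ^ 2 := integral_nonneg fun x => sq_nonneg _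
    linarith
  have hsum : ∫ z in Icc 0 T ×ˢ K, ∑ k, Function.uncurry (P k) z ≤ A * volume.real K := by
    rw [integral_finsetSum _ fun k _ => hPi k]
    refine (Finset.sum_le_sum fun k _ => hk k).trans ?_
    rw [← integral_finsetSum _ fun k _ => hvi k,
      ← setIntegral_eq_integral_of_forall_compl_eq_zero (s := K)]
    · have h1 : ∫ x in K, ∑ k, v k T x ^ 2 ≤ ∫ x in K, A := by
        refine setIntegral_mono_on (integrable_finsetSum _ fun k _ => (hvi k).integrableOn)
          (integrableOn_const hK.measure_ne_top) hK.measurableSet fun x hx => ?_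
        refine le_trans (Finset.sum_le_sum fun k _ => ?_) (hA T hTI x hx)
        simp only [hvdef, mul_pow]
        exact mul_le_of_le_one_left (sq_nonneg _) (hζ.sq_le x)
      refine h1.trans_eq ?_
      simp [mul_comm]
    · intro x hx
      have h1 : ∀ k, v k T x = 0 := fun k => (hvK k).val T hTI x hx
      simp [h1]
  have hNK : Icc 0 T ×ˢ N ⊆ Icc 0 T ×ˢ K := prod_mono_right fun x hx => (hN hx).1
  have hNM : MeasurableSet (Icc 0 T ×ˢ N) := measurableSet_Icc.prod hNm
  have hWi : IntegrableOn (fun z => energyDensity U D z.1 z.2) (Icc 0 T ×ˢ K) :=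
    (hU.continuousOn_density.mono (prod_mono_right hKΩ)).integrableOn_compact
      (isCompact_Icc.prod hK)
  have hfin : volume (Icc 0 T ×ˢ K) ≠ ⊤ := (isCompact_Icc.prod hK).measure_ne_top
  have hlow : ∫ z in Icc 0 T ×ˢ N, energyDensity U D z.1 z.2 ≤
      ∫ z in Icc 0 T ×ˢ K, (2 * ∑ k, Function.uncurry (P k) z + (4 * c + 34 * B + 9) * A) := by
    rw [← inter_eq_self_of_subset_right hNK, ← setIntegral_indicator hNM]
    refine setIntegral_mono_on (hWi.indicator hNM)
      (((integrable_finsetSum _ fun k _ => hPi k).const_mul _).add (integrableOn_const hfin))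
      (measurableSet_Icc.prod hK.measurableSet) fun z hz => ?_
    obtain ⟨t, x⟩ := z
    have h1 : 1 / 2 * ζ x ^ 2 * ∑ k, ∑ i, D k i t x ^ 2 ≤ ∑ k, P k t x
      + (2 * c + 17 * B + 4) * ∑ k, U k t x ^ 2 :=
      hU.caccioppoli_pointwise hc hζ hz.1 (hKΩ hz.2)
    have h2 := hA t hz.1 x hz.2
    have h3 := mul_le_mul_of_nonneg_left h2 (by positivity : 0 ≤ 4 * c + 34 * B + 9)
    have p1 : 0 ≤ ∑ k, U k t x ^ 2 := by positivity
    simp only [Function.uncurry_apply_pair]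
    by_cases hx : x ∈ N
    · rw [indicator_of_mem (show (t, x) ∈ Icc 0 T ×ˢ N from ⟨hz.1, hx⟩)]
      rw [hζ.on x (hN hx).2] at h1
      simp only [energyDensity, Finset.sum_add_distrib]
      linarith
    · rw [indicator_of_notMem fun h => hx h.2]
      have p2 : 0 ≤ 1 / 2 * ζ x ^ 2 * ∑ k, ∑ i, D k i t x ^ 2 := by positivity
      linarith
  refine hlow.trans ?_
  rw [integral_add ((integrable_finsetSum _ fun k _ => hPi k).const_mul _)
    (integrableOn_const hfin), integral_const_mul]
  have hvol : volume.real (Icc 0 T ×ˢ K) = T * volume.real K := by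
    rw [Measure.volume_eq_prod, measureReal_prod_prod, Real.volume_real_Icc_of_le hT, sub_zero]
  simp only [integral_const, measureReal_restrict_apply_univ, hvol, smul_eq_mul]
  linarith
end Caccioppoli

/-- A `C²` function with values in `[-1,1]`, whose first and second partial derivatives `ζd i`,
`ζdd i j` are bounded by `B`. -/
structure IsTestFun (B : ℝ) (ζ : EuclideanSpace ℝ (Fin n) → ℝ)
    (ζd : Fin n → EuclideanSpace ℝ (Fin n) → ℝ)
    (ζdd : Fin n → Fin n → EuclideanSpace ℝ (Fin n) → ℝ) : Prop where
  cont : Continuous ζ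
  cont_d : ∀ i, Continuous (ζd i)
  cont_dd : ∀ i j, Continuous (ζdd i j)
  deriv : ∀ x i, HasLineDerivAt ℝ ζ (ζd i x) x (EuclideanSpace.single i 1)
  deriv_d : ∀ x i j, HasLineDerivAt ℝ (ζd j) (ζdd i j x) x (EuclideanSpace.single i 1)
  symm : ∀ x i j, ζdd i j x = ζdd j i x
  abs_le : ∀ x, |ζ x| ≤ 1
  abs_d_le : ∀ x i, |ζd i x| ≤ B
  abs_dd_le : ∀ x i j, |ζdd i j x| ≤ B

lemma IsTestFun.mul {B₁ B₂ : ℝ} {f g : EuclideanSpace ℝ (Fin n) → ℝ}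
    {fd gd : Fin n → EuclideanSpace ℝ (Fin n) → ℝ}
    {fdd gdd : Fin n → Fin n → EuclideanSpace ℝ (Fin n) → ℝ}
    (hB₁ : 0 ≤ B₁) (hB₂ : 0 ≤ B₂) (hf : IsTestFun B₁ f fd fdd) (hg : IsTestFun B₂ g gd gdd) :
    IsTestFun (B₁ + B₂ + 2 * B₁ * B₂) (fun x => f x * g x)
      (fun i x => fd i x * g x + f x * gd i x)
      (fun i j x => fdd i j x * g x + fd j x * gd i x + (fd i x * gd j x + f x * gdd i j x)) where
  cont := hf.cont.mul hg.cont
  cont_d i := ((hf.cont_d i).mul hg.cont).add (hf.cont.mul (hg.cont_d i))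
  cont_dd i j := (((hf.cont_dd i j).mul hg.cont).add ((hf.cont_d j).mul (hg.cont_d i))).add
    (((hf.cont_d i).mul (hg.cont_d j)).add (hf.cont.mul (hg.cont_dd i j)))
  deriv x i := (hf.deriv x i).mul_real (hg.deriv x i)
  deriv_d x i j := ((hf.deriv_d x i j).mul_real (hg.deriv x i)).add_real
    ((hf.deriv x i).mul_real (hg.deriv_d x i j))
  symm x i j := by rw [hf.symm x i j, hg.symm x i j]; ring
  abs_le x := by
    rw [abs_mul]
    exact mul_le_one₀ (hf.abs_le x) (abs_nonneg _) (hg.abs_le x)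
  abs_d_le x i := by
    have h1 : |fd i x| * |g x| ≤ B₁ * 1 :=
      mul_le_mul (hf.abs_d_le x i) (hg.abs_le x) (abs_nonneg _) hB₁
    have h2 : |f x| * |gd i x| ≤ 1 * B₂ :=
      mul_le_mul (hf.abs_le x) (hg.abs_d_le x i) (abs_nonneg _) zero_le_one
    have h3 := abs_add_le (fd i x * g x) (f x * gd i x)
    rw [abs_mul, abs_mul] at h3
    have : 0 ≤ B₁ * B₂ := mul_nonneg hB₁ hB₂
    linarith
  abs_dd_le x i j := by
    have h1 : |fdd i j x| * |g x| ≤ B₁ * 1 :=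
      mul_le_mul (hf.abs_dd_le x i j) (hg.abs_le x) (abs_nonneg _) hB₁
    have h2 : |f x| * |gdd i j x| ≤ 1 * B₂ :=
      mul_le_mul (hf.abs_le x) (hg.abs_dd_le x i j) (abs_nonneg _) zero_le_one
    have h3 : ∀ i j, |fd i x| * |gd j x| ≤ B₁ * B₂ := fun i j =>
      mul_le_mul (hf.abs_d_le x i) (hg.abs_d_le x j) (abs_nonneg _) hB₁
    have h4 := abs_add_le (fdd i j x * g x + fd j x * gd i x) (fd i x * gd j x + f x * gdd i j x)
    have h5 := abs_add_le (fdd i j x * g x) (fd j x * gd i x)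
    have h6 := abs_add_le (fd i x * gd j x) (f x * gdd i j x)
    rw [abs_mul, abs_mul] at h5 h6
    have := h3 i j
    have := h3 j i
    linarith

/-- Composition of a fixed profile with affine maps whose linear part is a contraction. -/
lemma IsTestFun.comp_affine {F : Type*} [NormedAddCommGroup F] [NormedSpace ℝ F] {f : F → ℝ}
    (hf : ContDiff ℝ 2 f) (hf1 : ∀ y, |f y| ≤ 1) {B : ℝ}
    (hB : ∀ y, ‖fderiv ℝ f y‖ ≤ B ∧ ‖fderiv ℝ (fderiv ℝ f) y‖ ≤ B)
    (L : EuclideanSpace ℝ (Fin n) →L[ℝ] F) (hL : ‖L‖ ≤ 1) (b : F) :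
    IsTestFun B (fun x => f (L x + b))
      (fun i x => fderiv ℝ f (L x + b) (L (EuclideanSpace.single i 1)))
      (fun i j x => fderiv ℝ (fderiv ℝ f) (L x + b) (L (EuclideanSpace.single i 1))
        (L (EuclideanSpace.single j 1))) := by
  have hfd : ContDiff ℝ 1 (fderiv ℝ f) := hf.fderiv_right (by norm_num)
  have c1 : Continuous (fderiv ℝ f) := hfd.continuous
  have c2 : Continuous (fderiv ℝ (fderiv ℝ f)) := hfd.continuous_fderiv (by norm_num)
  have hLe : ∀ i : Fin n, ‖L (EuclideanSpace.single i 1)‖ ≤ 1 := fun i => by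
    refine (L.le_opNorm _).trans ?_
    simpa using hL
  have hline : ∀ (x : EuclideanSpace ℝ (Fin n)) (i : Fin n), HasDerivAt
      (fun s : ℝ => L (x + s • EuclideanSpace.single i 1) + b) (L (EuclideanSpace.single i 1)) 0 := by
    intro x i
    have : HasDerivAt (fun s : ℝ => x + s • (EuclideanSpace.single i 1 : EuclideanSpace ℝ (Fin n)))
        (EuclideanSpace.single i 1) 0 := by
      simpa using ((hasDerivAt_id (0 : ℝ)).smul_const
        (EuclideanSpace.single i 1 : EuclideanSpace ℝ (Fin n))).const_add x
    exact (L.hasFDerivAt.comp_hasDerivAt (0 : ℝ) this).add_const b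
  refine ⟨?_, ?_, ?_, ?_, ?_, ?_, fun x => hf1 _, ?_, ?_⟩
  · have := hf.continuous; fun_prop
  · intro i; fun_prop
  · intro i j; fun_prop
  · intro x i
    have h := ((hf.differentiable (by norm_num)) (L x + b)).hasFDerivAt
    have h2 : HasFDerivAt f (fderiv ℝ f (L x + b))
      (L (x + (0 : ℝ) • EuclideanSpace.single i 1) + b) := by simpa using h
    exact h2.comp_hasDerivAt (0 : ℝ) (hline x i)
  · intro x i j
    have h := ((hfd.differentiable (by norm_num)) (L x + b)).hasFDerivAt
    have h2 : HasFDerivAt (fderiv ℝ f) (fderiv ℝ (fderiv ℝ f) (L x + b))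
      (L (x + (0 : ℝ) • EuclideanSpace.single i 1) + b) := by simpa using h
    have h3 := h2.comp_hasDerivAt (0 : ℝ) (hline x i)
    exact (ContinuousLinearMap.apply ℝ ℝ (L (EuclideanSpace.single j 1))).hasFDerivAt.comp_hasDerivAt
      (0 : ℝ) h3
  · intro x i j
    exact (hf.contDiffAt.isSymmSndFDerivAt (by simp)) _ _
  · intro x i
    refine ((fderiv ℝ f (L x + b)).le_opNorm _).trans ?_
    have h0 := norm_nonneg (fderiv ℝ f (L x + b))
    calc _ ≤ ‖fderiv ℝ f (L x + b)‖ * 1 := by gcongr; exact hLe i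
      _ ≤ B := by rw [mul_one]; exact (hB _).1
  · intro x i j
    refine ((fderiv ℝ (fderiv ℝ f) (L x + b)).le_opNorm₂ _ _).trans ?_
    calc _ ≤ ‖fderiv ℝ (fderiv ℝ f) (L x + b)‖ * 1 * 1 := by
          gcongr
          · exact hLe i
          · exact hLe j
      _ ≤ B := by rw [mul_one, mul_one]; exact (hB _).2

lemma HasLineDerivAt.eq_zero_of_eventually_const {f : EuclideanSpace ℝ (Fin n) → ℝ} {f' a : ℝ}
    {x e : EuclideanSpace ℝ (Fin n)} (h : HasLineDerivAt ℝ f f' x e)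
    (hf : ∀ᶠ y in nhds x, f y = a) : f' = 0 := by
  have hc : Continuous fun s : ℝ => x + s • e := by fun_prop
  have hf0 : ∀ᶠ y in nhds (x + (0 : ℝ) • e), f y = a := by simpa using hf
  have h2 : ∀ᶠ s : ℝ in nhds 0, f (x + s • e) = a := hc.continuousAt.eventually hf0
  exact HasDerivAt.unique h ((hasDerivAt_const (0 : ℝ) a).congr_of_eventuallyEq h2)

lemma IsTestFun.isCutoff {B : ℝ} {ζ : EuclideanSpace ℝ (Fin n) → ℝ}
    {ζd : Fin n → EuclideanSpace ℝ (Fin n) → ℝ}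
    {ζdd : Fin n → Fin n → EuclideanSpace ℝ (Fin n) → ℝ} {K G : Set (EuclideanSpace ℝ (Fin n))}
    (hζ : IsTestFun B ζ ζd ζdd) (hK : IsCompact K) (hoff : ∀ x ∉ K, ζ x = 0)
    (hon : ∀ x ∈ G, ∀ᶠ y in nhds x, ζ y = 1) :
    IsCutoff K G ((n + n ^ 2) * B ^ 2) ζ ζd ζdd := by
  have hKo : ∀ x ∉ K, ∀ᶠ y in nhds x, y ∉ K := fun x hx => hK.isClosed.isOpen_compl.mem_nhds hx
  have offd : ∀ i, ∀ x ∉ K, ζd i x = 0 := fun i x hx =>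
    (hζ.deriv x i).eq_zero_of_eventually_const ((hKo x hx).mono hoff)
  have ond : ∀ i, ∀ x ∈ G, ∀ᶠ y in nhds x, ζd i y = 0 := fun i x hx =>
    (hon x hx).eventually_nhds.mono fun y hy => (hζ.deriv y i).eq_zero_of_eventually_const hy
  refine ⟨hζ.cont, hζ.cont_d, hζ.cont_dd, hζ.deriv, hζ.deriv_d, hζ.symm, hoff, offd,
    fun i j x hx => (hζ.deriv_d x i j).eq_zero_of_eventually_const ((hKo x hx).mono (offd j)),
    fun x hx => (hon x hx).self_of_nhds, fun i x hx => (ond i x hx).self_of_nhds,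
    fun i j x hx => (hζ.deriv_d x i j).eq_zero_of_eventually_const (ond j x hx),
    fun x => (sq_le_one_iff_abs_le_one _).2 (hζ.abs_le x), fun x => ?_, fun x => ?_⟩
  · have : ∀ i, ζd i x ^ 2 ≤ B ^ 2 := fun i => sq_le_sq.2 ((hζ.abs_d_le x i).trans (le_abs_self B))
    have h := Finset.sum_le_card_nsmul Finset.univ (fun i => ζd i x ^ 2) _ fun i _ => this i
    simp only [Finset.card_univ, Fintype.card_fin, nsmul_eq_mul] at h
    nlinarith [sq_nonneg (n * B : ℝ)]
  · have h := (Finset.abs_sum_le_sum_abs (fun i => ζdd i i x) Finset.univ).trans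
      (Finset.sum_le_card_nsmul Finset.univ (fun i => |ζdd i i x|) _
        fun i _ => hζ.abs_dd_le x i i)
    simp only [Finset.card_univ, Fintype.card_fin, nsmul_eq_mul] at h
    have h2 := sq_le_sq.2 (h.trans (le_abs_self _))
    have : 0 ≤ (n : ℝ) * B ^ 2 := by positivity
    nlinarith

lemma exists_fderiv_bound {F : Type*} [NormedAddCommGroup F] [NormedSpace ℝ F] {f : F → ℝ}
    (hf : ContDiff ℝ 2 f) (hs : HasCompactSupport (fderiv ℝ f)) :
    ∃ B : ℝ, 0 ≤ B ∧ ∀ y, ‖fderiv ℝ f y‖ ≤ B ∧ ‖fderiv ℝ (fderiv ℝ f) y‖ ≤ B := by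
  have hfd : ContDiff ℝ 1 (fderiv ℝ f) := hf.fderiv_right (by norm_num)
  obtain ⟨B₁, h1⟩ := hfd.continuous.bounded_above_of_compact_support hs
  obtain ⟨B₂, h2⟩ := (hfd.continuous_fderiv (by norm_num)).bounded_above_of_compact_support
    (hs.fderiv (𝕜 := ℝ))
  exact ⟨max B₁ B₂, (norm_nonneg _).trans ((h1 0).trans (le_max_left _ _)),
    fun y => ⟨(h1 y).trans (le_max_left _ _), (h2 y).trans (le_max_right _ _)⟩⟩

/-- A bump profile on `ℝⁿ`. -/
lemma exists_bump_profile (n : ℕ) : ∃ (f : EuclideanSpace ℝ (Fin n) → ℝ) (B : ℝ), 0 ≤ B ∧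
    ContDiff ℝ 2 f ∧ (∀ y, |f y| ≤ 1) ∧
    (∀ y, ‖fderiv ℝ f y‖ ≤ B ∧ ‖fderiv ℝ (fderiv ℝ f) y‖ ≤ B) ∧
    (∀ y ∈ ball 0 (3 / 2), f y = 1) ∧ (∀ y ∉ closedBall 0 2, f y = 0) := by
  let φ : ContDiffBump (0 : EuclideanSpace ℝ (Fin n)) := ⟨3 / 2, 2, by norm_num, by norm_num⟩
  have hφ : ContDiff ℝ 2 φ := φ.contDiff
  obtain ⟨B, hB0, hB⟩ := exists_fderiv_bound hφ (φ.hasCompactSupport.fderiv (𝕜 := ℝ))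
  refine ⟨φ, B, hB0, hφ, fun y => by rw [abs_of_nonneg φ.nonneg]; exact φ.le_one, hB,
    fun y hy => φ.one_of_mem_closedBall (ball_subset_closedBall hy), fun y hy => ?_⟩
  refine φ.zero_of_le_dist ?_
  rw [mem_closedBall, not_le] at hy
  exact hy.le

/-- A transition profile on `ℝ`. -/
lemma exists_transition_profile {δ : ℝ} (hδ : 0 < δ) : ∃ (f : ℝ → ℝ) (B : ℝ), 0 ≤ B ∧
    ContDiff ℝ 2 f ∧ (∀ y, |f y| ≤ 1) ∧
    (∀ y, ‖fderiv ℝ f y‖ ≤ B ∧ ‖fderiv ℝ (fderiv ℝ f) y‖ ≤ B) ∧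
    (∀ y, 2 * δ ≤ y → f y = 1) ∧ (∀ y ≤ δ, f y = 0) := by
  let f : ℝ → ℝ := fun y => Real.smoothTransition (y / δ - 1)
  have hf : ContDiff ℝ 2 f := Real.smoothTransition.contDiff.comp (by fun_prop)
  have h1 : ∀ y, 2 * δ ≤ y → f y = 1 := fun y hy => by
    refine Real.smoothTransition.one_of_one_le ?_
    rw [le_sub_iff_add_le, le_div_iff₀ hδ]; linarith
  have h0 : ∀ y ≤ δ, f y = 0 := fun y hy => by
    refine Real.smoothTransition.zero_of_nonpos ?_
    rw [sub_nonpos, div_le_one₀ hδ]; exact hy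
  have hs : HasCompactSupport (fderiv ℝ f) := by
    refine HasCompactSupport.intro (K := Icc δ (2 * δ)) isCompact_Icc fun y hy => ?_
    have hev : ∃ a : ℝ, f =ᶠ[nhds y] fun _ => a := by
      by_cases hyd : y < δ
      · exact ⟨0, Filter.mem_of_superset (Iio_mem_nhds hyd) fun z hz => h0 z (le_of_lt hz)⟩
      · have : 2 * δ < y := by
          by_contra h
          exact hy ⟨not_lt.1 hyd, not_lt.1 h⟩
        exact ⟨1, Filter.mem_of_superset (Ioi_mem_nhds this) fun z hz => h1 z (le_of_lt hz)⟩
    obtain ⟨a, ha⟩ := hev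
    rw [ha.fderiv_eq]
    simp
  obtain ⟨B, hB0, hB⟩ := exists_fderiv_bound hf hs
  exact ⟨f, B, hB0, hf, fun y => by
    rw [abs_of_nonneg (Real.smoothTransition.nonneg _)]; exact Real.smoothTransition.le_one _,
    hB, h1, h0⟩

/-- Cutoffs between concentric balls, uniformly in the centre and the radius. -/
lemma exists_cutoff_ball (n : ℕ) : ∃ B : ℝ, 0 ≤ B ∧ ∀ (x₀ : EuclideanSpace ℝ (Fin n)) (s : ℝ),
    1 ≤ s → ∃ ζ ζd ζdd, IsCutoff (closedBall x₀ (2 * s)) (closedBall x₀ s) B ζ ζd ζdd := by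
  obtain ⟨f, B, hB0, hf, hf1, hfB, hon, hoff⟩ := exists_bump_profile n
  refine ⟨(n + n ^ 2) * B ^ 2, by positivity, fun x₀ s hs => ?_⟩
  have hs0 : 0 < s := by linarith
  have hsi : |s⁻¹| = s⁻¹ := abs_of_pos (by positivity)
  have hL : ‖s⁻¹ • ContinuousLinearMap.id ℝ (EuclideanSpace ℝ (Fin n))‖ ≤ 1 := by
    rw [norm_smul, Real.norm_eq_abs, hsi]
    exact mul_le_one₀ (inv_le_one_of_one_le₀ hs) (norm_nonneg _) ContinuousLinearMap.norm_id_le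
  have hz : ∀ x : EuclideanSpace ℝ (Fin n),
      ‖(s⁻¹ • ContinuousLinearMap.id ℝ (EuclideanSpace ℝ (Fin n))) x + -(s⁻¹ • x₀)‖
        = s⁻¹ * dist x x₀ := by
    intro x
    have : (s⁻¹ • ContinuousLinearMap.id ℝ (EuclideanSpace ℝ (Fin n))) x + -(s⁻¹ • x₀)
      = s⁻¹ • (x - x₀) := by simp [sub_eq_add_neg]
    rw [this, norm_smul, Real.norm_eq_abs, hsi, dist_eq_norm]
  refine ⟨_, _, _, (IsTestFun.comp_affine hf hf1 hfB _ hL (-(s⁻¹ • x₀))).isCutoff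
    (isCompact_closedBall _ _) (fun x hx => hoff _ ?_) fun x hx => ?_⟩
  · rw [mem_closedBall, not_le] at hx
    rw [mem_closedBall_zero_iff, hz, not_le, lt_inv_mul_iff₀ hs0]
    linarith
  · have : ball x₀ (3 / 2 * s) ∈ nhds x := isOpen_ball.mem_nhds (by
      rw [mem_closedBall] at hx; rw [mem_ball]; nlinarith)
    filter_upwards [this] with y hy
    refine hon _ ?_
    rw [mem_ball] at hy
    rw [mem_ball_zero_iff, hz, inv_mul_lt_iff₀ hs0]
    linarith

/-- Cutoffs on half-balls `{⟪e,x⟫ ≥ R + δ, |x| ≤ 2 * r}`, uniformly in `r`. -/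
lemma exists_cutoff_halfBall {e : EuclideanSpace ℝ (Fin n)} (he : ‖e‖ = 1) (R : ℝ) {δ : ℝ}
    (hδ : 0 < δ) : ∃ B : ℝ, 0 ≤ B ∧ ∀ r : ℝ, 1 ≤ r → ∃ ζ ζd ζdd,
      IsCutoff (closedBall 0 (2 * r) ∩ {x | R + δ ≤ inner ℝ e x})
        (closedBall 0 r ∩ {x | R + 3 * δ ≤ inner ℝ e x}) B ζ ζd ζdd := by
  obtain ⟨f, B₁, hB1, hf, hf1, hfB, hfon, hfoff⟩ := exists_bump_profile n
  obtain ⟨h, B₂, hB2, hh, hh1, hhB, hhon, hhoff⟩ := exists_transition_profile hδ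
  refine ⟨(n + n ^ 2) * (B₂ + B₁ + 2 * B₂ * B₁) ^ 2, by positivity, fun r hr => ?_⟩
  have hr0 : 0 < r := by linarith
  have hri : |r⁻¹| = r⁻¹ := abs_of_pos (by positivity)
  have hL : ‖r⁻¹ • ContinuousLinearMap.id ℝ (EuclideanSpace ℝ (Fin n))‖ ≤ 1 := by
    rw [norm_smul, Real.norm_eq_abs, hri]
    exact mul_le_one₀ (inv_le_one_of_one_le₀ hr) (norm_nonneg _) ContinuousLinearMap.norm_id_le
  have hz : ∀ x : EuclideanSpace ℝ (Fin n),
      ‖(r⁻¹ • ContinuousLinearMap.id ℝ (EuclideanSpace ℝ (Fin n))) x + 0‖ = r⁻¹ * ‖x‖ := by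
    intro x
    simp [norm_smul, hr0.le]
  have ht := IsTestFun.mul hB2 hB1
    (IsTestFun.comp_affine hh hh1 hhB (innerSL ℝ e) (by rw [innerSL_apply_norm, he]) (-R))
    (IsTestFun.comp_affine hf hf1 hfB _ hL 0)
  have hc : Continuous fun x : EuclideanSpace ℝ (Fin n) => inner ℝ e x := by fun_prop
  refine ⟨_, _, _, ht.isCutoff
    ((isCompact_closedBall _ _).inter_right (isClosed_le continuous_const hc)) ?_ ?_⟩
  · intro x hx
    by_cases hx1 : x ∈ closedBall 0 (2 * r)
    · have : ¬ (R + δ ≤ inner ℝ e x) := fun h2 => hx ⟨hx1, h2⟩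
      refine mul_eq_zero_of_left (hhoff _ ?_) _
      rw [innerSL_apply_apply]; linarith
    · refine mul_eq_zero_of_right _ (hfoff _ ?_)
      rw [mem_closedBall_zero_iff, not_le] at hx1
      rw [mem_closedBall_zero_iff, hz, not_le, lt_inv_mul_iff₀ hr0]
      linarith
  · rintro x ⟨hx1, hx2⟩
    have m1 : ball (0 : EuclideanSpace ℝ (Fin n)) (3 / 2 * r) ∈ nhds x := isOpen_ball.mem_nhds (by
      rw [mem_closedBall] at hx1; rw [mem_ball]; nlinarith)
    have m2 : {x | R + 2 * δ < inner ℝ e x} ∈ nhds x :=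
      (isOpen_lt continuous_const hc).mem_nhds (by
        have h3 : R + 3 * δ ≤ inner ℝ e x := hx2
        have h4 : R + 2 * δ < inner ℝ e x := by linarith
        exact h4)
    filter_upwards [m1, m2] with y hy1 hy2
    have e1 : h (innerSL ℝ e y + -R) = 1 := hhon _ (by
      have h3 : R + 2 * δ < inner ℝ e y := hy2
      rw [innerSL_apply_apply]; linarith)
    have e2 : f ((r⁻¹ • ContinuousLinearMap.id ℝ (EuclideanSpace ℝ (Fin n))) y + 0) = 1 := by
      refine hfon _ ?_
      rw [mem_ball_zero_iff] at hy1
      rw [mem_ball_zero_iff, hz, inv_mul_lt_iff₀ hr0]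
      linarith
    rw [e1, e2, mul_one]

lemma hasLineDerivAt_inner (e x : EuclideanSpace ℝ (Fin n)) (i : Fin n) :
    HasLineDerivAt ℝ (fun y => inner ℝ e y) (e i) x (EuclideanSpace.single i 1) := by
  have h : HasDerivAt (fun s : ℝ => x + s • (EuclideanSpace.single i 1 : EuclideanSpace ℝ (Fin n)))
      (EuclideanSpace.single i 1) 0 := by
    simpa using ((hasDerivAt_id (0 : ℝ)).smul_const
      (EuclideanSpace.single i 1 : EuclideanSpace ℝ (Fin n))).const_add x
  have h2 := (hasDerivAt_const (0 : ℝ) e).inner ℝ h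
  simp only [zero_smul, add_zero, EuclideanSpace.inner_single_right, inner_zero_left,
    conj_trivial, one_mul] at h2
  exact h2

lemma hasLineDerivAt_norm_sub_sq (x₀ x : EuclideanSpace ℝ (Fin n)) (i : Fin n) :
    HasLineDerivAt ℝ (fun y => ‖y - x₀‖ ^ 2) (2 * (x i - x₀ i)) x
      (EuclideanSpace.single i 1) := by
  have h : HasDerivAt (fun s : ℝ => x + s • (EuclideanSpace.single i 1 : EuclideanSpace ℝ (Fin n))
      - x₀) (EuclideanSpace.single i 1) 0 := by
    simpa using (((hasDerivAt_id (0 : ℝ)).smul_const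
      (EuclideanSpace.single i 1 : EuclideanSpace ℝ (Fin n))).const_add x).sub_const x₀
  have h2 := h.norm_sq
  simp only [zero_smul, add_zero, EuclideanSpace.inner_single_right, conj_trivial, one_mul,
    PiLp.sub_apply] at h2
  exact h2

lemma hasLineDerivAt_coord (x : EuclideanSpace ℝ (Fin n)) (i j : Fin n) :
    HasLineDerivAt ℝ (fun y : EuclideanSpace ℝ (Fin n) => y j) (if i = j then 1 else 0) x
      (EuclideanSpace.single i 1) := by
  have h := hasLineDerivAt_inner (EuclideanSpace.single j 1) x i
  simpa [EuclideanSpace.inner_single_left, Pi.single_apply] using h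

/-- Quadratic polynomials in `x` with isotropic Hessian and `C¹` coefficients in time. -/
lemma isC21_quadratic {T : ℝ} (e x₀ : EuclideanSpace ℝ (Fin n)) {a a' b b' q q' : ℝ → ℝ}
    (ha : ∀ t ∈ Icc 0 T, HasDerivAt a (a' t) t) (ha' : ContinuousOn a' (Icc 0 T))
    (hb : ∀ t ∈ Icc 0 T, HasDerivAt b (b' t) t) (hb' : ContinuousOn b' (Icc 0 T))
    (hq : ∀ t ∈ Icc 0 T, HasDerivAt q (q' t) t) (hq' : ContinuousOn q' (Icc 0 T)) :
    IsC21 T univ (fun t x => a t + b t * inner ℝ e x + q t * ‖x - x₀‖ ^ 2)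
      (fun t x => a' t + b' t * inner ℝ e x + q' t * ‖x - x₀‖ ^ 2)
      (fun i t x => b t * e i + q t * (2 * (x i - x₀ i)))
      (fun i j t _ => if i = j then 2 * q t else 0) := by
  have ca : ContinuousOn a (Icc 0 T) := fun t ht => (ha t ht).continuousAt.continuousWithinAt
  have cb : ContinuousOn b (Icc 0 T) := fun t ht => (hb t ht).continuousAt.continuousWithinAt
  have cq : ContinuousOn q (Icc 0 T) := fun t ht => (hq t ht).continuousAt.continuousWithinAt
  refine ⟨?_, ?_, ?_, ?_, ?_, ?_, ?_, ?_⟩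
  · unfold Function.uncurry
    fun_prop (disch := first | exact (fun p hp => And.left hp) | assumption)
  · unfold Function.uncurry
    fun_prop (disch := first | exact (fun p hp => And.left hp) | assumption)
  · intro i; unfold Function.uncurry
    fun_prop (disch := first | exact (fun p hp => And.left hp) | assumption)
  · intro i j
    unfold Function.uncurry
    by_cases h : i = j
    · simp only [h, if_true]
      fun_prop (disch := first | exact (fun p hp => And.left hp) | assumption)
    · simp only [h, if_false]
      fun_prop
  · intro t ht x _
    have ht := Ioo_subset_Icc_self ht
    exact ((ha t ht).add ((hb t ht).mul_const _)).add ((hq t ht).mul_const _)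
  · intro t _ x _ i
    have h0 : HasLineDerivAt ℝ (fun _ : EuclideanSpace ℝ (Fin n) => a t) 0 x
      (EuclideanSpace.single i 1) := hasDerivAt_const (0 : ℝ) (a t)
    have h := (h0.add_real ((hasLineDerivAt_inner e x i).const_mul_real (b t))).add_real
      ((hasLineDerivAt_norm_sub_sq x₀ x i).const_mul_real (q t))
    simpa using h
  · intro t _ x _ i j
    have h0 : ∀ r : ℝ, HasLineDerivAt ℝ (fun _ : EuclideanSpace ℝ (Fin n) => r) 0 x
      (EuclideanSpace.single i 1) := fun r => hasDerivAt_const (0 : ℝ) r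
    have h := (h0 (b t * e j)).add_real
      ((((hasLineDerivAt_coord x i j).sub_real (h0 (x₀ j))).const_mul_real 2).const_mul_real (q t))
    convert h using 1
    split_ifs <;> ring
  · intro t _ x _ i j
    simp only [eq_comm]

lemma sum_quadratic_grad_sq (e x x₀ : EuclideanSpace ℝ (Fin n)) (b q : ℝ) :
    ∑ i, (b * e i + q * (2 * (x i - x₀ i))) ^ 2 =
      b ^ 2 * ‖e‖ ^ 2 + 4 * b * q * (inner ℝ e (x - x₀)) + 4 * q ^ 2 * ‖x - x₀‖ ^ 2 := by
  rw [EuclideanSpace.real_norm_sq_eq, EuclideanSpace.real_norm_sq_eq, PiLp.inner_apply,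
    Finset.mul_sum, Finset.mul_sum, Finset.mul_sum, ← Finset.sum_add_distrib,
    ← Finset.sum_add_distrib]
  refine Finset.sum_congr rfl fun i _ => ?_
  simp
  ring

/-- A regularised backward Gaussian weight (in logarithmic form). -/
def gaussianWeight (k α β t₀ : ℝ) (x₀ : EuclideanSpace ℝ (Fin n)) (t : ℝ)
    (x : EuclideanSpace ℝ (Fin n)) : ℝ :=
  -β * Real.log ((t + t₀) / (2 * t₀)) + 2 * k * α * (t + t₀) + -1 / (4 * (t + t₀)) * ‖x - x₀‖ ^ 2

section GaussianWeight
variable {k α β t₀ s S t : ℝ} {x₀ x : EuclideanSpace ℝ (Fin n)}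

lemma le_gaussianWeight (hk : 0 ≤ k) (hα : 0 ≤ α) (ht₀ : 0 < t₀) (hβ : s ^ 2 = 8 * t₀ * β)
    (hβ0 : 0 ≤ β) (ht : t ∈ Icc 0 t₀) (hx : x ∈ closedBall x₀ (s / 4)) :
    -(β / 8) ≤ gaussianWeight k α β t₀ x₀ t x := by
  have h0 : 0 < t + t₀ := by linarith [ht.1]
  have h1 : Real.log ((t + t₀) / (2 * t₀)) ≤ 0 :=
    Real.log_nonpos (by positivity) (by rw [div_le_one₀ (by positivity)]; linarith [ht.2])
  have h2 : ‖x - x₀‖ ^ 2 ≤ (s / 4) ^ 2 := by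
    rw [mem_closedBall, dist_eq_norm] at hx
    gcongr
  have h3 : -(β / 8) ≤ -1 / (4 * (t + t₀)) * ‖x - x₀‖ ^ 2 := by
    rw [neg_div, neg_mul, neg_le_neg_iff, one_div, inv_mul_le_iff₀ (by positivity)]
    have : t₀ * β ≤ (t + t₀) * β := by gcongr; linarith [ht.1]
    nlinarith
  have h4 : 0 ≤ 2 * k * α * (t + t₀) := by positivity
  have h5 : 0 ≤ -β * Real.log ((t + t₀) / (2 * t₀)) := mul_nonneg_of_nonpos_of_nonpos (by linarith) h1
  unfold gaussianWeight
  linarith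

lemma gaussianWeight_le_of_le_dist (ht₀ : 0 < t₀) (hβ : s ^ 2 = 8 * t₀ * β) (hβ0 : 0 ≤ β)
    (hs : 0 ≤ s) (ht : 0 ≤ t) (hlin : 2 * k * α * (t + t₀) ≤ β / 8) (hx : s ≤ dist x x₀) :
    gaussianWeight k α β t₀ x₀ t x ≤ -(7 / 8 * β) := by
  have h0 : 0 < t + t₀ := by linarith
  rw [dist_eq_norm] at hx
  have h2 : s ^ 2 ≤ ‖x - x₀‖ ^ 2 := by gcongr
  have h3 : -1 / (4 * (t + t₀)) * ‖x - x₀‖ ^ 2 ≤ -(β * (2 * t₀ / (t + t₀))) := by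
    calc _ ≤ -1 / (4 * (t + t₀)) * s ^ 2 :=
          mul_le_mul_of_nonpos_left h2 (div_nonpos_of_nonpos_of_nonneg (by norm_num)
            (by positivity))
      _ = _ := by rw [hβ]; field_simp; ring
  have h4 := Real.log_le_sub_one_of_pos (show 0 < 2 * t₀ / (t + t₀) by positivity)
  have h5 : -Real.log ((t + t₀) / (2 * t₀)) = Real.log (2 * t₀ / (t + t₀)) := by
    rw [← Real.log_inv, inv_div]
  have h6 : β * Real.log (2 * t₀ / (t + t₀)) ≤ β * (2 * t₀ / (t + t₀) - 1) := by gcongr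
  unfold gaussianWeight
  rw [neg_mul, ← mul_neg, h5]
  linarith

lemma gaussianWeight_le_of_le_time (ht₀ : 0 < t₀) (hβ0 : 0 ≤ β) (htS : 12 * t₀ ≤ S)
    (ht : S / 2 ≤ t) (hlin : 2 * k * α * (t + t₀) ≤ β / 8) :
    gaussianWeight k α β t₀ x₀ t x ≤ -(7 / 8 * β) := by
  have h0 : 0 < t + t₀ := by linarith
  have h3 : -1 / (4 * (t + t₀)) * ‖x - x₀‖ ^ 2 ≤ 0 :=
    mul_nonpos_of_nonpos_of_nonneg (div_nonpos_of_nonpos_of_nonneg (by norm_num)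
      (by positivity)) (by positivity)
  have h4 : Real.log (2 * t₀ / (t + t₀)) ≤ -1 := by
    rw [Real.log_le_iff_le_exp (by positivity)]
    have h7 : Real.exp (-1) * Real.exp 1 = 1 := by rw [← Real.exp_add]; simp
    have h8 := Real.exp_one_lt_d9
    have h9 := Real.exp_pos (-1)
    have h10 : 1 / 3 ≤ Real.exp (-1) := by nlinarith
    refine le_trans ?_ h10
    rw [div_le_div_iff₀ (by positivity) (by norm_num)]
    linarith
  have h5 : -Real.log ((t + t₀) / (2 * t₀)) = Real.log (2 * t₀ / (t + t₀)) := by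
    rw [← Real.log_inv, inv_div]
  have h6 : β * Real.log (2 * t₀ / (t + t₀)) ≤ β * (-1) := by gcongr
  unfold gaussianWeight
  rw [neg_mul, ← mul_neg, h5]
  linarith

end GaussianWeight

section Decay
variable {T c B : ℝ} {Ω K G : Set (EuclideanSpace ℝ (Fin n))}
  {ζ : EuclideanSpace ℝ (Fin n) → ℝ} {ζd : Fin n → EuclideanSpace ℝ (Fin n) → ℝ}
  {ζdd : Fin n → Fin n → EuclideanSpace ℝ (Fin n) → ℝ}
  {U Ut : Fin n → ℝ → EuclideanSpace ℝ (Fin n) → ℝ}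
  {D : Fin n → Fin n → ℝ → EuclideanSpace ℝ (Fin n) → ℝ}
  {DD : Fin n → Fin n → Fin n → ℝ → EuclideanSpace ℝ (Fin n) → ℝ}

lemma IsSubsol.integrableOn_density (hU : IsSubsol T c Ω U Ut D DD) (hK : IsCompact K)
    (hKΩ : K ⊆ Ω) :
    IntegrableOn (fun z => energyDensity U D z.1 z.2) (Icc 0 T ×ˢ K) :=
  (hU.continuousOn_density.mono (prod_mono_right hKΩ)).integrableOn_compact
    (isCompact_Icc.prod hK)

lemma setIntegral_mul_exp_le (hU : IsSubsol T c Ω U Ut D DD) (hK : IsCompact K)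
    (hKΩ : K ⊆ Ω) {g : ℝ → EuclideanSpace ℝ (Fin n) → ℝ}
    (hg : ContinuousOn (Function.uncurry g) (Icc 0 T ×ˢ univ)) {b : ℝ}
    {P Q : Set (ℝ × EuclideanSpace ℝ (Fin n))} (hP : P ⊆ Q) (hQ : Q ⊆ Icc 0 T ×ˢ K)
    (hPm : MeasurableSet P) (hb : ∀ z ∈ P, g z.1 z.2 ≤ b) :
    ∫ z in P, energyDensity U D z.1 z.2 * Real.exp (g z.1 z.2) ≤
      Real.exp b * ∫ z in Q, energyDensity U D z.1 z.2 := by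
  have h1 := (hU.integrableOn_weighted hK hKΩ hg).mono_set (hP.trans hQ)
  have h2 := (hU.integrableOn_density hK hKΩ).mono_set hQ
  calc _ ≤ ∫ z in P, Real.exp b * energyDensity U D z.1 z.2 := by
        refine setIntegral_mono_on h1 ((h2.mono_set hP).const_mul _) hPm fun z hz => ?_
        rw [mul_comm]
        exact mul_le_mul_of_nonneg_right (Real.exp_le_exp.2 (hb z hz))
          (energyDensity_nonneg _ _ _ _)
    _ = Real.exp b * ∫ z in P, energyDensity U D z.1 z.2 := integral_const_mul _ _
    _ ≤ _ := by
        refine mul_le_mul_of_nonneg_left ?_ (Real.exp_pos b).le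
        exact setIntegral_mono_set h2 (Filter.Eventually.of_forall fun z =>
          energyDensity_nonneg _ _ _ _) hP.eventuallyLE

lemma le_setIntegral_mul_exp (hU : IsSubsol T c Ω U Ut D DD) (hK : IsCompact K)
    (hKΩ : K ⊆ Ω) {g : ℝ → EuclideanSpace ℝ (Fin n) → ℝ}
    (hg : ContinuousOn (Function.uncurry g) (Icc 0 T ×ˢ univ)) {b : ℝ}
    {P Q : Set (ℝ × EuclideanSpace ℝ (Fin n))} (hP : P ⊆ Q) (hQ : Q ⊆ Icc 0 T ×ˢ K)
    (hPm : MeasurableSet P) (hb : ∀ z ∈ P, b ≤ g z.1 z.2) :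
    Real.exp b * ∫ z in P, energyDensity U D z.1 z.2 ≤
      ∫ z in Q, energyDensity U D z.1 z.2 * Real.exp (g z.1 z.2) := by
  have h1 := (hU.integrableOn_weighted hK hKΩ hg).mono_set hQ
  have h2 := (hU.integrableOn_density hK hKΩ).mono_set (hP.trans hQ)
  calc Real.exp b * ∫ z in P, energyDensity U D z.1 z.2
      = ∫ z in P, Real.exp b * energyDensity U D z.1 z.2 := (integral_const_mul _ _).symm
    _ ≤ ∫ z in P, energyDensity U D z.1 z.2 * Real.exp (g z.1 z.2) := by
        refine setIntegral_mono_on (h2.const_mul _) (h1.mono_set hP) hPm fun z hz => ?_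
        rw [mul_comm]
        exact mul_le_mul_of_nonneg_left (Real.exp_le_exp.2 (hb z hz))
          (energyDensity_nonneg _ _ _ _)
    _ ≤ _ := setIntegral_mono_set h1 (Filter.Eventually.of_forall fun z =>
          mul_nonneg (energyDensity_nonneg _ _ _ _) (Real.exp_pos _).le) hP.eventuallyLE

/-- Carleman inequality with a backward Gaussian weight. -/
lemma IsSubsol.carleman_gaussian (hΩ : IsOpen Ω) (hc : 0 ≤ c) {S t₀ s β : ℝ}
    {x₀ : EuclideanSpace ℝ (Fin n)} (hU : IsSubsol S c Ω U Ut D DD)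
    (hζ : IsCutoff (closedBall x₀ (2 * s)) (closedBall x₀ s) B ζ ζd ζdd)
    (hKΩ : closedBall x₀ (2 * s) ⊆ Ω) (hs : 0 < s) (ht₀ : 0 < t₀) (htS : 12 * t₀ ≤ S)
    (hS : 32 * (c / 2 + 1) * S ≤ 1) (hβn : 2 + (n : ℝ) / 2 ≤ β)
    {g : ℝ → EuclideanSpace ℝ (Fin n) → ℝ}
    (hgdef : g = gaussianWeight (c / 2 + 1) (β - n / 2) β t₀ x₀) :
    ContinuousOn (Function.uncurry g) (Icc 0 S ×ˢ univ) ∧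
    t₀ * ∫ z in Icc 0 (S / 2) ×ˢ closedBall x₀ (s / 4),
        energyDensity U D z.1 z.2 * Real.exp (g z.1 z.2) ≤
      3 * ((3 * c + 15 * B) / 2 *
          (∫ z in Icc 0 S ×ˢ (closedBall x₀ (2 * s) \ closedBall x₀ s),
            energyDensity U D z.1 z.2 * Real.exp (g z.1 z.2))
        + 2 * (1 + B) * ((S - S / 2)⁻¹ *
          ∫ z in Icc (S / 2) S ×ˢ closedBall x₀ (2 * s),
            energyDensity U D z.1 z.2 * Real.exp (g z.1 z.2))) := by
  have hS0 : 0 < S := by linarith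
  set k := c / 2 + 1 with hk
  have hk1 : 1 ≤ k := by linarith
  have hS1 : 32 * S ≤ 1 := by nlinarith
  set α := β - n / 2 with hα
  have hα2 : 2 ≤ α := by linarith
  have hτ : ∀ t ∈ Icc 0 S, 0 < t + t₀ ∧ t + t₀ ≤ 2 * S := fun t ht =>
    ⟨by linarith [ht.1], by linarith [ht.2]⟩
  have hid : ∀ t : ℝ, HasDerivAt (fun t => t + t₀) 1 t := fun t => (hasDerivAt_id t).add_const t₀
  have hg := isC21_quadratic (n := n) (T := S) 0 x₀
    (a := fun t => -β * Real.log ((t + t₀) / (2 * t₀)) + 2 * k * α * (t + t₀))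
    (a' := fun t => -β / (t + t₀) + 2 * k * α) (b := fun _ => 0) (b' := fun _ => 0)
    (q := fun t => -1 / (4 * (t + t₀))) (q' := fun t => 1 / (4 * (t + t₀) ^ 2))
    (fun t ht => by
      have h0 := (hτ t ht).1.ne'
      have h1 := (((hid t).div_const (2 * t₀)).log (by positivity)).const_mul (-β)
      have h2 := (hid t).const_mul (2 * k * α)
      refine (h1.add h2).congr_deriv ?_
      field_simp)
    (by
      refine ContinuousOn.add (ContinuousOn.div continuousOn_const (by fun_prop) fun t ht =>
        (hτ t ht).1.ne') continuousOn_const)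
    (fun t _ => hasDerivAt_const t 0) continuousOn_const
    (fun t ht => by
      have h0 := (hτ t ht).1.ne'
      have h1 := (((hid t).const_mul 4).inv (by positivity)).const_mul (-1)
      have h2 : HasDerivAt (fun t => -1 / (4 * (t + t₀))) _ t := h1
      refine h2.congr_deriv ?_
      field_simp)
    (ContinuousOn.div continuousOn_const (by fun_prop) fun t ht => by
      have h0 := (hτ t ht).1.ne'
      positivity)
  have hF := isC21_quadratic (n := n) (T := S) 0 x₀
    (a := fun t => α * (2 * k - 1 / (t + t₀)))
    (a' := fun t => α / (t + t₀) ^ 2) (b := fun _ => 0) (b' := fun _ => 0)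
    (q := fun _ => 0) (q' := fun _ => 0)
    (fun t ht => by
      have h0 := (hτ t ht).1.ne'
      have h1 := (((hid t).inv h0).const_sub (2 * k)).const_mul α
      simp only [one_div]
      refine h1.congr_deriv ?_
      field_simp)
    (ContinuousOn.div continuousOn_const (by fun_prop) fun t ht => by
      have h0 := (hτ t ht).1.ne'
      positivity)
    (fun t _ => hasDerivAt_const t 0) continuousOn_const
    (fun t _ => hasDerivAt_const t 0) continuousOn_const
  have hkτ : ∀ t ∈ Icc 0 S, 16 * (k * (t + t₀)) ≤ 1 := fun t ht => by
    have := (hτ t ht).2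
    nlinarith
  have hK := isCompact_closedBall x₀ (2 * s)
  have hgg : (fun t (x : EuclideanSpace ℝ (Fin n)) =>
      -β * Real.log ((t + t₀) / (2 * t₀)) + 2 * k * α * (t + t₀) +
        0 * inner ℝ (0 : EuclideanSpace ℝ (Fin n)) x + -1 / (4 * (t + t₀)) * ‖x - x₀‖ ^ 2) = g := by
    rw [hgdef]
    funext t x
    simp [gaussianWeight]
  rw [hgg] at hg
  refine ⟨hg.cont, ?_⟩
  exact hU.carleman hΩ hK hKΩ hc hζ
    isClosed_closedBall.measurableSet hg hF (γ := fun t => -1 / (2 * (t + t₀)))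
    (m := fun t => (t + t₀) * Real.exp (k * (t + t₀)))
    (m' := fun t => (1 + k * (t + t₀)) * Real.exp (k * (t + t₀)))
    (fun t ht x => by
      have h0 := (hτ t ht).1.ne'
      rw [sum_quadratic_grad_sq]
      simp only [if_true, Finset.sum_const, Finset.card_univ, Fintype.card_fin, nsmul_eq_mul,
        norm_zero, inner_zero_left, hα]
      field_simp
      ring)
    (fun t ht x i j => by
      have h0 := (hτ t ht).1.ne'
      congr 1
      field_simp
      norm_num)
    (ContinuousOn.div continuousOn_const (by fun_prop) fun t ht => by
      have h0 := (hτ t ht).1.ne'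
      positivity)
    (fun t ht => by
      have h := (hid t).mul (((hid t).const_mul k).exp)
      refine h.congr_deriv ?_
      ring)
    (by fun_prop)
    (fun t ht => mul_nonneg (hτ t ht).1.le (Real.exp_pos _).le)
    (fun t ht x _ => by
      have h0 := (hτ t ht).1
      have h1 : 2 * k ≤ 1 / (t + t₀) := by
        rw [le_div_iff₀ h0]
        have := hkτ t ht
        have : 0 ≤ k * (t + t₀) := by positivity
        linarith
      simp only [zero_mul, add_zero]
      exact mul_nonpos_of_nonneg_of_nonpos (by linarith) (by linarith))
    (l := t₀) (Λ := 3) (T₀ := S / 2) ht₀.le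
    (fun t ht => by
      have h0 := hτ t ht
      have h1 : Real.exp (k * (t + t₀)) ≤ 3 :=
        (Real.exp_le_exp.2 (by have := hkτ t ht; nlinarith : k * (t + t₀) ≤ 1)).trans
          (by linarith [Real.exp_one_lt_d9])
      nlinarith [Real.exp_pos (k * (t + t₀))])
    (by linarith) (by linarith)
    (fun t ht x _ => by
      have h0 := hτ t ht
      have h1 : 1 ≤ Real.exp (k * (t + t₀)) := Real.one_le_exp (by nlinarith)
      have h2 : t₀ ≤ t + t₀ := by linarith [ht.1]
      have h3 : 1 / 2 * ((t + t₀) * Real.exp (k * (t + t₀))) *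
            (α / (t + t₀) ^ 2) + 1 / 2 * ((1 + k * (t + t₀)) * Real.exp (k * (t + t₀))) *
            (α * (2 * k - 1 / (t + t₀))) =
          Real.exp (k * (t + t₀)) * (1 / 2 * α * (k + 2 * k ^ 2 * (t + t₀))) := by
        have := h0.1.ne'
        field_simp
        ring
      simp only [zero_mul, add_zero, mul_zero, ite_self, Finset.sum_const_zero]
      rw [h3]
      have h4 : k ≤ 1 / 2 * α * (k + 2 * k ^ 2 * (t + t₀)) := by
        have : 0 ≤ 2 * k ^ 2 * (t + t₀) := by have := h0.1; positivity
        nlinarith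
      calc t₀ + c / 2 * ((t + t₀) * Real.exp (k * (t + t₀)))
          ≤ 1 * Real.exp (k * (t + t₀)) + c / 2 * (1 * Real.exp (k * (t + t₀))) := by
            gcongr
            · nlinarith
            · linarith
        _ = Real.exp (k * (t + t₀)) * k := by rw [hk]; ring
        _ ≤ _ := by gcongr)
    (fun t ht => by
      have h0 := hτ t ht
      have h1 : 1 ≤ Real.exp (k * (t + t₀)) := Real.one_le_exp (by nlinarith)
      have h2 : t₀ ≤ t + t₀ := by linarith [ht.1]
      have h3 : 2 * ((t + t₀) * Real.exp (k * (t + t₀))) * (-1 / (2 * (t + t₀))) +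
          (1 + k * (t + t₀)) * Real.exp (k * (t + t₀)) =
          Real.exp (k * (t + t₀)) * (k * (t + t₀)) := by
        have := h0.1.ne'
        field_simp
        ring
      rw [h3, hk]
      nlinarith)
    (N := closedBall x₀ (s / 4))
    (subset_inter (closedBall_subset_closedBall (by linarith))
      (closedBall_subset_closedBall (by linarith))) isClosed_closedBall.measurableSet

/-- Smallness at small times in the centre of a ball. -/
lemma IsSubsol.gaussian_smallness (hΩ : IsOpen Ω) (hc : 0 ≤ c) {S t₀ s β : ℝ}
    {x₀ : EuclideanSpace ℝ (Fin n)} (hU : IsSubsol S c Ω U Ut D DD)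
    (hζ : IsCutoff (closedBall x₀ (2 * s)) (closedBall x₀ s) B ζ ζd ζdd)
    (hKΩ : closedBall x₀ (2 * s) ⊆ Ω) (hs : 0 < s) (ht₀ : 0 < t₀) (htS : 12 * t₀ ≤ S)
    (hS : 32 * (c / 2 + 1) * S ≤ 1) (hβ : s ^ 2 = 8 * t₀ * β) (hβn : 2 + (n : ℝ) / 2 ≤ β) :
    t₀ * ∫ z in Icc 0 t₀ ×ˢ closedBall x₀ (s / 4), energyDensity U D z.1 z.2 ≤
      3 * ((3 * c + 15 * B) / 2 + 4 * (1 + B) / S) * (Real.exp (-(3 / 4) * β) *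
        ∫ z in Icc 0 S ×ˢ closedBall x₀ (2 * s), energyDensity U D z.1 z.2) := by
  have hB : 0 ≤ B := le_trans (by positivity) (hζ.grad_le 0)
  have hS0 : 0 < S := by linarith
  have hn0 : (0 : ℝ) ≤ n := Nat.cast_nonneg n
  have hβ0 : 0 ≤ β := by linarith
  have hK := isCompact_closedBall x₀ (2 * s)
  have hlin : ∀ t ∈ Icc 0 S, 2 * (c / 2 + 1) * (β - n / 2) * (t + t₀) ≤ β / 8 := fun t ht => by
    have h1 : 16 * ((c / 2 + 1) * (t + t₀)) ≤ 1 := by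
      have := ht.2
      nlinarith
    have h2 : 0 ≤ (c / 2 + 1) * (t + t₀) := by have := ht.1; positivity
    nlinarith
  obtain ⟨hgc, hmain⟩ := hU.carleman_gaussian hΩ hc hζ hKΩ hs ht₀ htS hS hβn rfl
  have hlow : ∀ z ∈ Icc 0 t₀ ×ˢ closedBall x₀ (s / 4), -(β / 8) ≤
      gaussianWeight (c / 2 + 1) (β - n / 2) β t₀ x₀ z.1 z.2 := fun z hz =>
    le_gaussianWeight (by linarith) (by linarith) ht₀ hβ hβ0 hz.1 hz.2
  have hup₁ : ∀ z ∈ Icc 0 S ×ˢ (closedBall x₀ (2 * s) \ closedBall x₀ s),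
      gaussianWeight (c / 2 + 1) (β - n / 2) β t₀ x₀ z.1 z.2 ≤ -(7 / 8 * β) := fun z hz =>
    gaussianWeight_le_of_le_dist ht₀ hβ hβ0 hs.le hz.1.1 (hlin _ hz.1) (not_le.1 hz.2.2).le
  have hup₂ : ∀ z ∈ Icc (S / 2) S ×ˢ closedBall x₀ (2 * s),
      gaussianWeight (c / 2 + 1) (β - n / 2) β t₀ x₀ z.1 z.2 ≤ -(7 / 8 * β) := fun z hz =>
    gaussianWeight_le_of_le_time ht₀ hβ0 htS hz.1.1 (hlin _ ⟨by linarith [hz.1.1], hz.1.2⟩)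
  have i1 := le_setIntegral_mul_exp hU hK hKΩ hgc
    (P := Icc 0 t₀ ×ˢ closedBall x₀ (s / 4)) (Q := Icc 0 (S / 2) ×ˢ closedBall x₀ (s / 4))
    (prod_mono_left (Icc_subset_Icc_right (by linarith)))
    (prod_mono (Icc_subset_Icc_right (by linarith))
      (closedBall_subset_closedBall (by linarith)))
    (measurableSet_Icc.prod isClosed_closedBall.measurableSet) hlow
  have i2 := setIntegral_mul_exp_le hU hK hKΩ hgc
    (P := Icc 0 S ×ˢ (closedBall x₀ (2 * s) \ closedBall x₀ s)) (Q := Icc 0 S ×ˢ closedBall x₀ (2 * s))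
    (prod_mono_right sdiff_subset) subset_rfl (measurableSet_Icc.prod
      (isClosed_closedBall.measurableSet.diff isClosed_closedBall.measurableSet)) hup₁
  have i3 := setIntegral_mul_exp_le hU hK hKΩ hgc
    (P := Icc (S / 2) S ×ˢ closedBall x₀ (2 * s)) (Q := Icc 0 S ×ˢ closedBall x₀ (2 * s))
    (prod_mono_left (Icc_subset_Icc_left (by linarith))) subset_rfl (measurableSet_Icc.prod
      isClosed_closedBall.measurableSet) hup₂
  set X := ∫ z in Icc 0 S ×ˢ closedBall x₀ (2 * s), energyDensity U D z.1 z.2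
  set Y := ∫ z in Icc 0 t₀ ×ˢ closedBall x₀ (s / 4), energyDensity U D z.1 z.2
  have hfin : t₀ * (Real.exp (-(β / 8)) * Y) ≤ 3 * ((3 * c + 15 * B) / 2 *
      (Real.exp (-(7 / 8 * β)) * X) + 2 * (1 + B) * ((S - S / 2)⁻¹ *
        (Real.exp (-(7 / 8 * β)) * X))) := by
    have hSS : 0 ≤ (S - S / 2)⁻¹ := inv_nonneg.2 (by linarith)
    refine (mul_le_mul_of_nonneg_left i1 ht₀.le).trans (hmain.trans ?_)
    gcongr
  have e1 : Real.exp (-(7 / 8 * β)) = Real.exp (-(β / 8)) * Real.exp (-(3 / 4) * β) := by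
    rw [← Real.exp_add]; ring_nf
  rw [e1] at hfin
  refine le_of_mul_le_mul_left (a := Real.exp (-(β / 8))) ?_ (Real.exp_pos _)
  have e2 : (S - S / 2)⁻¹ = 2 / S := by field_simp; ring
  rw [e2] at hfin
  calc _ = t₀ * (Real.exp (-(β / 8)) * Y) := by ring
    _ ≤ _ := hfin
    _ = _ := by ring

end Decay

section Exterior
variable {T c R M : ℝ} {Ω : Set (EuclideanSpace ℝ (Fin n))}
  {U Ut : Fin n → ℝ → EuclideanSpace ℝ (Fin n) → ℝ}
  {D : Fin n → Fin n → ℝ → EuclideanSpace ℝ (Fin n) → ℝ}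
  {DD : Fin n → Fin n → Fin n → ℝ → EuclideanSpace ℝ (Fin n) → ℝ}

lemma IsC21.mono_time {S : ℝ} {v vt : ℝ → EuclideanSpace ℝ (Fin n) → ℝ}
    {d : Fin n → ℝ → EuclideanSpace ℝ (Fin n) → ℝ}
    {dd : Fin n → Fin n → ℝ → EuclideanSpace ℝ (Fin n) → ℝ} (hv : IsC21 T Ω v vt d dd)
    (hS : S ≤ T) : IsC21 S Ω v vt d dd := by
  have h : Icc 0 S ⊆ Icc 0 T := Icc_subset_Icc_right hS
  exact ⟨hv.cont.mono (prod_mono_left h), hv.cont_t.mono (prod_mono_left h),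
    fun i => (hv.cont_d i).mono (prod_mono_left h),
    fun i j => (hv.cont_dd i j).mono (prod_mono_left h),
    fun t ht => hv.deriv_t t (Ioo_subset_Ioo_right hS ht), fun t ht => hv.deriv_d t (h ht),
    fun t ht => hv.deriv_dd t (h ht), fun t ht => hv.symm t (h ht)⟩

lemma IsSubsol.mono_time {S : ℝ} (hU : IsSubsol T c Ω U Ut D DD) (hS : S ≤ T) :
    IsSubsol S c Ω U Ut D DD :=
  ⟨fun k => (hU.regular k).mono_time hS, fun t ht => hU.ineq t ⟨ht.1, ht.2.trans hS⟩, hU.zero⟩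

lemma isOpen_norm_gt (R : ℝ) : IsOpen {x : EuclideanSpace ℝ (Fin n) | R < ‖x‖} :=
  isOpen_lt continuous_const continuous_norm

set_option maxHeartbeats 800000 in
/-- Solutions of Gaussian growth vanishing at time zero have arbitrarily fast Gaussian decay for
small times. -/
lemma IsSubsol.exists_gaussian_decay (hT : 0 < T) (hc : 0 ≤ c) (hR : 0 < R) (hM : 0 ≤ M)
    (hU : IsSubsol T c {x | R < ‖x‖} U Ut D DD)
    (hgr : ∀ t ∈ Icc 0 T, ∀ x, R < ‖x‖ → ∑ k, U k t x ^ 2 ≤ Real.exp (2 * M * ‖x‖ ^ 2)) (κ : ℝ) :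
    ∃ t₀, 0 < t₀ ∧ t₀ ≤ T ∧ ∃ C ρ₀, 0 ≤ C ∧ R < ρ₀ ∧ 1 ≤ ρ₀ ∧
      ∀ x₀ : EuclideanSpace ℝ (Fin n), ρ₀ ≤ ‖x₀‖ →
        ∫ z in Icc 0 t₀ ×ˢ closedBall x₀ (‖x₀‖ / 32), energyDensity U D z.1 z.2 ≤
          C * Real.exp (-κ * ‖x₀‖ ^ 2) := by
  obtain ⟨B, hB0, hB⟩ := exists_cutoff_ball n
  have hn0 : (0 : ℝ) ≤ n := Nat.cast_nonneg n
  set S := min T (1 / (32 * (c / 2 + 1))) with hSdef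
  have hS0 : 0 < S := lt_min hT (by positivity)
  have hST : S ≤ T := min_le_left _ _
  have hS1 : 32 * (c / 2 + 1) * S ≤ 1 := by
    have : S ≤ 1 / (32 * (c / 2 + 1)) := min_le_right _ _
    rwa [le_div_iff₀ (by positivity), mul_comm] at this
  set H := 9 / 2 * M + n + |κ| with hH
  have hH0 : 0 ≤ H := by positivity
  set t₀ := min (S / 12) (3 / (2048 * (H + 1))) with ht₀def
  have ht₀ : 0 < t₀ := lt_min (by positivity) (by positivity)
  have ht₀S : 12 * t₀ ≤ S := by
    have : t₀ ≤ S / 12 := min_le_left _ _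
    linarith
  have ht₀H : 2048 * t₀ * (H + 1) ≤ 3 := by
    have : t₀ ≤ 3 / (2048 * (H + 1)) := min_le_right _ _
    rw [le_div_iff₀ (by positivity)] at this
    linarith
  set V := volume.real (ball (0 : EuclideanSpace ℝ (Fin n)) 1) with hV
  have hV0 : 0 ≤ V := measureReal_nonneg
  set C₁ := 3 * ((3 * c + 15 * B) / 2 + 4 * (1 + B) / S) with hC₁
  set C₂ := 2 + (4 * c + 34 * B + 9) * S with hC₂
  have hC₁0 : 0 ≤ C₁ := by positivity
  have hC₂0 : 0 ≤ C₂ := by positivity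
  refine ⟨t₀, ht₀, by linarith, C₁ * C₂ * V / t₀, 8 + n + 2 * R, by positivity, by linarith,
    by linarith, fun x₀ hx₀ => ?_⟩
  set ρ := ‖x₀‖ with hρ
  have hρ8 : 8 ≤ ρ := by linarith
  set β := ρ ^ 2 / (512 * t₀) with hβ
  have hρβ : ρ ^ 2 = 512 * t₀ * β := by rw [hβ]; field_simp
  have hUS := hU.mono_time hST
  have hΩ := isOpen_norm_gt (n := n) R
  have hsub : closedBall x₀ (2 * (2 * (ρ / 8))) ⊆ {x | R < ‖x‖} := fun x hx => by
    rw [mem_closedBall, dist_eq_norm, norm_sub_rev] at hx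
    have := norm_sub_norm_le x₀ x
    change R < ‖x‖
    linarith
  have hsub' : closedBall x₀ (2 * (ρ / 8)) ⊆ closedBall x₀ (2 * (2 * (ρ / 8))) :=
    closedBall_subset_closedBall (by linarith)
  obtain ⟨ζ, ζd, ζdd, hζ⟩ := hB x₀ (ρ / 8) (by linarith)
  obtain ⟨η, ηd, ηdd, hη⟩ := hB x₀ (2 * (ρ / 8)) (by linarith)
  have h1 := hUS.gaussian_smallness hΩ hc hζ (hsub'.trans hsub) (by linarith) ht₀ ht₀S hS1
    (β := β) (by linarith) (by
      rw [hβ, le_div_iff₀ (by positivity)]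
      have : 32 * S ≤ 1 := by nlinarith
      have : 512 * t₀ ≤ 4 / 3 := by linarith
      nlinarith)
  have h2 := hUS.caccioppoli hΩ (isCompact_closedBall _ _) hsub hc hS0.le hη
    (A := Real.exp (9 / 2 * M * ρ ^ 2)) (fun t ht x hx => by
      refine (hgr t ⟨ht.1, ht.2.trans hST⟩ x (hsub hx)).trans (Real.exp_le_exp.2 ?_)
      rw [mem_closedBall, dist_eq_norm] at hx
      have h3 : ‖x‖ ≤ 3 / 2 * ρ := by
        have := norm_sub_norm_le x x₀
        linarith
      have h4 : ‖x‖ ^ 2 ≤ (3 / 2 * ρ) ^ 2 := by gcongr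
      have := mul_le_mul_of_nonneg_left h4 hM
      linarith)
    (N := closedBall x₀ (2 * (ρ / 8))) (subset_inter hsub' subset_rfl)
    isClosed_closedBall.measurableSet
  have h3 : volume.real (closedBall x₀ (2 * (2 * (ρ / 8)))) ≤ Real.exp (n * ρ ^ 2) * V := by
    rw [Measure.addHaar_real_closedBall _ _ (by positivity), finrank_euclideanSpace_fin]
    refine mul_le_mul_of_nonneg_right ?_ hV0
    calc (2 * (2 * (ρ / 8))) ^ n ≤ (Real.exp ρ) ^ n := by
          gcongr
          linarith [Real.add_one_le_exp ρ]
      _ = Real.exp (n * ρ) := by rw [← Real.exp_nat_mul]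
      _ ≤ Real.exp (n * ρ ^ 2) := by
          gcongr
          nlinarith
  have e1 : ρ / 8 / 4 = ρ / 32 := by ring
  rw [e1] at h1
  set X := ∫ z in Icc 0 S ×ˢ closedBall x₀ (2 * (ρ / 8)), energyDensity U D z.1 z.2
  set Y := ∫ z in Icc 0 t₀ ×ˢ closedBall x₀ (ρ / 32), energyDensity U D z.1 z.2
  have h4 : X ≤ C₂ * (Real.exp (9 / 2 * M * ρ ^ 2) * (Real.exp (n * ρ ^ 2) * V)) :=
    h2.trans (by gcongr)
  have h5 : Real.exp (-(3 / 4) * β) ≤ Real.exp (-H * ρ ^ 2) := by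
    refine Real.exp_le_exp.2 ?_
    have hβ0 : 0 ≤ β := by positivity
    have : H * (512 * t₀ * β) ≤ 3 / 4 * β := by
      have : 512 * t₀ * H ≤ 3 / 4 := by nlinarith
      calc _ = (512 * t₀ * H) * β := by ring
        _ ≤ _ := by gcongr
    rw [hρβ]
    linarith
  have h6 : t₀ * Y ≤ C₁ * (Real.exp (-H * ρ ^ 2) *
      (C₂ * (Real.exp (9 / 2 * M * ρ ^ 2) * (Real.exp (n * ρ ^ 2) * V)))) := by
    have hX0 : 0 ≤ X := integral_nonneg fun z => energyDensity_nonneg _ _ _ _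
    refine h1.trans ?_
    gcongr
  have h7 : Real.exp (-H * ρ ^ 2) * (Real.exp (9 / 2 * M * ρ ^ 2) * Real.exp (n * ρ ^ 2)) ≤
      Real.exp (-κ * ρ ^ 2) := by
    rw [← Real.exp_add, ← Real.exp_add]
    refine Real.exp_le_exp.2 ?_
    have : κ * ρ ^ 2 ≤ |κ| * ρ ^ 2 := by gcongr; exact le_abs_self κ
    rw [hH]
    linarith
  rw [div_mul_eq_mul_div, le_div_iff₀ ht₀]
  calc Y * t₀ = t₀ * Y := mul_comm _ _
    _ ≤ _ := h6
    _ = C₁ * C₂ * V * (Real.exp (-H * ρ ^ 2) *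
      (Real.exp (9 / 2 * M * ρ ^ 2) * Real.exp (n * ρ ^ 2))) := by ring
    _ ≤ _ := mul_le_mul_of_nonneg_left h7 (by positivity)

end Exterior

section UnionBound
variable {α : Type*} [MeasurableSpace α] {μ : Measure α} {f : α → ℝ}

lemma setIntegral_union_le_add (hf : ∀ x, 0 ≤ f x) {s t : Set α} (hs : IntegrableOn f s μ)
    (ht : IntegrableOn f t μ) : ∫ x in s ∪ t, f x ∂μ ≤ ∫ x in s, f x ∂μ + ∫ x in t, f x ∂μ := by
  rw [← integral_add_measure hs ht]
  exact integral_mono_measure (Measure.restrict_union_le s t) (Filter.Eventually.of_forall hf)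
    (Integrable.add_measure hs ht)

lemma setIntegral_biUnion_finset_le {ι : Type*} (hf : ∀ x, 0 ≤ f x) (F : Finset ι) {B : ι → Set α}
    (hB : ∀ i ∈ F, IntegrableOn f (B i) μ) :
    ∫ x in ⋃ i ∈ F, B i, f x ∂μ ≤ ∑ i ∈ F, ∫ x in B i, f x ∂μ := by
  classical
  induction F using Finset.induction_on with
  | empty => simp
  | insert i F hi ih =>
    rw [Finset.set_biUnion_insert, Finset.sum_insert hi]
    have h1 := hB i (Finset.mem_insert_self i F)
    have h2 : ∀ j ∈ F, IntegrableOn f (B j) μ := fun j hj => hB j (Finset.mem_insert_of_mem hj)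
    have h3 : IntegrableOn f (⋃ j ∈ F, B j) μ := by
      rw [integrableOn_finset_iUnion]; exact h2
    exact (setIntegral_union_le_add hf h1 h3).trans (by linarith [ih h2])

end UnionBound

/-- Annuli are covered by boundedly many balls of proportional radius. -/
lemma exists_annulus_cover (n : ℕ) : ∃ F : Finset (EuclideanSpace ℝ (Fin n)),
    (∀ z ∈ F, 1 ≤ ‖z‖) ∧ ∀ ρ : ℝ, 0 < ρ → ∀ x : EuclideanSpace ℝ (Fin n), ρ ≤ ‖x‖ → ‖x‖ ≤ 2 * ρ →
      ∃ z ∈ F, x ∈ closedBall (ρ • z) (‖ρ • z‖ / 32) := by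
  have hcpt : IsCompact (closedBall (0 : EuclideanSpace ℝ (Fin n)) 2 ∩ {x | 1 ≤ ‖x‖}) :=
    (isCompact_closedBall _ _).inter_right (isClosed_le continuous_const continuous_norm)
  obtain ⟨t, hts, htf, hcov⟩ := hcpt.finite_cover_balls (e := 1 / 32) (by norm_num)
  refine ⟨htf.toFinset, fun z hz => (hts (htf.mem_toFinset.1 hz)).2, fun ρ hρ x h1 h2 => ?_⟩
  have hx : ρ⁻¹ • x ∈ closedBall (0 : EuclideanSpace ℝ (Fin n)) 2 ∩ {x | 1 ≤ ‖x‖} := by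
    have hn : ‖ρ⁻¹ • x‖ = ρ⁻¹ * ‖x‖ := by rw [norm_smul, norm_inv, Real.norm_of_nonneg hρ.le]
    refine ⟨?_, ?_⟩
    · rw [mem_closedBall_zero_iff, hn, inv_mul_le_iff₀ hρ]; linarith
    · change 1 ≤ ‖ρ⁻¹ • x‖
      rw [hn, le_inv_mul_iff₀ hρ]; linarith
  obtain ⟨z, hz, hxz⟩ := mem_iUnion₂.1 (hcov hx)
  refine ⟨z, htf.mem_toFinset.2 hz, ?_⟩
  have hz1 : 1 ≤ ‖z‖ := (hts hz).2
  rw [mem_ball, dist_eq_norm] at hxz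
  rw [mem_closedBall, dist_eq_norm, norm_smul, Real.norm_of_nonneg hρ.le]
  have e1 : x - ρ • z = ρ • (ρ⁻¹ • x - z) := by rw [smul_sub, smul_inv_smul₀ hρ.ne']
  rw [e1, norm_smul, Real.norm_of_nonneg hρ.le]
  nlinarith

section Exterior
variable {T c R M : ℝ} {Ω : Set (EuclideanSpace ℝ (Fin n))}
  {U Ut : Fin n → ℝ → EuclideanSpace ℝ (Fin n) → ℝ}
  {D : Fin n → Fin n → ℝ → EuclideanSpace ℝ (Fin n) → ℝ}
  {DD : Fin n → Fin n → Fin n → ℝ → EuclideanSpace ℝ (Fin n) → ℝ}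

lemma isCompact_annulus (a b : ℝ) :
    IsCompact {x : EuclideanSpace ℝ (Fin n) | a ≤ ‖x‖ ∧ ‖x‖ ≤ b} := by
  have h : {x : EuclideanSpace ℝ (Fin n) | a ≤ ‖x‖ ∧ ‖x‖ ≤ b} =
      closedBall 0 b ∩ {x | a ≤ ‖x‖} := by
    ext x
    simp [and_comm]
  rw [h]
  exact (isCompact_closedBall _ _).inter_right (isClosed_le continuous_const continuous_norm)

/-- Weighted integrals over annuli of solutions with Gaussian decay. -/
lemma IsSubsol.annulus_le (hU : IsSubsol T c {x | R < ‖x‖} U Ut D DD) {F : Finset (EuclideanSpace ℝ (Fin n))}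
    (hF1 : ∀ z ∈ F, 1 ≤ ‖z‖)
    (hF : ∀ ρ : ℝ, 0 < ρ → ∀ x : EuclideanSpace ℝ (Fin n), ρ ≤ ‖x‖ → ‖x‖ ≤ 2 * ρ →
      ∃ z ∈ F, x ∈ closedBall (ρ • z) (‖ρ • z‖ / 32))
    {κ C ρ₀ : ℝ} (hκ : 0 ≤ κ) (hC : 0 ≤ C) (hRρ : 2 * R < ρ₀) (hρ₀ : 1 ≤ ρ₀)
    (hdec : ∀ x₀ : EuclideanSpace ℝ (Fin n), ρ₀ ≤ ‖x₀‖ →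
        ∫ z in Icc 0 T ×ˢ closedBall x₀ (‖x₀‖ / 32), energyDensity U D z.1 z.2 ≤
          C * Real.exp (-(4 * κ + 1) * ‖x₀‖ ^ 2)) {ρ : ℝ} (hρ : ρ₀ ≤ ρ) :
    ∫ z in Icc 0 T ×ˢ {x | ρ ≤ ‖x‖ ∧ ‖x‖ ≤ 2 * ρ},
      energyDensity U D z.1 z.2 * Real.exp (κ * ‖z.2‖ ^ 2) ≤ F.card * C / ρ := by
  have hρ0 : 0 < ρ := by linarith
  have hΩs : {x : EuclideanSpace ℝ (Fin n) | ρ ≤ ‖x‖ ∧ ‖x‖ ≤ 2 * ρ} ⊆ {x | R < ‖x‖} := fun x hx => by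
    have : ρ ≤ ‖x‖ := hx.1
    change R < ‖x‖
    linarith
  have hzρ : ∀ z ∈ F, ρ ≤ ‖ρ • z‖ := fun z hz => by
    rw [norm_smul, Real.norm_of_nonneg hρ0.le]
    have := hF1 z hz
    nlinarith
  have hint : ∀ z ∈ F, IntegrableOn (fun z : ℝ × EuclideanSpace ℝ (Fin n) => energyDensity U D z.1 z.2)
      (Icc 0 T ×ˢ closedBall (ρ • z) (‖ρ • z‖ / 32)) := fun z hz => by
    refine hU.integrableOn_density (isCompact_closedBall _ _) fun x hx => ?_
    rw [mem_closedBall, dist_eq_norm, norm_sub_rev] at hx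
    have h1 := norm_sub_norm_le (ρ • z) x
    have h2 := hzρ z hz
    change R < ‖x‖
    linarith
  have h1 := setIntegral_mul_exp_le hU (isCompact_annulus ρ (2 * ρ)) hΩs
    (g := fun _ x => κ * ‖x‖ ^ 2) (b := κ * (2 * ρ) ^ 2)
    (by unfold Function.uncurry; fun_prop) subset_rfl subset_rfl
    (measurableSet_Icc.prod (isCompact_annulus ρ (2 * ρ)).isClosed.measurableSet) (by
      rintro z ⟨_, hz⟩
      have : ‖z.2‖ ≤ 2 * ρ := hz.2
      gcongr)
  have h2 : ∫ z in Icc 0 T ×ˢ {x : EuclideanSpace ℝ (Fin n) | ρ ≤ ‖x‖ ∧ ‖x‖ ≤ 2 * ρ},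
      energyDensity U D z.1 z.2 ≤
      ∫ z in ⋃ z ∈ F, Icc 0 T ×ˢ closedBall (ρ • z) (‖ρ • z‖ / 32), energyDensity U D z.1 z.2 := by
    refine setIntegral_mono_set ?_ (Filter.Eventually.of_forall fun z =>
      energyDensity_nonneg _ _ _ _) (LE.le.eventuallyLE ?_)
    · rw [integrableOn_finset_iUnion]; exact hint
    · rintro ⟨t, x⟩ ⟨ht, hx⟩
      obtain ⟨z, hz, hxz⟩ := hF ρ hρ0 x hx.1 hx.2
      exact mem_iUnion₂.2 ⟨z, hz, ht, hxz⟩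
  have h3 := setIntegral_biUnion_finset_le (fun z : ℝ × EuclideanSpace ℝ (Fin n) =>
    energyDensity_nonneg U D z.1 z.2) F hint
  have h4 := Finset.sum_le_card_nsmul F (fun z => ∫ z in
    Icc 0 T ×ˢ closedBall (ρ • z) (‖ρ • z‖ / 32), energyDensity U D z.1 z.2)
    (C * Real.exp (-(4 * κ + 1) * ρ ^ 2)) fun z hz => by
      have h5 := hzρ z hz
      refine (hdec _ (hρ.trans h5)).trans ?_
      refine mul_le_mul_of_nonneg_left (Real.exp_le_exp.2 ?_) hC
      have : ρ ^ 2 ≤ ‖ρ • z‖ ^ 2 := by gcongr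
      nlinarith
  rw [nsmul_eq_mul] at h4
  have h6 : Real.exp (κ * (2 * ρ) ^ 2) * Real.exp (-(4 * κ + 1) * ρ ^ 2) ≤ 1 / ρ := by
    rw [← Real.exp_add, show κ * (2 * ρ) ^ 2 + -(4 * κ + 1) * ρ ^ 2 = -ρ ^ 2 by ring, neg_eq_neg_one_mul,
      ← neg_eq_neg_one_mul, Real.exp_neg, one_div]
    refine inv_anti₀ hρ0 ?_
    have := Real.add_one_le_exp (ρ ^ 2)
    nlinarith
  calc _ ≤ _ := h1
    _ ≤ Real.exp (κ * (2 * ρ) ^ 2) * (F.card * (C * Real.exp (-(4 * κ + 1) * ρ ^ 2))) :=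
        mul_le_mul_of_nonneg_left (h2.trans (h3.trans h4)) (Real.exp_pos _).le
    _ = F.card * C * (Real.exp (κ * (2 * ρ) ^ 2) * Real.exp (-(4 * κ + 1) * ρ ^ 2)) := by ring
    _ ≤ F.card * C * (1 / ρ) := mul_le_mul_of_nonneg_left h6 (by positivity)
    _ = _ := by ring

/-- Solutions of Gaussian growth vanishing at time zero are integrable against arbitrary growing
Gaussians for small times. -/
lemma IsSubsol.exists_weighted_bound (hT : 0 < T) (hc : 0 ≤ c) (hR : 0 < R) (hM : 0 ≤ M)
    (hU : IsSubsol T c {x | R < ‖x‖} U Ut D DD)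
    (hgr : ∀ t ∈ Icc 0 T, ∀ x, R < ‖x‖ → ∑ k, U k t x ^ 2 ≤ Real.exp (2 * M * ‖x‖ ^ 2))
    {κ : ℝ} (hκ : 0 ≤ κ) :
    ∃ t₀, 0 < t₀ ∧ t₀ ≤ T ∧ ∀ δ : ℝ, 0 < δ → ∃ A, 0 ≤ A ∧ ∀ r,
      ∫ z in Icc 0 t₀ ×ˢ {x | R + δ ≤ ‖x‖ ∧ ‖x‖ ≤ r},
        energyDensity U D z.1 z.2 * Real.exp (κ * ‖z.2‖ ^ 2) ≤ A := by
  obtain ⟨t₀, ht₀, ht₀T, C, ρ₀, hC, hRρ, hρ1, hdec⟩ :=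
    hU.exists_gaussian_decay hT hc hR hM hgr (4 * κ + 1)
  obtain ⟨F, hF1, hF⟩ := exists_annulus_cover n
  refine ⟨t₀, ht₀, ht₀T, fun δ hδ => ?_⟩
  have hU' := hU.mono_time ht₀T
  set ρ := 2 * ρ₀ with hρ
  set f : ℝ × EuclideanSpace ℝ (Fin n) → ℝ :=
    fun z => energyDensity U D z.1 z.2 * Real.exp (κ * ‖z.2‖ ^ 2) with hf
  have hf0 : ∀ z, 0 ≤ f z := fun z => mul_nonneg (energyDensity_nonneg _ _ _ _) (Real.exp_pos _).le
  have hfi : ∀ a b, R < a → IntegrableOn f (Icc 0 t₀ ×ˢ {x | a ≤ ‖x‖ ∧ ‖x‖ ≤ b}) := fun a b ha =>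
    hU'.integrableOn_weighted (isCompact_annulus a b)
      (fun x hx => lt_of_lt_of_le ha (show a ≤ ‖x‖ from hx.1)) (g := fun _ x => κ * ‖x‖ ^ 2)
      (by unfold Function.uncurry; fun_prop)
  have hann : ∀ σ, ρ ≤ σ → ∫ z in Icc 0 t₀ ×ˢ {x | σ ≤ ‖x‖ ∧ ‖x‖ ≤ 2 * σ}, f z ≤
      F.card * C / σ := fun σ hσ =>
    hU'.annulus_le hF1 hF hκ hC (by linarith : 2 * R < ρ) (by linarith)
      (fun x₀ hx₀ => hdec x₀ (by linarith)) hσ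
  set Q := F.card * C with hQ
  have hQ0 : 0 ≤ Q := by positivity
  have hdy : ∀ J : ℕ, ∫ z in Icc 0 t₀ ×ˢ {x | ρ ≤ ‖x‖ ∧ ‖x‖ ≤ 2 ^ J * ρ}, f z ≤
      Q * (3 - 2 * (1 / 2) ^ J) := by
    intro J
    have h2 : ∀ J : ℕ, ρ ≤ 2 ^ J * ρ := fun J => le_mul_of_one_le_left (by linarith)
      (one_le_pow₀ (by norm_num))
    have hstep : ∀ J : ℕ, ∫ z in Icc 0 t₀ ×ˢ {x | 2 ^ J * ρ ≤ ‖x‖ ∧ ‖x‖ ≤ 2 * (2 ^ J * ρ)}, f z ≤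
        Q * (1 / 2) ^ J := fun J => by
      refine (hann _ (h2 J)).trans ?_
      rw [one_div, inv_pow, div_eq_mul_inv]
      refine mul_le_mul_of_nonneg_left (inv_anti₀ (by positivity) ?_) hQ0
      exact le_mul_of_one_le_right (by positivity) (by linarith)
    induction J with
    | zero =>
      have h3 := hstep 0
      simp only [pow_zero, one_mul, mul_one] at h3 ⊢
      refine le_trans (setIntegral_mono_set (hfi ρ (2 * ρ) (by linarith))
        (Filter.Eventually.of_forall hf0) (LE.le.eventuallyLE ?_)) (h3.trans (by linarith))
      refine prod_mono_right fun x hx => ⟨hx.1, ?_⟩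
      have : ‖x‖ ≤ ρ := hx.2
      linarith
    | succ J ih =>
      have h4 := setIntegral_union_le_add hf0 (hfi ρ (2 ^ J * ρ) (by linarith))
        (hfi (2 ^ J * ρ) (2 * (2 ^ J * ρ)) (by linarith [h2 J]))
      have h5 : ∫ z in Icc 0 t₀ ×ˢ {x | ρ ≤ ‖x‖ ∧ ‖x‖ ≤ 2 ^ (J + 1) * ρ}, f z ≤
          ∫ z in Icc 0 t₀ ×ˢ {x | ρ ≤ ‖x‖ ∧ ‖x‖ ≤ 2 ^ J * ρ} ∪
            Icc 0 t₀ ×ˢ {x | 2 ^ J * ρ ≤ ‖x‖ ∧ ‖x‖ ≤ 2 * (2 ^ J * ρ)}, f z := by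
        refine setIntegral_mono_set ((hfi ρ (2 ^ J * ρ) (by linarith)).union
          (hfi (2 ^ J * ρ) (2 * (2 ^ J * ρ)) (by linarith [h2 J])))
          (Filter.Eventually.of_forall hf0) (LE.le.eventuallyLE ?_)
        rintro ⟨t, x⟩ ⟨ht, hx1, hx2⟩
        rcases le_total ‖x‖ (2 ^ J * ρ) with h | h
        · exact Or.inl ⟨ht, hx1, h⟩
        · exact Or.inr ⟨ht, h, hx2.trans (le_of_eq (by ring))⟩
      have h6 := hstep J
      have h7 : ((1 : ℝ) / 2) ^ (J + 1) = 1 / 2 * (1 / 2) ^ J := by ring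
      rw [h7]
      linarith
  have hA0 : 0 ≤ ∫ z in Icc 0 t₀ ×ˢ {x | R + δ ≤ ‖x‖ ∧ ‖x‖ ≤ ρ}, f z := integral_nonneg hf0
  refine ⟨(∫ z in Icc 0 t₀ ×ˢ {x | R + δ ≤ ‖x‖ ∧ ‖x‖ ≤ ρ}, f z) + Q * 3, by positivity, fun r => ?_⟩
  obtain ⟨J, hJ⟩ : ∃ J : ℕ, r ≤ 2 ^ J * ρ := by
    obtain ⟨J, hJ⟩ := pow_unbounded_of_one_lt r (one_lt_two)
    exact ⟨J, hJ.le.trans (le_mul_of_one_le_right (by positivity) (by linarith))⟩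
  have i1 := hfi (R + δ) ρ (by linarith)
  have i2 := hfi ρ (2 ^ J * ρ) (by linarith)
  have h8 : ∫ z in Icc 0 t₀ ×ˢ {x | R + δ ≤ ‖x‖ ∧ ‖x‖ ≤ r}, f z ≤
      ∫ z in Icc 0 t₀ ×ˢ {x | R + δ ≤ ‖x‖ ∧ ‖x‖ ≤ ρ} ∪
        Icc 0 t₀ ×ˢ {x | ρ ≤ ‖x‖ ∧ ‖x‖ ≤ 2 ^ J * ρ}, f z := by
    refine setIntegral_mono_set (i1.union i2) (Filter.Eventually.of_forall hf0)
      (LE.le.eventuallyLE ?_)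
    rintro ⟨t, x⟩ ⟨ht, hx1, hx2⟩
    rcases le_total ‖x‖ ρ with h | h
    · exact Or.inl ⟨ht, hx1, h⟩
    · exact Or.inr ⟨ht, h, hx2.trans hJ⟩
  have h9 := setIntegral_union_le_add hf0 i1 i2
  have h10 : Q * (3 - 2 * (1 / 2) ^ J) ≤ Q * 3 := by
    refine mul_le_mul_of_nonneg_left ?_ hQ0
    have : (0 : ℝ) ≤ (1 / 2) ^ J := by positivity
    linarith
  exact h8.trans (h9.trans (add_le_add le_rfl ((hdy J).trans h10)))

end Exterior

section HalfSpace
variable {T c R M B : ℝ}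
  {ζ : EuclideanSpace ℝ (Fin n) → ℝ} {ζd : Fin n → EuclideanSpace ℝ (Fin n) → ℝ}
  {ζdd : Fin n → Fin n → EuclideanSpace ℝ (Fin n) → ℝ}
  {U Ut : Fin n → ℝ → EuclideanSpace ℝ (Fin n) → ℝ}
  {D : Fin n → Fin n → ℝ → EuclideanSpace ℝ (Fin n) → ℝ}
  {DD : Fin n → Fin n → Fin n → ℝ → EuclideanSpace ℝ (Fin n) → ℝ}

lemma inner_le_norm_of_unit {e : EuclideanSpace ℝ (Fin n)} (he : ‖e‖ = 1)
    (x : EuclideanSpace ℝ (Fin n)) : inner ℝ e x ≤ ‖x‖ := by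
  simpa [he] using real_inner_le_norm e x

/-- The Carleman weight for half-spaces `{⟪e,x⟫ ≥ R}`. -/
def halfSpaceWeight (k α R S : ℝ) (e : EuclideanSpace ℝ (Fin n)) (t : ℝ)
    (x : EuclideanSpace ℝ (Fin n)) : ℝ :=
  α * (S - t) * (inner ℝ e x - R) + k * ‖x‖ ^ 2

lemma isCompact_halfBall (e : EuclideanSpace ℝ (Fin n)) (a r : ℝ) :
    IsCompact (closedBall (0 : EuclideanSpace ℝ (Fin n)) r ∩ {x | a ≤ inner ℝ e x}) :=
  (isCompact_closedBall _ _).inter_right (isClosed_le continuous_const (by fun_prop))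

lemma halfBall_subset_norm_gt {e : EuclideanSpace ℝ (Fin n)} (he : ‖e‖ = 1) {a r : ℝ} (hR : R < a) :
    closedBall (0 : EuclideanSpace ℝ (Fin n)) r ∩ {x | a ≤ inner ℝ e x} ⊆ {x | R < ‖x‖} :=
  fun x hx => hR.trans_le (le_trans (show a ≤ inner ℝ e x from hx.2) (inner_le_norm_of_unit he x))

/-- Carleman inequality on half-balls. -/
lemma IsSubsol.carleman_halfBall (hc : 0 ≤ c) (hR : 0 < R) {S α δ r T₀ : ℝ}
    {e : EuclideanSpace ℝ (Fin n)} (he : ‖e‖ = 1) (hU : IsSubsol S c {x | R < ‖x‖} U Ut D DD)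
    (hδ : 0 < δ)
    (hζ : IsCutoff (closedBall 0 (2 * r) ∩ {x | R + δ ≤ inner ℝ e x})
        (closedBall 0 r ∩ {x | R + 3 * δ ≤ inner ℝ e x}) B ζ ζd ζdd)
    (hα : 4 * (c / 2 + 1) * n + 1 ≤ 2 * α * R) (hT₀ : 0 ≤ T₀) (hT₀S : T₀ < S)
    {N : Set (EuclideanSpace ℝ (Fin n))}
    (hN : N ⊆ closedBall 0 (2 * r) ∩ {x | R + δ ≤ inner ℝ e x} ∩
      (closedBall 0 r ∩ {x | R + 3 * δ ≤ inner ℝ e x})) (hNm : MeasurableSet N)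
    {g : ℝ → EuclideanSpace ℝ (Fin n) → ℝ} (hgdef : g = halfSpaceWeight (c / 2 + 1) α R S e) :
    ContinuousOn (Function.uncurry g) (Icc 0 S ×ˢ univ) ∧
    ∫ z in Icc 0 T₀ ×ˢ N, energyDensity U D z.1 z.2 * Real.exp (g z.1 z.2) ≤
      (3 * c + 15 * B) / 2 *
          (∫ z in Icc 0 S ×ˢ ((closedBall 0 (2 * r) ∩ {x | R + δ ≤ inner ℝ e x}) \
            (closedBall 0 r ∩ {x | R + 3 * δ ≤ inner ℝ e x})),
            energyDensity U D z.1 z.2 * Real.exp (g z.1 z.2))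
        + 2 * (1 + B) * ((S - T₀)⁻¹ *
          ∫ z in Icc T₀ S ×ˢ (closedBall 0 (2 * r) ∩ {x | R + δ ≤ inner ℝ e x}),
            energyDensity U D z.1 z.2 * Real.exp (g z.1 z.2)) := by
  set k := c / 2 + 1 with hk
  have hk1 : 1 ≤ k := by linarith
  have hn0 : (0 : ℝ) ≤ n := Nat.cast_nonneg n
  have hα0 : 0 < α := by
    have : 0 < 2 * α * R := lt_of_lt_of_le (by positivity) hα
    by_contra! h
    nlinarith
  have hid : ∀ t : ℝ, HasDerivAt (fun t => S - t) (-1) t := fun t => (hasDerivAt_id t).const_sub S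
  have hg := isC21_quadratic (n := n) (T := S) e 0
    (a := fun t => -α * R * (S - t)) (a' := fun _ => α * R)
    (b := fun t => α * (S - t)) (b' := fun _ => -α) (q := fun _ => k) (q' := fun _ => 0)
    (fun t _ => ((hid t).const_mul (-α * R)).congr_deriv (by ring)) continuousOn_const
    (fun t _ => ((hid t).const_mul α).congr_deriv (by ring)) continuousOn_const
    (fun t _ => hasDerivAt_const t k) continuousOn_const
  have hF := isC21_quadratic (n := n) (T := S) e 0
    (a := fun t => α * R - 2 * k * n - α ^ 2 * (S - t) ^ 2)
    (a' := fun t => 2 * α ^ 2 * (S - t))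
    (b := fun t => -α - 4 * k * α * (S - t)) (b' := fun _ => 4 * k * α)
    (q := fun _ => -4 * k ^ 2) (q' := fun _ => 0)
    (fun t _ => ((((hid t).pow 2).const_mul (α ^ 2)).const_sub (α * R - 2 * k * n)).congr_deriv
      (by simp; ring)) (by fun_prop)
    (fun t _ => (((hid t).const_mul (4 * k * α)).const_sub (-α)).congr_deriv (by ring))
    continuousOn_const
    (fun t _ => hasDerivAt_const t (-4 * k ^ 2)) continuousOn_const
  have hgg : (fun t (x : EuclideanSpace ℝ (Fin n)) =>
      -α * R * (S - t) + α * (S - t) * inner ℝ e x + k * ‖x - 0‖ ^ 2) = g := by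
    rw [hgdef]
    funext t x
    simp only [halfSpaceWeight, sub_zero]
    ring
  rw [hgg] at hg
  refine ⟨hg.cont, ?_⟩
  have hy : ∀ x ∈ closedBall (0 : EuclideanSpace ℝ (Fin n)) (2 * r) ∩ {x | R + δ ≤ inner ℝ e x},
      R ≤ inner ℝ e x := fun x hx => by
    have : R + δ ≤ inner ℝ e x := hx.2
    linarith
  have key := hU.carleman (isOpen_norm_gt R) (isCompact_halfBall e _ _)
    (halfBall_subset_norm_gt he (by linarith)) hc hζ
    (isCompact_halfBall e _ _).isClosed.measurableSet hg hF (γ := fun _ => 2 * k)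
    (m := fun _ => 1) (m' := fun _ => 0)
    (fun t ht x => by
      rw [sum_quadratic_grad_sq]
      simp only [if_true, Finset.sum_const, Finset.card_univ, Fintype.card_fin, nsmul_eq_mul,
        he, sub_zero]
      ring)
    (fun t ht x i j => rfl) continuousOn_const (fun t _ => hasDerivAt_const t 1)
    continuousOn_const (fun t _ => zero_le_one)
    (fun t ht x hx => by
      have h1 := hy x hx
      have h2 : 0 ≤ S - t := by linarith [ht.2]
      have h3 : α * R ≤ α * inner ℝ e x := by gcongr
      have h4 : 0 ≤ 4 * k * α * (S - t) * inner ℝ e x := by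
        have : 0 ≤ inner ℝ e x := hR.le.trans h1
        positivity
      have h5 : 0 ≤ 4 * k ^ 2 * ‖x - 0‖ ^ 2 := by positivity
      have h6 : 0 ≤ 2 * k * n + α ^ 2 * (S - t) ^ 2 := by positivity
      nlinarith)
    (l := 1) (Λ := 1) (T₀ := T₀) zero_le_one (fun t _ => le_rfl) hT₀ hT₀S
    (fun t ht x hx => by
      have h1 := hy x hx
      have h2 : 0 ≤ 2 * α ^ 2 * (S - t) := by
        have : 0 ≤ S - t := by linarith [ht.2]
        positivity
      have h3 : 4 * k * α * R ≤ 4 * k * α * inner ℝ e x := by gcongr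
      have h4 : 2 * k * (4 * k * n + 1) ≤ 2 * k * (2 * α * R) := by gcongr
      simp only [if_true, Finset.sum_const, Finset.card_univ, Fintype.card_fin, nsmul_eq_mul]
      nlinarith)
    (fun t ht => by linarith)
    hN hNm
  simpa only [one_mul] using key

/-- Comparison of weighted integrals. -/
lemma setIntegral_mul_exp_le_mul {S : ℝ} {Ω K : Set (EuclideanSpace ℝ (Fin n))}
    (hU : IsSubsol S c Ω U Ut D DD) (hK : IsCompact K)
    (hKΩ : K ⊆ Ω) {g h : ℝ → EuclideanSpace ℝ (Fin n) → ℝ}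
    (hg : ContinuousOn (Function.uncurry g) (Icc 0 S ×ˢ univ))
    (hh : ContinuousOn (Function.uncurry h) (Icc 0 S ×ˢ univ)) {b : ℝ}
    {P : Set (ℝ × EuclideanSpace ℝ (Fin n))} (hP : P ⊆ Icc 0 S ×ˢ K)
    (hPm : MeasurableSet P) (hb : ∀ z ∈ P, g z.1 z.2 ≤ b + h z.1 z.2) :
    ∫ z in P, energyDensity U D z.1 z.2 * Real.exp (g z.1 z.2) ≤
      Real.exp b * ∫ z in Icc 0 S ×ˢ K, energyDensity U D z.1 z.2 * Real.exp (h z.1 z.2) := by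
  have h1 := (hU.integrableOn_weighted hK hKΩ hg).mono_set hP
  have h2 := hU.integrableOn_weighted hK hKΩ hh
  calc _ ≤ ∫ z in P, Real.exp b * (energyDensity U D z.1 z.2 * Real.exp (h z.1 z.2)) := by
        refine setIntegral_mono_on h1 ((h2.mono_set hP).const_mul _) hPm fun z hz => ?_
        rw [mul_left_comm, ← Real.exp_add]
        exact mul_le_mul_of_nonneg_left (Real.exp_le_exp.2 (hb z hz))
          (energyDensity_nonneg _ _ _ _)
    _ = Real.exp b * ∫ z in P, energyDensity U D z.1 z.2 * Real.exp (h z.1 z.2) :=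
        integral_const_mul _ _
    _ ≤ _ := by
        refine mul_le_mul_of_nonneg_left ?_ (Real.exp_pos b).le
        exact setIntegral_mono_set h2 (Filter.Eventually.of_forall fun z =>
          mul_nonneg (energyDensity_nonneg _ _ _ _) (Real.exp_pos _).le) hP.eventuallyLE

/-- Quantitative smallness in half-balls at times before the final one. -/
lemma IsSubsol.halfBall_le (hc : 0 ≤ c) (hR : 0 < R) {S A δ r₀ y t₂ α : ℝ}
    {e : EuclideanSpace ℝ (Fin n)} (he : ‖e‖ = 1) (hU : IsSubsol S c {x | R < ‖x‖} U Ut D DD)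
    (hδ : 0 < δ) (hA : ∀ r, ∫ z in Icc 0 S ×ˢ {x | R + δ ≤ ‖x‖ ∧ ‖x‖ ≤ r},
        energyDensity U D z.1 z.2 * Real.exp ((c / 2 + 3) * ‖z.2‖ ^ 2) ≤ A)
    (hζ : IsCutoff (closedBall 0 (2 * (α * S)) ∩ {x | R + δ ≤ inner ℝ e x})
        (closedBall 0 (α * S) ∩ {x | R + 3 * δ ≤ inner ℝ e x}) B ζ ζd ζdd)
    (hα : 4 * (c / 2 + 1) * n + 1 ≤ 2 * α * R) (hα1 : 1 ≤ α)
    (ht₂ : 0 ≤ t₂) (hαt : 1 ≤ α * (S - t₂)) (hr₀ : r₀ ≤ α * S) (hy : 3 * δ ≤ y)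
    (hθ : 6 * δ * S ≤ (S - t₂) * y) :
    ∫ z in Icc 0 t₂ ×ˢ (closedBall 0 r₀ ∩ {x | R + y ≤ inner ℝ e x}),
        energyDensity U D z.1 z.2 ≤
      ((3 * c + 15 * B) / 2 + 6 * (1 + B)) * A * (α * Real.exp (-(3 * δ * S) * α)) := by
  have hB : 0 ≤ B := le_trans (by positivity) (hζ.grad_le 0)
  have hα0 : 0 < α := by linarith
  have hSt : 0 < S - t₂ := by
    by_contra! h
    nlinarith
  have hS : 0 < S := by linarith
  have hαS : 0 < α * S := mul_pos hα0 hS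
  set g : ℝ → EuclideanSpace ℝ (Fin n) → ℝ := halfSpaceWeight (c / 2 + 1) α R S e with hgdef
  set K := closedBall (0 : EuclideanSpace ℝ (Fin n)) (2 * (α * S)) ∩ {x | R + δ ≤ inner ℝ e x}
    with hK
  set G := closedBall (0 : EuclideanSpace ℝ (Fin n)) (α * S) ∩ {x | R + 3 * δ ≤ inner ℝ e x}
    with hG
  set N := closedBall (0 : EuclideanSpace ℝ (Fin n)) r₀ ∩ {x | R + y ≤ inner ℝ e x} with hN
  set T₀ := S - 1 / α with hT₀
  have hT₀t : t₂ ≤ T₀ := by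
    have : 1 / α ≤ S - t₂ := by rw [div_le_iff₀ hα0]; linarith
    linarith
  have hT₀S : T₀ < S := by
    have : 0 < 1 / α := by positivity
    linarith
  have hKc : IsCompact K := isCompact_halfBall _ _ _
  have hGc : IsCompact G := isCompact_halfBall _ _ _
  have hNc : IsCompact N := isCompact_halfBall _ _ _
  have hKΩ : K ⊆ {x | R < ‖x‖} := halfBall_subset_norm_gt he (by linarith)
  have hNKG : N ⊆ K ∩ G := fun x hx => by
    have h1 : ‖x‖ ≤ r₀ := mem_closedBall_zero_iff.1 hx.1
    have h2 : R + y ≤ inner ℝ e x := hx.2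
    refine ⟨⟨mem_closedBall_zero_iff.2 (by linarith), show R + δ ≤ inner ℝ e x by linarith⟩,
      mem_closedBall_zero_iff.2 (by linarith), show R + 3 * δ ≤ inner ℝ e x by linarith⟩
  obtain ⟨hgc, hcarl⟩ := hU.carleman_halfBall hc hR he hδ hζ hα (ht₂.trans hT₀t) hT₀S hNKG
    hNc.isClosed.measurableSet hgdef
  have hann := isCompact_annulus (n := n) (R + δ) (2 * (α * S))
  have hannΩ : {x : EuclideanSpace ℝ (Fin n) | R + δ ≤ ‖x‖ ∧ ‖x‖ ≤ 2 * (α * S)} ⊆ {x | R < ‖x‖} :=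
    fun x hx => by
      have : R + δ ≤ ‖x‖ := hx.1
      change R < ‖x‖
      linarith
  have hKann : K ⊆ {x | R + δ ≤ ‖x‖ ∧ ‖x‖ ≤ 2 * (α * S)} := fun x hx =>
    ⟨le_trans (show R + δ ≤ inner ℝ e x from hx.2) (inner_le_norm_of_unit he x),
      mem_closedBall_zero_iff.1 hx.1⟩
  have hh : ContinuousOn (Function.uncurry fun (_ : ℝ) (x : EuclideanSpace ℝ (Fin n)) =>
      (c / 2 + 3) * ‖x‖ ^ 2) (Icc 0 S ×ˢ univ) := by
    unfold Function.uncurry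
    fun_prop
  have hyK : ∀ x ∈ K, 0 ≤ inner ℝ e x - R ∧ inner ℝ e x - R ≤ ‖x‖ := fun x hx => by
    have h1 : R + δ ≤ inner ℝ e x := hx.2
    have h2 := inner_le_norm_of_unit he x
    constructor <;> linarith
  have e1 : ∫ z in Icc 0 S ×ˢ (K \ G), energyDensity U D z.1 z.2 * Real.exp (g z.1 z.2) ≤
      Real.exp (3 * δ * S * α) * A := by
    refine (setIntegral_mul_exp_le_mul hU hann hannΩ hgc hh (b := 3 * δ * S * α)
      (prod_mono_right (sdiff_subset.trans hKann))
      (measurableSet_Icc.prod (hKc.isClosed.measurableSet.diff hGc.isClosed.measurableSet))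
      ?_).trans (mul_le_mul_of_nonneg_left (hA _) (Real.exp_pos _).le)
    rintro ⟨t, x⟩ ⟨ht, hxK, hxG⟩
    obtain ⟨h1, h2⟩ := hyK x hxK
    have h3 : 0 ≤ S - t := by linarith [ht.2]
    have h4 : S - t ≤ S := by linarith [ht.1]
    have h5 : α * (S - t) * (inner ℝ e x - R) ≤ α * S * (inner ℝ e x - R) := by gcongr
    have h6 : α * S * (inner ℝ e x - R) ≤ 3 * δ * S * α + ‖x‖ ^ 2 := by
      rcases le_or_gt (R + 3 * δ) (inner ℝ e x) with h | h
      · have h7 : α * S < ‖x‖ := by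
          by_contra! h8
          exact hxG ⟨mem_closedBall_zero_iff.2 h8, h⟩
        have h8 : α * S * (inner ℝ e x - R) ≤ ‖x‖ * ‖x‖ := by gcongr
        have : 0 ≤ 3 * δ * S * α := by positivity
        nlinarith
      · have : α * S * (inner ℝ e x - R) ≤ α * S * (3 * δ) := by gcongr; linarith
        nlinarith [sq_nonneg ‖x‖]
    change α * (S - t) * (inner ℝ e x - R) + (c / 2 + 1) * ‖x‖ ^ 2 ≤ _ + (c / 2 + 3) * ‖x‖ ^ 2
    nlinarith [sq_nonneg ‖x‖]
  have e2 : ∫ z in Icc T₀ S ×ˢ K, energyDensity U D z.1 z.2 * Real.exp (g z.1 z.2) ≤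
      Real.exp 1 * A := by
    refine (setIntegral_mul_exp_le_mul hU hann hannΩ hgc hh (b := 1)
      (prod_mono (Icc_subset_Icc_left (ht₂.trans hT₀t)) hKann)
      (measurableSet_Icc.prod hKc.isClosed.measurableSet)
      ?_).trans (mul_le_mul_of_nonneg_left (hA _) (Real.exp_pos _).le)
    rintro ⟨t, x⟩ ⟨ht, hxK⟩
    obtain ⟨h1, h2⟩ := hyK x hxK
    have h3 : α * (S - t) ≤ 1 := by
      have : S - t ≤ 1 / α := by linarith [ht.1]
      rw [le_div_iff₀ hα0] at this
      linarith
    have h4 : α * (S - t) * (inner ℝ e x - R) ≤ 1 * (inner ℝ e x - R) := by gcongr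
    change α * (S - t) * (inner ℝ e x - R) + (c / 2 + 1) * ‖x‖ ^ 2 ≤ _ + (c / 2 + 3) * ‖x‖ ^ 2
    nlinarith [sq_nonneg (‖x‖ - 1)]
  have hA0 : 0 ≤ A := (integral_nonneg fun z => mul_nonneg (energyDensity_nonneg U D z.1 z.2)
    (Real.exp_pos _).le).trans (hA 0)
  have e3 : Real.exp (6 * δ * S * α) * ∫ z in Icc 0 t₂ ×ˢ N, energyDensity U D z.1 z.2 ≤
      ∫ z in Icc 0 T₀ ×ˢ N, energyDensity U D z.1 z.2 * Real.exp (g z.1 z.2) := by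
    refine le_setIntegral_mul_exp hU hNc (hNKG.trans (inter_subset_left.trans hKΩ)) hgc
      (prod_mono_left (Icc_subset_Icc_right hT₀t)) (prod_mono_left (Icc_subset_Icc_right hT₀S.le))
      (measurableSet_Icc.prod hNc.isClosed.measurableSet) ?_
    rintro ⟨t, x⟩ ⟨ht, hx⟩
    have h1 : R + y ≤ inner ℝ e x := hx.2
    have h2 : S - t₂ ≤ S - t := by linarith [ht.2]
    have h3 : α * (S - t₂) * y ≤ α * (S - t) * (inner ℝ e x - R) := by
      have : y ≤ inner ℝ e x - R := by linarith
      have : 0 ≤ y := by linarith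
      have : 0 ≤ S - t := by linarith
      gcongr
    have h4 : 6 * δ * S * α ≤ (S - t₂) * y * α := by gcongr
    change _ ≤ α * (S - t) * (inner ℝ e x - R) + (c / 2 + 1) * ‖x‖ ^ 2
    have : 0 ≤ (c / 2 + 1) * ‖x‖ ^ 2 := by positivity
    linarith
  have e4 : S - T₀ = α⁻¹ := by rw [hT₀]; ring
  rw [e4, inv_inv] at hcarl
  have hexp3 : Real.exp 1 ≤ 3 * Real.exp (3 * δ * S * α) := by
    have : 1 ≤ Real.exp (3 * δ * S * α) := Real.one_le_exp (by positivity)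
    linarith [Real.exp_one_lt_d9]
  set I := ∫ z in Icc 0 t₂ ×ˢ N, energyDensity U D z.1 z.2 with hI
  have e5 : Real.exp (6 * δ * S * α) * I ≤
      ((3 * c + 15 * B) / 2 + 6 * (1 + B)) * A * (α * Real.exp (3 * δ * S * α)) := by
    calc _ ≤ _ := e3.trans hcarl
      _ ≤ (3 * c + 15 * B) / 2 * (α * (Real.exp (3 * δ * S * α) * A)) +
          2 * (1 + B) * (α * (3 * Real.exp (3 * δ * S * α) * A)) := by
        gcongr
        · refine e1.trans (le_mul_of_one_le_left (by positivity) hα1)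
        · exact e2.trans (by gcongr)
      _ = _ := by ring
  have e6 : I = Real.exp (-(6 * δ * S * α)) * (Real.exp (6 * δ * S * α) * I) := by
    rw [← mul_assoc, ← Real.exp_add]; simp
  have e7 : Real.exp (-(3 * δ * S) * α) = Real.exp (-(6 * δ * S * α)) * Real.exp (3 * δ * S * α) := by
    rw [← Real.exp_add]; congr 1; ring
  rw [e6, e7]
  calc _ ≤ Real.exp (-(6 * δ * S * α)) * (((3 * c + 15 * B) / 2 + 6 * (1 + B)) * A *
        (α * Real.exp (3 * δ * S * α))) := by gcongr
    _ = _ := by ring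

/-- Vanishing in half-spaces under a weighted integrability hypothesis. -/
lemma IsSubsol.eq_zero_of_weighted_bound (hc : 0 ≤ c) (hR : 0 < R) {S : ℝ} (hS : 0 < S)
    (hU : IsSubsol S c {x | R < ‖x‖} U Ut D DD)
    (hA : ∀ δ : ℝ, 0 < δ → ∃ A, 0 ≤ A ∧ ∀ r, ∫ z in Icc 0 S ×ˢ {x | R + δ ≤ ‖x‖ ∧ ‖x‖ ≤ r},
        energyDensity U D z.1 z.2 * Real.exp ((c / 2 + 3) * ‖z.2‖ ^ 2) ≤ A)
    {t : ℝ} (ht : t ∈ Ioo 0 S) {x : EuclideanSpace ℝ (Fin n)} (hx : R < ‖x‖) :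
    energyDensity U D t x = 0 := by
  have hx0 : 0 < ‖x‖ := hR.trans hx
  set e : EuclideanSpace ℝ (Fin n) := ‖x‖⁻¹ • x with hedef
  have he : ‖e‖ = 1 := by
    rw [hedef, norm_smul, norm_inv, norm_norm, inv_mul_cancel₀ hx0.ne']
  have hex : inner ℝ e x = ‖x‖ := by
    rw [hedef, real_inner_smul_left, real_inner_self_eq_norm_sq]
    field_simp
  set y := (‖x‖ - R) / 2 with hy
  set t₂ := (t + S) / 2 with ht₂
  have hy0 : 0 < y := by rw [hy]; linarith
  have ht0 : 0 < t := ht.1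
  have htS : t < S := ht.2
  have hSt : 0 < S - t₂ := by linarith
  set δ := (S - t₂) * y / (6 * S) with hδdef
  have hδ : 0 < δ := by positivity
  have hθ : 6 * δ * S = (S - t₂) * y := by rw [hδdef]; field_simp
  have hδy : 3 * δ ≤ y := by
    have : 6 * δ * S ≤ S * y := by rw [hθ]; gcongr; linarith
    nlinarith
  obtain ⟨A, hA0, hA⟩ := hA δ hδ
  obtain ⟨B, hB0, hB⟩ := exists_cutoff_halfBall he R hδ
  set N := closedBall (0 : EuclideanSpace ℝ (Fin n)) (‖x‖ + 1) ∩ {x | R + y ≤ inner ℝ e x} with hN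
  have hNc : IsCompact N := isCompact_halfBall _ _ _
  have hNΩ : N ⊆ {x | R < ‖x‖} := halfBall_subset_norm_gt he (by linarith)
  set I := ∫ z in Icc 0 t₂ ×ˢ N, energyDensity U D z.1 z.2 with hI
  have hI0 : 0 ≤ I := integral_nonneg fun z => energyDensity_nonneg _ _ _ _
  have hlim : Filter.Tendsto (fun α : ℝ => ((3 * c + 15 * B) / 2 + 6 * (1 + B)) * A *
      (α * Real.exp (-(3 * δ * S) * α))) Filter.atTop (nhds 0) := by
    have h := tendsto_rpow_mul_exp_neg_mul_atTop_nhds_zero 1 (3 * δ * S) (by positivity)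
    simpa using h.const_mul (((3 * c + 15 * B) / 2 + 6 * (1 + B)) * A)
  have hle : I ≤ 0 := by
    refine ge_of_tendsto hlim ?_
    have ev : ∀ w v : ℝ, 0 < v → ∀ᶠ α : ℝ in Filter.atTop, w ≤ α * v := fun w v hv =>
      (Filter.tendsto_id.atTop_mul_const hv).eventually_ge_atTop w
    filter_upwards [Filter.eventually_ge_atTop 1, ev (4 * (c / 2 + 1) * n + 1) (2 * R) (by positivity),
      ev 1 (S - t₂) hSt, ev (‖x‖ + 1) S hS, ev 1 S hS] with α h1 h2 h3 h4 h5
    obtain ⟨ζ, ζd, ζdd, hζ⟩ := hB (α * S) h5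
    exact hU.halfBall_le hc hR he hδ hA hζ (by linarith) h1 (by linarith) h3 h4 hδy hθ.le
  have hsub : Ioo 0 t₂ ×ˢ (ball 0 (‖x‖ + 1) ∩ {x | R + y < inner ℝ e x}) ⊆ Icc 0 t₂ ×ˢ N :=
    prod_mono Ioo_subset_Icc_self (inter_subset_inter ball_subset_closedBall
      fun z hz => le_of_lt (show R + y < inner ℝ e z from hz))
  have hUt := hU.mono_time (show t₂ ≤ S by linarith)
  have hae : (fun z : ℝ × EuclideanSpace ℝ (Fin n) => energyDensity U D z.1 z.2) =ᵐ[volume.restrict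
      (Icc 0 t₂ ×ˢ N)] 0 :=
    (setIntegral_eq_zero_iff_of_nonneg_ae (Filter.Eventually.of_forall fun z =>
      energyDensity_nonneg _ _ _ _) (hUt.integrableOn_density hNc hNΩ)).1 (le_antisymm hle hI0)
  have hopen : IsOpen (Ioo 0 t₂ ×ˢ (ball (0 : EuclideanSpace ℝ (Fin n)) (‖x‖ + 1) ∩
      {x | R + y < inner ℝ e x})) :=
    isOpen_Ioo.prod (isOpen_ball.inter (isOpen_lt continuous_const (by fun_prop)))
  have heq := Measure.eqOn_open_of_ae_eq (ae_restrict_of_ae_restrict_of_subset hsub hae) hopen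
    (hUt.continuousOn_density.mono (hsub.trans (prod_mono_right hNΩ))) continuousOn_const
  refine heq (x := (t, x)) ⟨⟨ht0, by linarith⟩, mem_ball_zero_iff.2 (by linarith), ?_⟩
  change R + y < inner ℝ e x
  rw [hex]
  linarith

lemma eq_zero_of_energyDensity_eq_zero {t : ℝ} {x : EuclideanSpace ℝ (Fin n)}
    (h : energyDensity U D t x = 0) (k : Fin n) : U k t x = 0 := by
  have h1 := sum_sq_le_energyDensity (U := U) (D := D) t x
  have h2 := Finset.single_le_sum (f := fun k => U k t x ^ 2) (fun i _ => sq_nonneg _)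
    (Finset.mem_univ k)
  have h3 : U k t x ^ 2 ≤ 0 := by
    linarith
  exact pow_eq_zero_iff two_ne_zero |>.1 (le_antisymm h3 (sq_nonneg _))

/-- Local-in-time backward uniqueness. -/
lemma IsSubsol.exists_eq_zero (hT : 0 < T) (hc : 0 ≤ c) (hR : 0 < R) (hM : 0 ≤ M)
    (hU : IsSubsol T c {x | R < ‖x‖} U Ut D DD)
    (hgr : ∀ t ∈ Icc 0 T, ∀ x, R < ‖x‖ → ∑ k, U k t x ^ 2 ≤ Real.exp (2 * M * ‖x‖ ^ 2)) :
    ∃ t₀, 0 < t₀ ∧ t₀ ≤ T ∧ ∀ t ∈ Ioo 0 t₀, ∀ x, R < ‖x‖ → ∀ k, U k t x = 0 := by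
  obtain ⟨t₀, h0, hle, h⟩ := hU.exists_weighted_bound hT hc hR hM hgr
    (κ := c / 2 + 3) (by positivity)
  exact ⟨t₀, h0, hle, fun t ht x hx k => eq_zero_of_energyDensity_eq_zero
    ((hU.mono_time hle).eq_zero_of_weighted_bound hc hR h0 h ht hx) k⟩

end HalfSpace

section Iteration
variable {T c R M : ℝ} {Ω : Set (EuclideanSpace ℝ (Fin n))}
  {U Ut : Fin n → ℝ → EuclideanSpace ℝ (Fin n) → ℝ}
  {D : Fin n → Fin n → ℝ → EuclideanSpace ℝ (Fin n) → ℝ}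
  {DD : Fin n → Fin n → Fin n → ℝ → EuclideanSpace ℝ (Fin n) → ℝ}

lemma ContinuousOn.uncurry_comp_add_const {f : ℝ → EuclideanSpace ℝ (Fin n) → ℝ} {s : ℝ}
    (hf : ContinuousOn (Function.uncurry f) (Icc 0 T ×ˢ Ω)) (hs : 0 ≤ s) :
    ContinuousOn (Function.uncurry fun t x => f (t + s) x) (Icc 0 (T - s) ×ˢ Ω) := by
  refine hf.comp (g := Function.uncurry f) (f := fun p : ℝ × EuclideanSpace ℝ (Fin n) =>
    (p.1 + s, p.2)) (by fun_prop) ?_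
  rintro ⟨t, x⟩ ⟨ht, hx⟩
  exact ⟨⟨by linarith [ht.1], by linarith [ht.2]⟩, hx⟩

lemma IsSubsol.time_shift (hU : IsSubsol T c Ω U Ut D DD) {s : ℝ} (hs : 0 ≤ s)
    (h0 : ∀ k, ∀ x ∈ Ω, U k s x = 0) :
    IsSubsol (T - s) c Ω (fun k t => U k (t + s)) (fun k t => Ut k (t + s))
      (fun k i t => D k i (t + s)) (fun k i j t => DD k i j (t + s)) := by
  have hmem : ∀ t ∈ Icc 0 (T - s), t + s ∈ Icc 0 T := fun t ht =>
    ⟨by linarith [ht.1], by linarith [ht.2]⟩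
  refine ⟨fun k => ⟨(hU.regular k).cont.uncurry_comp_add_const hs,
    (hU.regular k).cont_t.uncurry_comp_add_const hs,
    fun i => ((hU.regular k).cont_d i).uncurry_comp_add_const hs,
    fun i j => ((hU.regular k).cont_dd i j).uncurry_comp_add_const hs,
    fun t ht x hx => ?_, fun t ht => (hU.regular k).deriv_d _ (hmem t ht),
    fun t ht => (hU.regular k).deriv_dd _ (hmem t ht),
    fun t ht => (hU.regular k).symm _ (hmem t ht)⟩, fun t ht => hU.ineq _ (hmem t ht), ?_⟩
  · have h := (hU.regular k).deriv_t (t + s) ⟨by linarith [ht.1], by linarith [ht.2]⟩ x hx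
    exact h.comp_add_const t s
  · intro k x hx
    simpa using h0 k x hx

lemma IsSubsol.eq_zero_right (hU : IsSubsol T c Ω U Ut D DD) {τ : ℝ} (hτ0 : 0 ≤ τ) (hτT : τ ≤ T)
    {x : EuclideanSpace ℝ (Fin n)} (hx : x ∈ Ω) (k : Fin n) (h : ∀ t ∈ Ioo 0 τ, U k t x = 0) :
    U k τ x = 0 := by
  rcases hτ0.eq_or_lt with rfl | hτ
  · exact hU.zero k x hx
  have hc : ContinuousOn (fun t => U k t x) (Icc 0 τ) :=
    (hU.regular k).cont.comp (g := Function.uncurry (U k)) (f := fun t => (t, x)) (by fun_prop)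
      fun t ht => ⟨⟨ht.1, ht.2.trans hτT⟩, hx⟩
  have hEq : EqOn (fun t => U k t x) (fun _ => 0) (Ioo 0 τ) := fun t ht => h t ht
  exact hEq.of_subset_closure hc continuousOn_const Ioo_subset_Icc_self
    (by rw [closure_Ioo hτ.ne]) ⟨hτ.le, le_rfl⟩

/-- Backward uniqueness for `|∂ₜu + Δu|² ≤ c (|u|² + |∇u|²)` in exterior domains. -/
lemma IsSubsol.eq_zero (hT : 0 < T) (hc : 0 ≤ c) (hR : 0 < R) (hM : 0 ≤ M)
    (hU : IsSubsol T c {x | R < ‖x‖} U Ut D DD)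
    (hgr : ∀ t ∈ Icc 0 T, ∀ x, R < ‖x‖ → ∑ k, U k t x ^ 2 ≤ Real.exp (2 * M * ‖x‖ ^ 2)) :
    ∀ t ∈ Icc 0 T, ∀ x, R < ‖x‖ → ∀ k, U k t x = 0 := by
  set A : Set ℝ := {τ | τ ∈ Icc 0 T ∧ ∀ t ∈ Ioo 0 τ, ∀ x, R < ‖x‖ → ∀ k, U k t x = 0} with hA
  have hA0 : (0 : ℝ) ∈ A := ⟨⟨le_rfl, hT.le⟩, fun t ht => absurd (ht.1.trans ht.2) (lt_irrefl _)⟩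
  have hAb : BddAbove A := ⟨T, fun τ hτ => hτ.1.2⟩
  set s := sSup A with hs
  have hs0 : 0 ≤ s := le_csSup hAb hA0
  have hsT : s ≤ T := csSup_le ⟨0, hA0⟩ fun τ hτ => hτ.1.2
  have hlt : ∀ t ∈ Ioo 0 s, ∀ x, R < ‖x‖ → ∀ k, U k t x = 0 := fun t ht => by
    obtain ⟨τ, hτ, htτ⟩ := exists_lt_of_lt_csSup ⟨0, hA0⟩ ht.2
    exact hτ.2 t ⟨ht.1, htτ⟩
  have hle : ∀ t ∈ Icc 0 s, ∀ x, R < ‖x‖ → ∀ k, U k t x = 0 := fun t ht x hx k =>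
    hU.eq_zero_right ht.1 (ht.2.trans hsT) hx k fun t' ht' =>
      hlt t' ⟨ht'.1, ht'.2.trans_le ht.2⟩ x hx k
  rcases hsT.eq_or_lt with h | h
  · rwa [h] at hle
  · exfalso
    obtain ⟨t₀, h0, h1, h2⟩ := (hU.time_shift hs0 fun k x hx => hle s ⟨hs0, le_rfl⟩ x hx k
      ).exists_eq_zero (sub_pos.2 h) hc hR hM fun t ht x hx =>
        hgr (t + s) ⟨by linarith [ht.1], by linarith [ht.2]⟩ x hx
    have hmem : s + t₀ ∈ A := by
      refine ⟨⟨by linarith, by linarith⟩, fun t ht x hx k => ?_⟩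
      rcases le_or_gt t s with h3 | h3
      · exact hle t ⟨ht.1.le, h3⟩ x hx k
      · simpa using h2 (t - s) ⟨by linarith, by linarith [ht.2]⟩ x hx k
    linarith [le_csSup hAb hmem]

end Iteration

section Components

lemma ContinuousLinearMap.opNorm_sq_le_sum_sq
    (A : EuclideanSpace ℝ (Fin n) →L[ℝ] EuclideanSpace ℝ (Fin n)) :
    ‖A‖ ^ 2 ≤ ∑ k, ∑ i, (A (EuclideanSpace.single i 1) k) ^ 2 := by
  have hsum : ∑ k, ∑ i, (A (EuclideanSpace.single i 1) k) ^ 2 =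
      ∑ i, ‖A (EuclideanSpace.single i 1)‖ ^ 2 := by
    rw [Finset.sum_comm]
    simp only [EuclideanSpace.real_norm_sq_eq]
  rw [hsum]
  set Q := ∑ i, ‖A (EuclideanSpace.single i 1)‖ ^ 2 with hQ
  have hQ0 : 0 ≤ Q := by positivity
  have h : ‖A‖ ≤ √Q := by
    refine A.opNorm_le_bound (Real.sqrt_nonneg _) fun v => ?_
    have hv : v = ∑ i, v i • (EuclideanSpace.single i 1 : EuclideanSpace ℝ (Fin n)) := by
      ext j
      simp [Pi.single_apply]
    have h1 : ‖A v‖ ≤ ∑ i, ‖A (EuclideanSpace.single i 1)‖ * ‖v i‖ := by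
      conv_lhs => rw [hv, map_sum]
      refine (norm_sum_le _ _).trans (Finset.sum_le_sum fun i _ => ?_)
      rw [map_smul, norm_smul, mul_comm]
    have h2 := Real.sum_mul_le_sqrt_mul_sqrt Finset.univ
      (fun i => ‖A (EuclideanSpace.single i 1)‖) (fun i => ‖v i‖)
    rw [← EuclideanSpace.norm_eq] at h2
    exact h1.trans h2
  calc ‖A‖ ^ 2 ≤ √Q ^ 2 := by gcongr
    _ = Q := Real.sq_sqrt hQ0

lemma HasFDerivAt.hasLineDerivAt_comp {F : Type*} [NormedAddCommGroup F] [NormedSpace ℝ F]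
    {f : EuclideanSpace ℝ (Fin n) → F} {f' : EuclideanSpace ℝ (Fin n) →L[ℝ] F}
    {x : EuclideanSpace ℝ (Fin n)} (hf : HasFDerivAt f f' x) (L : F →L[ℝ] ℝ)
    (v : EuclideanSpace ℝ (Fin n)) : HasLineDerivAt ℝ (fun y => L (f y)) (L (f' v)) x v :=
  (L.hasFDerivAt.comp x hf).hasLineDerivAt v

/-- The components of a `C^{2,1}` vector field satisfying the differential inequality. -/
lemma isSubsol_components {R T c₁ : ℝ} (hc₁ : 0 < c₁)
    {u ut : EuclideanSpace ℝ (Fin n) × ℝ → EuclideanSpace ℝ (Fin n)}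
    {du : EuclideanSpace ℝ (Fin n) × ℝ →
      EuclideanSpace ℝ (Fin n) →L[ℝ] EuclideanSpace ℝ (Fin n)}
    {d2u : EuclideanSpace ℝ (Fin n) × ℝ →
      EuclideanSpace ℝ (Fin n) →L[ℝ] EuclideanSpace ℝ (Fin n) →L[ℝ] EuclideanSpace ℝ (Fin n)}
    (hu_cont : ContinuousOn u (extRegion n R ×ˢ Icc 0 T))
    (hut : ∀ z ∈ extRegion n R ×ˢ Icc 0 T,
      HasDerivWithinAt (fun s => u (z.1, s)) (ut z) (Icc 0 T) z.2)
    (hut_cont : ContinuousOn ut (extRegion n R ×ˢ Icc 0 T))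
    (hdu : ∀ z ∈ extRegion n R ×ˢ Icc 0 T,
      HasFDerivWithinAt (fun x => u (x, z.2)) (du z) (extRegion n R) z.1)
    (hdu_cont : ContinuousOn du (extRegion n R ×ˢ Icc 0 T))
    (hd2u : ∀ z ∈ extRegion n R ×ˢ Icc 0 T,
      HasFDerivWithinAt (fun x => du (x, z.2)) (d2u z) (extRegion n R) z.1)
    (hd2u_cont : ContinuousOn d2u (extRegion n R ×ˢ Icc 0 T))
    (ha : ∀ z ∈ extRegion n R ×ˢ Icc 0 T,
      ‖ut z + ∑ i, d2u z (EuclideanSpace.single i 1) (EuclideanSpace.single i 1)‖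
        ≤ c₁ * (‖du z‖ + ‖u z‖))
    (hb : ∀ x ∈ extRegion n R, u (x, 0) = 0) :
    IsSubsol T (2 * c₁ ^ 2) {x | R < ‖x‖} (fun k t x => u (x, t) k) (fun k t x => ut (x, t) k)
      (fun k i t x => du (x, t) (EuclideanSpace.single i 1) k)
      (fun k i j t x => d2u (x, t) (EuclideanSpace.single i 1) (EuclideanSpace.single j 1) k) := by
  have hsub : ∀ x : EuclideanSpace ℝ (Fin n), R < ‖x‖ → x ∈ extRegion n R := fun x hx => hx.le
  have hnhds : ∀ x : EuclideanSpace ℝ (Fin n), R < ‖x‖ → extRegion n R ∈ nhds x := fun x hx =>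
    Filter.mem_of_superset ((isOpen_norm_gt R).mem_nhds hx) hsub
  have hswap : ∀ {F : Type} [TopologicalSpace F] {f : EuclideanSpace ℝ (Fin n) × ℝ → F},
      ContinuousOn f (extRegion n R ×ˢ Icc 0 T) →
      ContinuousOn (fun p : ℝ × EuclideanSpace ℝ (Fin n) => f (p.2, p.1))
        (Icc 0 T ×ˢ {x | R < ‖x‖}) := by
    intro F _ f hf
    refine hf.comp (f := fun p : ℝ × EuclideanSpace ℝ (Fin n) => (p.2, p.1)) (by fun_prop) ?_
    rintro ⟨t, x⟩ ⟨ht, hx⟩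
    exact ⟨hsub x hx, ht⟩
  have hdu' : ∀ t ∈ Icc 0 T, ∀ x : EuclideanSpace ℝ (Fin n), R < ‖x‖ →
      HasFDerivAt (fun y => u (y, t)) (du (x, t)) x := fun t ht x hx =>
    (hdu (x, t) ⟨hsub x hx, ht⟩).hasFDerivAt (hnhds x hx)
  have hd2u' : ∀ t ∈ Icc 0 T, ∀ x : EuclideanSpace ℝ (Fin n), R < ‖x‖ →
      HasFDerivAt (fun y => du (y, t)) (d2u (x, t)) x := fun t ht x hx =>
    (hd2u (x, t) ⟨hsub x hx, ht⟩).hasFDerivAt (hnhds x hx)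
  have hproj : ∀ (k : Fin n) {f : ℝ × EuclideanSpace ℝ (Fin n) → EuclideanSpace ℝ (Fin n)}
      {s : Set (ℝ × EuclideanSpace ℝ (Fin n))}, ContinuousOn f s →
      ContinuousOn (fun p => f p k) s := fun k _ _ hf =>
    (EuclideanSpace.proj (𝕜 := ℝ) k).continuous.comp_continuousOn hf
  have cu := hswap hu_cont
  have cut := hswap hut_cont
  have cdu := hswap hdu_cont
  have cd2u := hswap hd2u_cont
  refine ⟨fun k => ⟨?_, ?_, fun i => ?_, fun i j => ?_, fun t ht x hx => ?_,
    fun t ht x hx i => ?_, fun t ht x hx i j => ?_, fun t ht x hx i j => ?_⟩, fun t ht x hx => ?_,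
    fun k x hx => ?_⟩
  · exact hproj k cu
  · exact hproj k cut
  · exact hproj k (cdu.clm_apply continuousOn_const)
  · exact hproj k ((cd2u.clm_apply continuousOn_const).clm_apply continuousOn_const)
  · have h := (hut (x, t) ⟨hsub x hx, Ioo_subset_Icc_self ht⟩).hasDerivAt (Icc_mem_nhds ht.1 ht.2)
    exact ((EuclideanSpace.proj k : EuclideanSpace ℝ (Fin n) →L[ℝ] ℝ).hasFDerivAt.comp_hasDerivAt t h)
  · exact (hdu' t ht x hx).hasLineDerivAt_comp (EuclideanSpace.proj k) _
  · exact (hd2u' t ht x hx).hasLineDerivAt_comp ((EuclideanSpace.proj k).comp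
      (ContinuousLinearMap.apply ℝ (EuclideanSpace ℝ (Fin n)) (EuclideanSpace.single j 1))) _
  · have h := second_derivative_symmetric_of_eventually (f := fun y => u (y, t))
      (f' := fun y => du (y, t)) (Filter.mem_of_superset ((isOpen_norm_gt R).mem_nhds hx)
        fun y hy => hdu' t ht y hy) (hd2u' t ht x hx) (EuclideanSpace.single i 1)
        (EuclideanSpace.single j 1)
    simp only [h]
  · have h1 := ha (x, t) ⟨hsub x hx, ht⟩
    have h2 : ∑ k, (ut (x, t) k + ∑ i, d2u (x, t) (EuclideanSpace.single i 1)
        (EuclideanSpace.single i 1) k) ^ 2 = ‖ut (x, t) + ∑ i, d2u (x, t)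
          (EuclideanSpace.single i 1) (EuclideanSpace.single i 1)‖ ^ 2 := by
      rw [EuclideanSpace.real_norm_sq_eq]
      simp
    have h3 := (du (x, t)).opNorm_sq_le_sum_sq
    have h4 := EuclideanSpace.real_norm_sq_eq (u (x, t))
    have h5 : ‖ut (x, t) + ∑ i, d2u (x, t) (EuclideanSpace.single i 1)
        (EuclideanSpace.single i 1)‖ ^ 2 ≤ (c₁ * (‖du (x, t)‖ + ‖u (x, t)‖)) ^ 2 := by gcongr
    rw [h2]
    unfold energyDensity
    rw [Finset.sum_add_distrib, ← h4]
    refine h5.trans ?_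
    rw [mul_pow]
    have h6 := add_sq_le (a := ‖du (x, t)‖) (b := ‖u (x, t)‖)
    calc c₁ ^ 2 * (‖du (x, t)‖ + ‖u (x, t)‖) ^ 2
        ≤ c₁ ^ 2 * (2 * (‖du (x, t)‖ ^ 2 + ‖u (x, t)‖ ^ 2)) := by gcongr
      _ ≤ c₁ ^ 2 * (2 * ((∑ k, ∑ i, (du (x, t) (EuclideanSpace.single i 1) k) ^ 2)
            + ‖u (x, t)‖ ^ 2)) := by gcongr
      _ = _ := by ring
  · simp [hb x (hsub x hx)]

lemma extRegion_subset_closure {R : ℝ} (hR : 0 < R) :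
    extRegion n R ⊆ closure {x : EuclideanSpace ℝ (Fin n) | R < ‖x‖} := by
  intro x hx
  have hx : R ≤ ‖x‖ := hx
  have hlim : Filter.Tendsto (fun a : ℝ => a • x) (nhdsWithin 1 (Ioi 1)) (nhds x) := by
    have h : Continuous fun a : ℝ => a • x := by fun_prop
    simpa using (h.tendsto 1).mono_left nhdsWithin_le_nhds
  refine mem_closure_of_tendsto hlim ?_
  filter_upwards [self_mem_nhdsWithin] with a ha
  have ha : 1 < a := ha
  change R < ‖a • x‖
  rw [norm_smul, Real.norm_of_nonneg (by linarith)]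
  nlinarith

end Components

end Auxiliary

/-- **Backward uniqueness for the heat operator.** Let `u` be a `C^{2,1}` function on
`(ℝⁿ ∖ B_R(0)) × [0,T]` (here encoded via its continuous time-derivative `ut`, spatial
gradient `du` and spatial Hessian `d2u`), satisfying `|∂ₜu + Δu| ≤ c₁(|∇u| + |u|)`,
`u(·,0) = 0` and the growth bound `|u(x,t)| ≤ exp(M|x|²)`. Then `u ≡ 0` on
`(ℝⁿ ∖ B_R(0)) × [0,T]`. -/
theorem backward_uniqueness_heat
    (n : ℕ) (hn : 1 ≤ n) (R T c₁ M : ℝ) (hR : 0 < R) (hT : 0 < T)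
    (hc₁ : 0 < c₁) (hM : 0 < M)
    (u ut : EuclideanSpace ℝ (Fin n) × ℝ → EuclideanSpace ℝ (Fin n))
    (du : EuclideanSpace ℝ (Fin n) × ℝ →
      EuclideanSpace ℝ (Fin n) →L[ℝ] EuclideanSpace ℝ (Fin n))
    (d2u : EuclideanSpace ℝ (Fin n) × ℝ →
      EuclideanSpace ℝ (Fin n) →L[ℝ] EuclideanSpace ℝ (Fin n) →L[ℝ] EuclideanSpace ℝ (Fin n))
    -- `u` is continuous on `(ℝⁿ ∖ B_R(0)) × [0,T]` together with `∂ₜu`, `∇u`, `∇²u`: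
    (hu_cont : ContinuousOn u (extRegion n R ×ˢ Icc 0 T))
    (hut : ∀ z ∈ extRegion n R ×ˢ Icc 0 T,
      HasDerivWithinAt (fun s => u (z.1, s)) (ut z) (Icc 0 T) z.2)
    (hut_cont : ContinuousOn ut (extRegion n R ×ˢ Icc 0 T))
    (hdu : ∀ z ∈ extRegion n R ×ˢ Icc 0 T,
      HasFDerivWithinAt (fun x => u (x, z.2)) (du z) (extRegion n R) z.1)
    (hdu_cont : ContinuousOn du (extRegion n R ×ˢ Icc 0 T))
    (hd2u : ∀ z ∈ extRegion n R ×ˢ Icc 0 T,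
      HasFDerivWithinAt (fun x => du (x, z.2)) (d2u z) (extRegion n R) z.1)
    (hd2u_cont : ContinuousOn d2u (extRegion n R ×ˢ Icc 0 T))
    -- (a) the differential inequality `|∂ₜu + Δu| ≤ c₁ (|∇u| + |u|)`:
    (ha : ∀ z ∈ extRegion n R ×ˢ Icc 0 T,
      ‖ut z + ∑ i, d2u z (EuclideanSpace.single i 1) (EuclideanSpace.single i 1)‖
        ≤ c₁ * (‖du z‖ + ‖u z‖))
    -- (b) vanishing at time zero:
    (hb : ∀ x ∈ extRegion n R, u (x, 0) = 0)
    -- (c) the growth bound `|u(x,t)| ≤ exp (M |x|²)`: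
    (hc : ∀ z ∈ extRegion n R ×ˢ Icc 0 T, ‖u z‖ ≤ Real.exp (M * ‖z.1‖ ^ 2)) :
    ∀ z ∈ extRegion n R ×ˢ Icc 0 T, u z = 0 := by
  have hU := isSubsol_components hc₁ hu_cont hut hut_cont hdu hdu_cont hd2u hd2u_cont ha hb
  have hzero := hU.eq_zero hT (by positivity) hR hM.le fun t ht x hx => by
    have h1 := hc (x, t) ⟨le_of_lt hx, ht⟩
    rw [← EuclideanSpace.real_norm_sq_eq]
    calc ‖u (x, t)‖ ^ 2 ≤ Real.exp (M * ‖x‖ ^ 2) ^ 2 := by gcongr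
      _ = Real.exp (2 * M * ‖x‖ ^ 2) := by rw [← Real.exp_nat_mul]; congr 1; push_cast; ring
  rintro ⟨x, t⟩ ⟨hx, ht⟩
  have hcont : ContinuousOn (fun y => u (y, t)) (extRegion n R) :=
    hu_cont.comp (f := fun y => (y, t)) (by fun_prop) fun y hy => ⟨hy, ht⟩
  have hEq : EqOn (fun y => u (y, t)) (fun _ => 0) {x | R < ‖x‖} := fun y hy => by
    ext k
    exact hzero t ht y hy k
  exact hEq.of_subset_closure hcont continuousOn_const (fun y (hy : R < ‖y‖) => hy.le)
    (extRegion_subset_closure hR) hx
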